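/- arXiv:2110.04688 — 8 statements merged into one kernel-verified Lean document; each statement's English description precedes it below -/
import Mathlib

section
/- Suppose (A1)–(A3) hold. Then for any R₀ > 0 there exists a solution (σ, R) of the evolutionary tumor problem on [0,∞) with R(0) = R₀; the radius component R is uniquely determined by R₀, and it satisfies R(t) ≥ R₀ e^{−νt/3} for all t ≥ 0 (so in particular R(t) > 0 for all time). -/
open MeasureTheory Set Filter Topology

/-- Heaviside function: `H s = 1` for `s > 0`, `H s = 0` for `s ≤ 0`. -/
noncomputable def Hside (s : ℝ) : ℝ := if 0 < s then 1 else 0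

/-- Assumption (A1)/(A2): `f ∈ C¹[0,∞)` is strictly increasing. -/
def C1StrictInc (f : ℝ → ℝ) : Prop :=
  ContDiffOn ℝ 1 f (Ici 0) ∧ StrictMonoOn f (Ici 0)

/-- Proliferation rate `S`: `S s = g s` if `s > σD`, `S s = -ν` otherwise. -/
noncomputable def Sfun (g : ℝ → ℝ) (σD ν s : ℝ) : ℝ := if σD < s then g s else -ν

/-- A solution of the stationary radial nutrient problem with boundary parameter
`σbar` and radius `R`: `σ` is continuous on `[0,R]`, differentiable on `(0,R]`
with derivative `σ'` there, satisfies
`r² σ'(r) = ∫₀^r l² f(σ l) H(σ l − σD) dl` on `(0,R]` (encoding the ODE together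
with `σ'(0) = 0`), and the Robin condition `σ'(R) + β (σ(R) − σbar) = 0`. -/
structure IsStationarySol (f : ℝ → ℝ) (β σD σbar R : ℝ) (σ σ' : ℝ → ℝ) : Prop where
  cont : ContinuousOn σ (Icc 0 R)
  deriv : ∀ r ∈ Ioc (0:ℝ) R, HasDerivWithinAt σ (σ' r) (Icc 0 R) r
  ode : ∀ r ∈ Ioc (0:ℝ) R,
    r ^ 2 * σ' r = ∫ l in (0:ℝ)..r, l ^ 2 * f (σ l) * Hside (σ l - σD)
  robin : σ' R + β * (σ R - σbar) = 0

/-- A solution of the evolutionary tumor problem on `[0,∞)`: `R` is positive and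
differentiable on `[0,∞)` with derivative `R'`, for each `t ≥ 0` the radial profile
`σ(·,t)` solves the stationary problem with parameters `φ t` and `R t`, and
`R(t)² R'(t) = ∫₀^{R(t)} S(σ(r,t)) r² dr` for `t > 0`. -/
structure IsEvolutionSol (f g : ℝ → ℝ) (β σD ν : ℝ) (φ : ℝ → ℝ)
    (σ : ℝ → ℝ → ℝ) (R R' : ℝ → ℝ) : Prop where
  pos : ∀ t ≥ (0:ℝ), 0 < R t
  stat : ∀ t ≥ (0:ℝ), ∃ σ', IsStationarySol f β σD (φ t) (R t) (fun r => σ r t) σ'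
  deriv : ∀ t ≥ (0:ℝ), HasDerivWithinAt R (R' t) (Ici 0) t
  ode : ∀ t > (0:ℝ), (R t) ^ 2 * R' t = ∫ r in (0:ℝ)..(R t), Sfun g σD ν (σ r t) * r ^ 2

section Aux

structure SS (F : ℝ → ℝ) (β s R : ℝ) (σ p : ℝ → ℝ) : Prop where
  cont : ContinuousOn σ (Icc 0 R)
  deriv : ∀ r ∈ Ioc (0:ℝ) R, HasDerivWithinAt σ (p r) (Icc 0 R) r
  ode : ∀ r ∈ Ioc (0:ℝ) R, r ^ 2 * p r = ∫ l in (0:ℝ)..r, l ^ 2 * F (σ l)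
  robin : p R + β * (σ R - s) = 0

section SSlemmas

variable {F : ℝ → ℝ} {β s R : ℝ} {σ p : ℝ → ℝ}

lemma SS.p_nonneg (h : SS F β s R σ p) (hF0 : ∀ x, 0 ≤ F x) {r : ℝ} (hr : r ∈ Ioc (0:ℝ) R) :
    0 ≤ p r := by
  have h1 := h.ode r hr
  have h2 : 0 ≤ ∫ l in (0:ℝ)..r, l ^ 2 * F (σ l) :=
    intervalIntegral.integral_nonneg hr.1.le (fun l _ => mul_nonneg (sq_nonneg l) (hF0 _))
  rw [← h1] at h2
  exact nonneg_of_mul_nonneg_right h2 (by have := hr.1; positivity)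

lemma SS.hda (h : SS F β s R σ p) {r : ℝ} (hr : r ∈ Ioo (0:ℝ) R) : HasDerivAt σ (p r) r :=
  (h.deriv r ⟨hr.1, hr.2.le⟩).hasDerivAt (Icc_mem_nhds hr.1 hr.2)

lemma SS.mono (h : SS F β s R σ p) (hF0 : ∀ x, 0 ≤ F x) : MonotoneOn σ (Icc 0 R) := by
  apply monotoneOn_of_deriv_nonneg (convex_Icc 0 R) h.cont
  · intro r hr
    rw [interior_Icc] at hr
    exact (h.hda hr).differentiableAt.differentiableWithinAt
  · intro r hr
    rw [interior_Icc] at hr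
    rw [(h.hda hr).deriv]
    exact h.p_nonneg hF0 ⟨hr.1, hr.2.le⟩

/-- integrability of monotone functions of the profile -/
lemma SS.integ (h : SS F β s R σ p) (hF0 : ∀ x, 0 ≤ F x) {T : ℝ → ℝ} (hT : Monotone T)
    {a b : ℝ} (ha : a ∈ Icc 0 R) (hb : b ∈ Icc 0 R) :
    IntervalIntegrable (fun l => l ^ 2 * T (σ l)) volume a b := by
  have h1 : MonotoneOn (fun l => T (σ l)) (uIcc a b) := by
    intro x hx y hy hxy
    have hs : uIcc a b ⊆ Icc 0 R := uIcc_subset_Icc ha hb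
    exact hT (h.mono hF0 (hs hx) (hs hy) hxy)
  exact h1.intervalIntegrable.continuousOn_mul (by fun_prop)

lemma SS.le_s (h : SS F β s R σ p) (hF0 : ∀ x, 0 ≤ F x) (hβ : 0 < β) (hR : 0 < R)
    {r : ℝ} (hr : r ∈ Icc 0 R) : σ r ≤ s := by
  have h1 := h.mono hF0 hr (right_mem_Icc.2 hR.le) hr.2
  have h2 := h.p_nonneg hF0 (r := R) ⟨hR, le_rfl⟩
  have h3 := h.robin
  have : β * (σ R - s) ≤ 0 := by linarith
  have : σ R - s ≤ 0 := by
    by_contra hc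
    push Not at hc
    have := mul_pos hβ hc
    linarith
  linarith

/-- The key maximum principle. -/
lemma SS.maxp {s' : ℝ} {σ' p' : ℝ → ℝ} (h : SS F β s R σ p) (h' : SS F β s' R σ' p')
    (hF0 : ∀ x, 0 ≤ F x) (hF : Monotone F) {r₁ : ℝ} (hr₁ : r₁ ∈ Icc 0 R) (hR : 0 < R)
    (hw : 0 < σ r₁ - σ' r₁) : σ r₁ - σ' r₁ ≤ σ R - σ' R ∧ 0 ≤ p R - p' R := by
  set w : ℝ → ℝ := fun r => σ r - σ' r with hwdef
  have hwc : ContinuousOn w (Icc 0 R) := h.cont.sub h'.cont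
  have hwd : ∀ r ∈ Ioo (0:ℝ) R, HasDerivAt w (p r - p' r) r := fun r hr => (h.hda hr).sub (h'.hda hr)
  have hmono : ∀ a b, 0 < a → a ≤ b → b ≤ R → (∀ r ∈ Ioo a b, 0 < w r) → 0 ≤ p a - p' a →
      0 ≤ p b - p' b := by
    intro a b ha hab hb hpos hpa
    have ea := h.ode a ⟨ha, hab.trans hb⟩
    have ea' := h'.ode a ⟨ha, hab.trans hb⟩
    have eb := h.ode b ⟨ha.trans_le hab, hb⟩
    have eb' := h'.ode b ⟨ha.trans_le hab, hb⟩
    have m0 : (0:ℝ) ∈ Icc 0 R := ⟨le_rfl, hR.le⟩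
    have ma : a ∈ Icc 0 R := ⟨ha.le, hab.trans hb⟩
    have mb : b ∈ Icc 0 R := ⟨(ha.trans_le hab).le, hb⟩
    have i1 := intervalIntegral.integral_add_adjacent_intervals (h.integ hF0 hF m0 ma) (h.integ hF0 hF ma mb)
    have i2 := intervalIntegral.integral_add_adjacent_intervals (h'.integ hF0 hF m0 ma) (h'.integ hF0 hF ma mb)
    have i3 : (∫ l in a..b, l ^ 2 * F (σ' l)) ≤ ∫ l in a..b, l ^ 2 * F (σ l) := by
      apply intervalIntegral.integral_mono_on_of_le_Ioo hab (h'.integ hF0 hF ma mb) (h.integ hF0 hF ma mb)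
      intro r hr
      have := hpos r hr
      exact mul_le_mul_of_nonneg_left (hF (by simp only [hwdef] at this; linarith)) (sq_nonneg r)
    have h4 : 0 ≤ a ^ 2 * (p a - p' a) := by positivity
    have h5 : 0 ≤ b ^ 2 * (p b - p' b) := by nlinarith
    exact nonneg_of_mul_nonneg_right h5 (by have := ha.trans_le hab; positivity)
  -- starting point
  have start : ∃ r₀ ∈ Icc 0 r₁, 0 < w r₀ ∧ (∀ r ∈ Icc r₀ r₁, 0 < w r) ∧
      ((0 < r₀ ∧ 0 ≤ p r₀ - p' r₀) ∨ r₀ = 0) := by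
    by_cases hne : ({r ∈ Icc 0 r₁ | w r ≤ 0}).Nonempty
    · have hcl : IsCompact {r ∈ Icc 0 r₁ | w r ≤ 0} := by
        have : ContinuousOn w (Icc 0 r₁) := hwc.mono (Icc_subset_Icc le_rfl hr₁.2)
        have := this.preimage_isClosed_of_isClosed isClosed_Icc (isClosed_Iic (a := (0:ℝ)))
        exact isCompact_Icc.of_isClosed_subset this (fun x hx => hx.1)
      obtain ⟨a, ⟨ha1, ha2⟩, hamax⟩ := hcl.exists_isGreatest hne
      have har : a < r₁ := by
        rcases eq_or_lt_of_le ha1.2 with e | e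
        · rw [e] at ha2; exact absurd hw (not_lt.2 ha2)
        · exact e
      obtain ⟨c, hc, hceq⟩ := exists_hasDerivAt_eq_slope w (fun r => p r - p' r) har
        (hwc.mono (Icc_subset_Icc ha1.1 hr₁.2))
        (fun r hr => hwd r ⟨ha1.1.trans_lt hr.1, hr.2.trans_le hr₁.2⟩)
      have hpos : ∀ r ∈ Ioc a r₁, 0 < w r := by
        intro r hr
        by_contra hcon
        have := hamax (show r ∈ {r ∈ Icc 0 r₁ | w r ≤ 0} from
          ⟨⟨ha1.1.trans hr.1.le, hr.2⟩, not_lt.1 hcon⟩)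
        exact absurd hr.1 (not_lt.2 this)
      refine ⟨c, ⟨ha1.1.trans hc.1.le, hc.2.le⟩, hpos c ⟨hc.1, hc.2.le⟩,
        fun r hr => hpos r ⟨hc.1.trans_le hr.1, hr.2⟩, Or.inl ⟨ha1.1.trans_lt hc.1, ?_⟩⟩
      rw [hceq]
      apply div_nonneg _ (sub_nonneg.2 har.le)
      have : 0 < w r₁ := hw
      linarith
    · have hpos : ∀ r ∈ Icc 0 r₁, 0 < w r := by
        intro r hr
        by_contra hcon
        exact hne ⟨r, hr, not_lt.1 hcon⟩
      exact ⟨0, ⟨le_rfl, hr₁.1⟩, hpos 0 ⟨le_rfl, hr₁.1⟩, hpos, Or.inr rfl⟩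
  obtain ⟨r₀, hr₀, hw₀, hpos₀, hst⟩ := start
  have hder : ∀ b, r₀ ≤ b → 0 < b → b ≤ R → (∀ r ∈ Ioo r₀ b, 0 < w r) → 0 ≤ p b - p' b := by
    intro b hb hb0 hbR hpos
    rcases hst with ⟨h1, h2⟩ | h1
    · exact hmono r₀ b h1 hb hbR hpos h2
    · subst h1
      have eb := h.ode b ⟨hb0, hbR⟩
      have eb' := h'.ode b ⟨hb0, hbR⟩
      have m0 : (0:ℝ) ∈ Icc 0 R := ⟨le_rfl, hR.le⟩
      have mb : b ∈ Icc 0 R := ⟨hb, hbR⟩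
      have i3 : (∫ l in (0:ℝ)..b, l ^ 2 * F (σ' l)) ≤ ∫ l in (0:ℝ)..b, l ^ 2 * F (σ l) := by
        apply intervalIntegral.integral_mono_on_of_le_Ioo hb (h'.integ hF0 hF m0 mb) (h.integ hF0 hF m0 mb)
        intro r hr
        have := hpos r hr
        exact mul_le_mul_of_nonneg_left (hF (by simp only [hwdef] at this; linarith)) (sq_nonneg r)
      have h5 : 0 ≤ b ^ 2 * (p b - p' b) := by nlinarith
      exact nonneg_of_mul_nonneg_right h5 (by positivity)
  have hwmono : ∀ b, r₀ ≤ b → b ≤ R → (∀ r ∈ Ioo r₀ b, 0 < w r) → MonotoneOn w (Icc r₀ b) := by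
    intro b hb hbR hpos
    have hin : ∀ r ∈ interior (Icc r₀ b), r ∈ Ioo 0 R ∧ r ∈ Ioo r₀ b := by
      intro r hr
      rw [interior_Icc] at hr
      exact ⟨⟨hr₀.1.trans_lt hr.1, hr.2.trans_le hbR⟩, hr⟩
    apply monotoneOn_of_deriv_nonneg (convex_Icc r₀ b) (hwc.mono (Icc_subset_Icc hr₀.1 hbR))
    · intro r hr
      exact (hwd r (hin r hr).1).differentiableAt.differentiableWithinAt
    · intro r hr
      obtain ⟨h1, h2⟩ := hin r hr
      rw [(hwd r h1).deriv]
      exact hder r h2.1.le h1.1 h1.2.le (fun x hx => hpos x ⟨hx.1, hx.2.trans h2.2⟩)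
  have hall : ∀ r ∈ Icc r₀ R, 0 < w r := by
    by_contra hcon
    push Not at hcon
    have hcl : IsCompact {r ∈ Icc r₀ R | w r ≤ 0} := by
      have : ContinuousOn w (Icc r₀ R) := hwc.mono (Icc_subset_Icc hr₀.1 le_rfl)
      have := this.preimage_isClosed_of_isClosed isClosed_Icc (isClosed_Iic (a := (0:ℝ)))
      exact isCompact_Icc.of_isClosed_subset this (fun x hx => hx.1)
    obtain ⟨x, hx, hx2⟩ := hcon
    obtain ⟨b, ⟨hb1, hb2⟩, hbmin⟩ := hcl.exists_isLeast ⟨x, hx, hx2⟩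
    have hpos : ∀ r ∈ Ioo r₀ b, 0 < w r := by
      intro r hr
      by_contra hcon
      have := hbmin (show r ∈ {r ∈ Icc r₀ R | w r ≤ 0} from
        ⟨⟨hr.1.le, hr.2.le.trans hb1.2⟩, not_lt.1 hcon⟩)
      exact absurd hr.2 (not_lt.2 this)
    have := hwmono b hb1.1 hb1.2 hpos (left_mem_Icc.2 hb1.1) (right_mem_Icc.2 hb1.1) hb1.1
    linarith
  have hr₀R : r₀ ≤ R := hr₀.2.trans hr₁.2
  exact ⟨hwmono R hr₀R le_rfl (fun r hr => hall r ⟨hr.1.le, hr.2.le⟩) ⟨hr₀.2, hr₁.2⟩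
    (right_mem_Icc.2 hr₀R) hr₁.2,
    hder R hr₀R hR le_rfl (fun r hr => hall r ⟨hr.1.le, hr.2.le⟩)⟩

lemma SS.compare {s' : ℝ} {σ' p' : ℝ → ℝ} (h : SS F β s R σ p) (h' : SS F β s' R σ' p')
    (hF0 : ∀ x, 0 ≤ F x) (hF : Monotone F) (hR : 0 < R) (hβ : 0 < β) (hs : s' ≤ s)
    {r : ℝ} (hr : r ∈ Icc 0 R) : 0 ≤ σ r - σ' r ∧ σ r - σ' r ≤ s - s' := by
  have e := h.robin
  have e' := h'.robin
  constructor
  · by_contra hc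
    push Not at hc
    obtain ⟨h1, h2⟩ := h'.maxp h hF0 hF hr hR (by linarith)
    nlinarith
  · by_cases hw : 0 < σ r - σ' r
    · obtain ⟨h1, h2⟩ := h.maxp h' hF0 hF hr hR hw
      have : 0 ≤ β * ((s - s') - (σ R - σ' R)) := by linarith
      have := nonneg_of_mul_nonneg_right this hβ
      linarith
    · linarith

/-- Lipschitz dependence of the growth integral on the boundary parameter (ordered). -/
lemma SS.lip_aux {s' : ℝ} {σ' p' : ℝ → ℝ} (h : SS F β s R σ p) (h' : SS F β s' R σ' p')
    (hF0 : ∀ x, 0 ≤ F x) (hF : Monotone F) (hR : 0 < R) (hβ : 0 < β) (hs : s' ≤ s)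
    {T : ℝ → ℝ} (hT : Monotone T) {κ Lg M : ℝ} (hκ : 0 ≤ κ) (hLg : 0 ≤ Lg)
    (hTF : ∀ x y, x ≤ y → y ≤ M → T y - T x ≤ κ * (F y - F x) + Lg * (y - x))
    (hM : ∀ r ∈ Icc 0 R, σ r ≤ M) :
    0 ≤ (∫ r in (0:ℝ)..R, r ^ 2 * T (σ r)) - (∫ r in (0:ℝ)..R, r ^ 2 * T (σ' r)) ∧
    (∫ r in (0:ℝ)..R, r ^ 2 * T (σ r)) - (∫ r in (0:ℝ)..R, r ^ 2 * T (σ' r)) ≤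
      R ^ 2 * (κ * β + Lg * R) * (s - s') := by
  have m0 : (0:ℝ) ∈ Icc 0 R := ⟨le_rfl, hR.le⟩
  have mR : R ∈ Icc 0 R := ⟨hR.le, le_rfl⟩
  have iT := h.integ hF0 hT m0 mR
  have iT' := h'.integ hF0 hT m0 mR
  have iF := h.integ hF0 hF m0 mR
  have iF' := h'.integ hF0 hF m0 mR
  have hcmp := fun r hr => h.compare h' hF0 hF hR hβ hs (r := r) hr
  rw [← intervalIntegral.integral_sub iT iT']
  constructor
  · apply intervalIntegral.integral_nonneg hR.le
    intro r hr
    have : T (σ' r) ≤ T (σ r) := hT (by linarith [(hcmp r hr).1])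
    nlinarith [sq_nonneg r]
  · have h1 : (∫ r in (0:ℝ)..R, (r ^ 2 * T (σ r) - r ^ 2 * T (σ' r))) ≤
        ∫ r in (0:ℝ)..R, (κ * (r ^ 2 * F (σ r) - r ^ 2 * F (σ' r)) + R ^ 2 * Lg * (s - s')) := by
      apply intervalIntegral.integral_mono_on hR.le (iT.sub iT')
        (((iF.sub iF').const_mul κ).add intervalIntegrable_const)
      intro r hr
      have hc := hcmp r hr
      have h2 := hTF (σ' r) (σ r) (by linarith) (hM r hr)
      have h3 : Lg * (σ r - σ' r) ≤ Lg * (s - s') := mul_le_mul_of_nonneg_left hc.2 hLg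
      have h4 : r ^ 2 ≤ R ^ 2 := pow_le_pow_left₀ hr.1 hr.2 2
      have h5 : 0 ≤ Lg * (s - s') := mul_nonneg hLg (by linarith)
      have h6 : r ^ 2 * (T (σ r) - T (σ' r)) ≤ r ^ 2 * (κ * (F (σ r) - F (σ' r)) + Lg * (s - s')) :=
        mul_le_mul_of_nonneg_left (by linarith) (sq_nonneg r)
      have h7 := mul_le_mul_of_nonneg_right h4 h5
      nlinarith
    have h2 : (∫ r in (0:ℝ)..R, (κ * (r ^ 2 * F (σ r) - r ^ 2 * F (σ' r)) + R ^ 2 * Lg * (s - s')))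
        = κ * (R ^ 2 * (p R - p' R)) + R * (R ^ 2 * Lg * (s - s')) := by
      rw [intervalIntegral.integral_add ((iF.sub iF').const_mul κ) intervalIntegrable_const,
        intervalIntegral.integral_const_mul, intervalIntegral.integral_sub iF iF',
        ← h.ode R ⟨hR, le_rfl⟩, ← h'.ode R ⟨hR, le_rfl⟩, intervalIntegral.integral_const]
      simp only [sub_zero, smul_eq_mul]
      ring
    have h3 : p R - p' R ≤ β * (s - s') := by
      have := (hcmp R mR).1
      have e := h.robin
      have e' := h'.robin
      nlinarith
    have h4 : κ * (R ^ 2 * (p R - p' R)) ≤ κ * (R ^ 2 * (β * (s - s'))) :=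
      mul_le_mul_of_nonneg_left (mul_le_mul_of_nonneg_left h3 (sq_nonneg R)) hκ
    rw [h2] at h1
    nlinarith

lemma SS.lip {s' : ℝ} {σ' p' : ℝ → ℝ} (h : SS F β s R σ p) (h' : SS F β s' R σ' p')
    (hF0 : ∀ x, 0 ≤ F x) (hF : Monotone F) (hR : 0 < R) (hβ : 0 < β)
    {T : ℝ → ℝ} (hT : Monotone T) {κ Lg M : ℝ} (hκ : 0 ≤ κ) (hLg : 0 ≤ Lg)
    (hTF : ∀ x y, x ≤ y → y ≤ M → T y - T x ≤ κ * (F y - F x) + Lg * (y - x))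
    (hM : ∀ r ∈ Icc 0 R, σ r ≤ M) (hM' : ∀ r ∈ Icc 0 R, σ' r ≤ M) :
    |(∫ r in (0:ℝ)..R, r ^ 2 * T (σ r)) - (∫ r in (0:ℝ)..R, r ^ 2 * T (σ' r))| ≤
      R ^ 2 * (κ * β + Lg * R) * |s - s'| := by
  rcases le_total s' s with hs | hs
  · obtain ⟨h1, h2⟩ := h.lip_aux h' hF0 hF hR hβ hs hT hκ hLg hTF hM
    rwa [abs_of_nonneg h1, abs_of_nonneg (by linarith)]
  · obtain ⟨h1, h2⟩ := h'.lip_aux h hF0 hF hR hβ hs hT hκ hLg hTF hM'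
    rw [abs_sub_comm, abs_sub_comm s]
    rwa [abs_of_nonneg h1, abs_of_nonneg (by linarith)]

end SSlemmas

section SSgrowth

variable {F : ℝ → ℝ} {β s R : ℝ} {σ p : ℝ → ℝ}

lemma SS.restrict (h : SS F β s R σ p) (hβ : 0 < β) {R₁ : ℝ} (hR1 : R₁ ≤ R) :
    SS F β (σ R₁ + p R₁ / β) R₁ σ p where
  cont := h.cont.mono (Icc_subset_Icc le_rfl hR1)
  deriv := fun r hr => (h.deriv r ⟨hr.1, hr.2.trans hR1⟩).mono (Icc_subset_Icc le_rfl hR1)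
  ode := fun r hr => h.ode r ⟨hr.1, hr.2.trans hR1⟩
  robin := by field_simp; ring

lemma SS.int_bd (h : SS F β s R σ p) {T : ℝ → ℝ} {D M a b : ℝ} (hM : ∀ r ∈ Icc 0 R, σ r ≤ M)
    (hD : ∀ x ≤ M, |T x| ≤ D) (ha : 0 ≤ a) (hab : a ≤ b) (hb : b ≤ R) :
    |∫ r in a..b, r ^ 2 * T (σ r)| ≤ b ^ 2 * D * (b - a) := by
  have := intervalIntegral.norm_integral_le_of_norm_le_const (a := a) (b := b) (C := b ^ 2 * D)
    (f := fun r => r ^ 2 * T (σ r)) (by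
      intro r hr
      rw [uIoc_of_le hab] at hr
      rw [Real.norm_eq_abs, abs_mul, abs_of_nonneg (sq_nonneg r)]
      exact mul_le_mul (pow_le_pow_left₀ (ha.trans hr.1.le) hr.2 2)
        (hD _ (hM r ⟨ha.trans hr.1.le, hr.2.trans hb⟩)) (abs_nonneg _) (sq_nonneg b))
  rwa [Real.norm_eq_abs, abs_of_nonneg (sub_nonneg.2 hab)] at this

lemma SS.p_le (h : SS F β s R σ p) (hF0 : ∀ x, 0 ≤ F x) (hF : Monotone F) {M : ℝ}
    (hM : ∀ r ∈ Icc 0 R, σ r ≤ M) {r : ℝ} (hr : r ∈ Ioc (0:ℝ) R) : p r ≤ r * F M := by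
  have h1 := h.int_bd (T := F) (D := F M) (a := 0) (b := r) hM
    (fun x hx => by rw [abs_of_nonneg (hF0 x)]; exact hF hx) le_rfl hr.1.le hr.2
  rw [← h.ode r hr] at h1
  have h2 := (abs_le.1 h1).2
  have h3 : 0 < r ^ 2 := by have := hr.1; positivity
  have : r ^ 2 * p r ≤ r ^ 2 * (r * F M) := by nlinarith
  exact le_of_mul_le_mul_left this h3

lemma SS.s_diff (h : SS F β s R σ p) (hF0 : ∀ x, 0 ≤ F x) (hF : Monotone F) (hβ : 0 < β) {M : ℝ}
    (hM : ∀ r ∈ Icc 0 R, σ r ≤ M) {R₁ : ℝ} (h0 : 0 < R₁) (h1 : R₁ < R) :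
    |s - (σ R₁ + p R₁ / β)| ≤ (R * F M + 2 * F M / β) * (R - R₁) := by
  have hR : 0 < R := h0.trans h1
  have hs : s = σ R + p R / β := by
    have := h.robin
    field_simp
    linarith
  have hFM := hF0 M
  obtain ⟨c, hc, hce⟩ := exists_hasDerivAt_eq_slope σ p h1
    (h.cont.mono (Icc_subset_Icc h0.le le_rfl)) (fun r hr => h.hda ⟨h0.trans hr.1, hr.2⟩)
  have hd : 0 < R - R₁ := sub_pos.2 h1
  have hσ : σ R - σ R₁ = p c * (R - R₁) := by rw [hce]; field_simp
  have hc0 : 0 ≤ p c := h.p_nonneg hF0 ⟨h0.trans hc.1, hc.2.le⟩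
  have hc1 : p c ≤ R * F M := (h.p_le hF0 hF hM ⟨h0.trans hc.1, hc.2.le⟩).trans
    (mul_le_mul_of_nonneg_right hc.2.le hFM)
  have m0 : (0:ℝ) ∈ Icc 0 R := ⟨le_rfl, hR.le⟩
  have mR : R ∈ Icc 0 R := ⟨hR.le, le_rfl⟩
  have m1 : R₁ ∈ Icc 0 R := ⟨h0.le, h1.le⟩
  have i1 := intervalIntegral.integral_add_adjacent_intervals (h.integ hF0 hF m0 m1) (h.integ hF0 hF m1 mR)
  rw [← h.ode R ⟨hR, le_rfl⟩, ← h.ode R₁ ⟨h0, h1.le⟩] at i1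
  have i2 := h.int_bd (T := F) (D := F M) (a := R₁) (b := R) hM
    (fun x hx => by rw [abs_of_nonneg (hF0 x)]; exact hF hx) h0.le h1.le le_rfl
  have i3 : 0 ≤ ∫ r in R₁..R, r ^ 2 * F (σ r) :=
    intervalIntegral.integral_nonneg h1.le (fun l _ => mul_nonneg (sq_nonneg l) (hF0 _))
  have i4 := (abs_le.1 i2).2
  have hp1 := h.p_le hF0 hF hM ⟨h0, h1.le⟩
  have hp0 := h.p_nonneg hF0 (r := R₁) ⟨h0, h1.le⟩
  have hR2 : 0 < R ^ 2 := by positivity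
  have hpd : |p R - p R₁| ≤ 2 * F M * (R - R₁) := by
    rw [abs_le]
    have e1 : R ^ 2 * (p R - p R₁) = (∫ r in R₁..R, r ^ 2 * F (σ r)) - (R - R₁) * ((R + R₁) * p R₁) := by
      linear_combination -i1
    have e2 : (R + R₁) * p R₁ ≤ 2 * R ^ 2 * F M := by
      calc (R + R₁) * p R₁ ≤ (2 * R) * (R * F M) := by
            apply mul_le_mul (by linarith) _ hp0 (by positivity)
            exact hp1.trans (mul_le_mul_of_nonneg_right h1.le hFM)
        _ = _ := by ring
    have e3 : 0 ≤ (R + R₁) * p R₁ := by positivity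
    constructor
    · have : R ^ 2 * (-(2 * F M * (R - R₁))) ≤ R ^ 2 * (p R - p R₁) := by
        rw [e1]
        have := mul_le_mul_of_nonneg_left e2 hd.le
        linarith
      exact le_of_mul_le_mul_left this hR2
    · have : R ^ 2 * (p R - p R₁) ≤ R ^ 2 * (2 * F M * (R - R₁)) := by
        rw [e1]
        have := mul_nonneg hd.le e3
        have : 0 ≤ R ^ 2 * F M * (R - R₁) := by positivity
        linarith
      exact le_of_mul_le_mul_left this hR2
  have e : s - (σ R₁ + p R₁ / β) = (σ R - σ R₁) + (p R - p R₁) / β := by rw [hs]; ring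
  rw [e]
  have e4 : |(p R - p R₁) / β| ≤ 2 * F M * (R - R₁) / β := by
    rw [abs_div, abs_of_pos hβ]
    exact div_le_div_of_nonneg_right hpd hβ.le
  have e5 : |σ R - σ R₁| ≤ R * F M * (R - R₁) := by
    rw [hσ, abs_of_nonneg (by positivity)]
    exact mul_le_mul_of_nonneg_right hc1 hd.le
  calc _ ≤ |σ R - σ R₁| + |(p R - p R₁) / β| := abs_add_le _ _
    _ ≤ R * F M * (R - R₁) + 2 * F M * (R - R₁) / β := add_le_add e5 e4
    _ = _ := by ring

lemma SS.growth_aux {R' : ℝ} {σ' p' : ℝ → ℝ} (h : SS F β s R σ p) (h' : SS F β s R' σ' p')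
    (hF0 : ∀ x, 0 ≤ F x) (hF : Monotone F) (hβ : 0 < β)
    {T : ℝ → ℝ} (hT : Monotone T) {κ Lg M B D : ℝ} (hκ : 0 ≤ κ) (hLg : 0 ≤ Lg)
    (hTF : ∀ x y, x ≤ y → y ≤ M → T y - T x ≤ κ * (F y - F x) + Lg * (y - x))
    (hD : ∀ x ≤ M, |T x| ≤ D) (hs : s ≤ M) (hR : 0 < R) (hRR : R ≤ R') (hB : R' ≤ B) :
    |(∫ r in (0:ℝ)..R', r ^ 2 * T (σ' r)) / R' ^ 3 - (∫ r in (0:ℝ)..R, r ^ 2 * T (σ r)) / R ^ 3| ≤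
      ((κ * β + Lg * B) * (B * F M + 2 * F M / β) + 4 * D) * (Real.log R' - Real.log R) := by
  have hR' : 0 < R' := hR.trans_le hRR
  have hM : ∀ r ∈ Icc 0 R, σ r ≤ M := fun r hr => (h.le_s hF0 hβ hR hr).trans hs
  have hM' : ∀ r ∈ Icc 0 R', σ' r ≤ M := fun r hr => (h'.le_s hF0 hβ hR' hr).trans hs
  have hFM := hF0 M
  have hD0 : 0 ≤ D := (abs_nonneg _).trans (hD M le_rfl)
  have hB0 : 0 < B := hR'.trans_le hB
  set K := κ * β + Lg * B with hK
  set C := B * F M + 2 * F M / β with hC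
  have hK0 : 0 ≤ K := by positivity
  have hC0 : 0 ≤ C := by positivity
  have m0 : (0:ℝ) ∈ Icc 0 R' := ⟨le_rfl, hR'.le⟩
  have mR' : R' ∈ Icc 0 R' := ⟨hR'.le, le_rfl⟩
  have mR : R ∈ Icc 0 R' := ⟨hR.le, hRR⟩
  set I := ∫ r in (0:ℝ)..R, r ^ 2 * T (σ r) with hI
  set I' := ∫ r in (0:ℝ)..R', r ^ 2 * T (σ' r) with hI'
  have hIb : |I| ≤ R ^ 3 * D := by
    have := h.int_bd (T := T) hM hD le_rfl hR.le le_rfl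
    calc _ ≤ _ := this
      _ = _ := by ring
  have hdiff : |I' - I| ≤ R' ^ 2 * (K * C + D) * (R' - R) := by
    have hr := h'.restrict hβ hRR
    have l1 := hr.lip h hF0 hF hR hβ hT hκ hLg hTF
      (fun r hr => hM' r ⟨hr.1, hr.2.trans hRR⟩) hM
    have l2 : |(σ' R + p' R / β) - s| ≤ C * (R' - R) := by
      rcases eq_or_lt_of_le hRR with e | e
      · subst e
        have := h'.robin
        have : (σ' R + p' R / β) - s = 0 := by field_simp; linarith
        rw [this]; simp
      · rw [abs_sub_comm]
        refine (h'.s_diff hF0 hF hβ hM' hR e).trans ?_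
        apply mul_le_mul_of_nonneg_right _ (by linarith)
        rw [hC]
        have := mul_le_mul_of_nonneg_right hB hFM
        linarith
    have l3 := h'.int_bd (T := T) hM' hD hR.le hRR le_rfl
    have l4 := intervalIntegral.integral_add_adjacent_intervals (h'.integ hF0 hT m0 mR) (h'.integ hF0 hT mR mR')
    have l5 : R ^ 2 * (κ * β + Lg * R) * |(σ' R + p' R / β) - s| ≤ R' ^ 2 * K * (C * (R' - R)) := by
      apply mul_le_mul _ l2 (abs_nonneg _) (by positivity)
      apply mul_le_mul (pow_le_pow_left₀ hR.le hRR 2) _ (by positivity) (by positivity)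
      rw [hK]
      have := mul_le_mul_of_nonneg_left (hRR.trans hB) hLg
      linarith
    have l6 : I' - I = ((∫ r in (0:ℝ)..R, r ^ 2 * T (σ' r)) - I) + ∫ r in R..R', r ^ 2 * T (σ' r) := by
      rw [hI', ← l4]; ring
    rw [l6]
    calc _ ≤ _ := abs_add_le _ _
      _ ≤ R' ^ 2 * K * (C * (R' - R)) + R' ^ 2 * D * (R' - R) := add_le_add (l1.trans l5) l3
      _ = _ := by ring
  set q := R / R' with hq
  have hq0 : 0 < q := by positivity
  have hq1 : q ≤ 1 := (div_le_one hR').2 hRR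
  have e1 : I' / R' ^ 3 - I / R ^ 3 = (I' - I) / R' ^ 3 - I / R ^ 3 * (1 - q ^ 3) := by
    rw [hq]; field_simp; ring
  have b1 : |(I' - I) / R' ^ 3| ≤ (K * C + D) * (1 - q) := by
    rw [abs_div, abs_of_pos (by positivity : 0 < R' ^ 3), div_le_iff₀ (by positivity)]
    calc _ ≤ _ := hdiff
      _ = _ := by rw [hq]; field_simp
  have b2 : |I / R ^ 3 * (1 - q ^ 3)| ≤ D * (3 * (1 - q)) := by
    rw [abs_mul]
    apply mul_le_mul _ _ (abs_nonneg _) hD0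
    · rw [abs_div, abs_of_pos (by positivity : 0 < R ^ 3), div_le_iff₀ (by positivity)]
      linarith
    · rw [abs_of_nonneg (by have := pow_le_one₀ hq0.le hq1 (n := 3); linarith)]
      nlinarith [mul_nonneg hq0.le (sub_nonneg.2 hq1), sq_nonneg (1 - q), mul_nonneg (mul_nonneg hq0.le hq0.le) (sub_nonneg.2 hq1)]
  have b3 : 1 - q ≤ Real.log R' - Real.log R := by
    have := Real.log_le_sub_one_of_pos hq0
    rw [hq, Real.log_div hR.ne' hR'.ne'] at this
    linarith
  rw [e1]
  calc _ ≤ _ := abs_sub _ _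
    _ ≤ (K * C + D) * (1 - q) + D * (3 * (1 - q)) := add_le_add b1 b2
    _ = (K * C + 4 * D) * (1 - q) := by ring
    _ ≤ _ := mul_le_mul_of_nonneg_left b3 (by positivity)

lemma SS.growth {R' : ℝ} {σ' p' : ℝ → ℝ} (h : SS F β s R σ p) (h' : SS F β s R' σ' p')
    (hF0 : ∀ x, 0 ≤ F x) (hF : Monotone F) (hβ : 0 < β)
    {T : ℝ → ℝ} (hT : Monotone T) {κ Lg M B D : ℝ} (hκ : 0 ≤ κ) (hLg : 0 ≤ Lg)
    (hTF : ∀ x y, x ≤ y → y ≤ M → T y - T x ≤ κ * (F y - F x) + Lg * (y - x))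
    (hD : ∀ x ≤ M, |T x| ≤ D) (hs : s ≤ M) (hR : 0 < R) (hR' : 0 < R') (hB : R ≤ B) (hB' : R' ≤ B) :
    |(∫ r in (0:ℝ)..R', r ^ 2 * T (σ' r)) / R' ^ 3 - (∫ r in (0:ℝ)..R, r ^ 2 * T (σ r)) / R ^ 3| ≤
      ((κ * β + Lg * B) * (B * F M + 2 * F M / β) + 4 * D) * |Real.log R' - Real.log R| := by
  rcases le_total R R' with e | e
  · have := h.growth_aux h' hF0 hF hβ hT hκ hLg hTF hD hs hR e hB'
    rwa [abs_of_nonneg (a := Real.log R' - Real.log R) (sub_nonneg.2 (Real.log_le_log hR e))]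
  · have := h'.growth_aux h hF0 hF hβ hT hκ hLg hTF hD hs hR' e hB
    rw [abs_sub_comm, abs_sub_comm (Real.log R')]
    rwa [abs_of_nonneg (a := Real.log R - Real.log R') (sub_nonneg.2 (Real.log_le_log hR' e))]

end SSgrowth

section Volterra

/-- bounded measurable sources -/
structure Bdd (q : ℝ → ℝ) (C : ℝ) : Prop where
  meas : Measurable q
  bd : ∀ x, |q x| ≤ C

lemma Bdd.integ {q : ℝ → ℝ} {C : ℝ} (h : Bdd q C) (a b : ℝ) : IntervalIntegrable q volume a b := by
  apply (intervalIntegrable_const (c := C) (μ := volume) (a := a) (b := b)).mono_fun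
    h.meas.aestronglyMeasurable
  refine Eventually.of_forall fun x => ?_
  simp only [Real.norm_eq_abs]
  exact (h.bd x).trans (le_abs_self C)

lemma Bdd.integ2 {q : ℝ → ℝ} {C : ℝ} (h : Bdd q C) (a b : ℝ) :
    IntervalIntegrable (fun l => l ^ 2 * q l) volume a b :=
  (h.integ a b).continuousOn_mul (by fun_prop)

noncomputable def Pq (q : ℝ → ℝ) (s : ℝ) : ℝ := (∫ l in (0:ℝ)..s, l ^ 2 * q l) / s ^ 2

lemma Pq_bd {q : ℝ → ℝ} {C : ℝ} (h : Bdd q C) (s : ℝ) : |Pq q s| ≤ C * |s| := by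
  have hC : 0 ≤ C := (abs_nonneg _).trans (h.bd 0)
  by_cases hs : s = 0
  · simp [Pq, hs]
  have h1 := intervalIntegral.norm_integral_le_of_norm_le_const (a := 0) (b := s) (C := s ^ 2 * C)
    (f := fun l => l ^ 2 * q l) (by
      intro l hl
      rw [Real.norm_eq_abs, abs_mul, abs_of_nonneg (sq_nonneg l)]
      apply mul_le_mul _ (h.bd l) (abs_nonneg _) (sq_nonneg s)
      rw [mem_uIoc] at hl
      rcases hl with hl | hl <;> nlinarith)
  rw [Real.norm_eq_abs, sub_zero] at h1
  rw [Pq, abs_div, abs_of_nonneg (sq_nonneg s), div_le_iff₀ (by positivity)]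
  linarith

lemma Pq_cont {q : ℝ → ℝ} {C : ℝ} (h : Bdd q C) : Continuous (Pq q) := by
  rw [continuous_iff_continuousAt]
  intro s
  by_cases hs : s = 0
  · subst hs
    have h0 : Pq q 0 = 0 := by simp [Pq]
    rw [ContinuousAt, h0]
    apply squeeze_zero_norm (a := fun s => C * |s|)
    · intro t
      rw [Real.norm_eq_abs]
      exact Pq_bd h t
    · have : Continuous (fun s : ℝ => C * |s|) := by fun_prop
      have := this.tendsto 0
      simpa using this
  · unfold Pq
    apply ContinuousAt.div
    · exact (intervalIntegral.continuous_primitive h.integ2 0).continuousAt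
    · fun_prop
    · positivity

lemma Pq_diff {q q' : ℝ → ℝ} {C C' : ℝ} (h : Bdd q C) (h' : Bdd q' C') {s : ℝ} (hs : 0 ≤ s) :
    |Pq q s - Pq q' s| ≤ ∫ l in (0:ℝ)..s, |q l - q' l| := by
  have hi : IntervalIntegrable (fun l => |q l - q' l|) volume 0 s := ((h.integ 0 s).sub (h'.integ 0 s)).abs
  rcases eq_or_lt_of_le hs with e | e
  · subst e; simp [Pq]
  have h1 : Pq q s - Pq q' s = (∫ l in (0:ℝ)..s, (l ^ 2 * q l - l ^ 2 * q' l)) / s ^ 2 := by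
    rw [intervalIntegral.integral_sub (h.integ2 0 s) (h'.integ2 0 s), Pq, Pq]; ring
  rw [h1, abs_div, abs_of_nonneg (sq_nonneg s), div_le_iff₀ (by positivity), mul_comm,
    ← intervalIntegral.integral_const_mul]
  rw [← Real.norm_eq_abs]
  apply intervalIntegral.norm_integral_le_of_norm_le hs _ (hi.const_mul _)
  refine Eventually.of_forall fun l hl => ?_
  rw [← mul_sub, Real.norm_eq_abs, abs_mul, abs_of_nonneg (sq_nonneg l)]
  exact mul_le_mul_of_nonneg_right (pow_le_pow_left₀ hl.1.le hl.2 2) (abs_nonneg _)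

lemma exp_int {c : ℝ} (hc : 0 < c) (s : ℝ) : ∫ l in (0:ℝ)..s, Real.exp (c * l) ≤ Real.exp (c * s) / c := by
  have : ∫ l in (0:ℝ)..s, Real.exp (c * l) = Real.exp (c * s) / c - Real.exp (c * 0) / c := by
    apply intervalIntegral.integral_eq_sub_of_hasDerivAt (f := fun l => Real.exp (c * l) / c)
    · intro x _
      have := ((hasDerivAt_id x).const_mul c).exp.div_const c
      have e : Real.exp (c * id x) * (c * 1) / c = Real.exp (c * x) := by
        rw [mul_one, mul_div_assoc, div_self hc.ne', mul_one, id]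
      rw [← e]
      exact this
    · apply Continuous.intervalIntegrable; fun_prop
  rw [this]
  have : 0 ≤ Real.exp (c * 0) / c := by positivity
  linarith

lemma ind_int {ρ ρ' C s : ℝ} {k : ℝ → ℝ} (hC : 0 ≤ C) (hk : ∀ x, |k x| ≤ C) (hs : 0 ≤ s) (hρ : ρ ≤ ρ')
    (hi : IntervalIntegrable (fun l => |(if ρ < l then k l else 0) - (if ρ' < l then k l else 0)|) volume 0 s) :
    ∫ l in (0:ℝ)..s, |(if ρ < l then k l else 0) - (if ρ' < l then k l else 0)| ≤ C * (ρ' - ρ) := by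
  have hg : Integrable (indicator (Ioc ρ ρ') (fun _ : ℝ => C)) volume := by
    rw [integrable_indicator_iff measurableSet_Ioc]
    simp
  have hg0 : ∀ x, 0 ≤ indicator (Ioc ρ ρ') (fun _ : ℝ => C) x := fun x => indicator_nonneg (fun _ _ => hC) x
  calc _ ≤ ∫ l in (0:ℝ)..s, indicator (Ioc ρ ρ') (fun _ : ℝ => C) l := by
        apply intervalIntegral.integral_mono_on hs hi hg.intervalIntegrable
        intro l _
        by_cases h1 : ρ < l
        · by_cases h2 : ρ' < l
          · simp only [h1, h2, if_true, if_false, sub_self, abs_zero]; exact hg0 l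
          · have : l ∈ Ioc ρ ρ' := ⟨h1, not_lt.1 h2⟩
            simp [h1, h2, indicator_of_mem this, hk]
        · have h2 : ¬ ρ' < l := fun h => h1 (hρ.trans_lt h)
          simp only [h1, h2, if_true, if_false, sub_self, abs_zero]; exact hg0 l
    _ ≤ ∫ l, indicator (Ioc ρ ρ') (fun _ : ℝ => C) l := by
        rw [intervalIntegral.integral_of_le hs]
        exact setIntegral_le_integral hg (Eventually.of_forall hg0)
    _ = _ := by
        rw [integral_indicator measurableSet_Ioc]
        simp [hρ, mul_comm]

variable {R : ℝ}

noncomputable def sz (lam : ℝ) (hR : (0:ℝ) ≤ R) (z : C(Icc (0:ℝ) R, ℝ)) (l : ℝ) : ℝ :=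
  Real.exp (lam * l) * z (projIcc 0 R hR l)

noncomputable def Qf (k : ℝ → ℝ) (lam : ℝ) (hR : (0:ℝ) ≤ R) (ρ : ℝ) (z : C(Icc (0:ℝ) R, ℝ)) (l : ℝ) : ℝ :=
  if ρ < l then k (sz lam hR z l) else 0

lemma sz_cont (lam : ℝ) (hR : (0:ℝ) ≤ R) (z : C(Icc (0:ℝ) R, ℝ)) : Continuous (sz lam hR z) := by
  unfold sz
  have : Continuous (fun l => z (projIcc 0 R hR l)) := z.continuous.comp continuous_projIcc
  fun_prop

lemma Qf_bdd {k : ℝ → ℝ} {C : ℝ} (hk : Continuous k) (hC : ∀ x, |k x| ≤ C) (lam : ℝ) (hR : (0:ℝ) ≤ R)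
    (ρ : ℝ) (z : C(Icc (0:ℝ) R, ℝ)) : Bdd (Qf k lam hR ρ z) C where
  meas := by
    unfold Qf
    exact Measurable.ite measurableSet_Ioi (hk.comp (sz_cont lam hR z)).measurable measurable_const
  bd := by
    intro x
    unfold Qf
    split_ifs
    · exact hC _
    · simpa using (abs_nonneg _).trans (hC 0)

noncomputable def Amap (q : C(Icc (0:ℝ) R, ℝ) → ℝ → ℝ) (hq : ∀ z, Continuous (Pq (q z))) (lam b : ℝ)
    (z : C(Icc (0:ℝ) R, ℝ)) : C(Icc (0:ℝ) R, ℝ) where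
  toFun r := Real.exp (-(lam * r)) * (b + ∫ s in (0:ℝ)..r, Pq (q z) s)
  continuous_toFun := by
    have : Continuous fun r : ℝ => ∫ s in (0:ℝ)..r, Pq (q z) s :=
      intervalIntegral.continuous_primitive (fun a b => (hq z).intervalIntegrable a b) 0
    have : Continuous fun r : ℝ => Real.exp (-(lam * r)) * (b + ∫ s in (0:ℝ)..r, Pq (q z) s) := by fun_prop
    exact this.comp continuous_subtype_val

theorem ivp (k : ℝ → ℝ) (L C : ℝ) (hL : 0 ≤ L) (hkL : ∀ x y, |k x - k y| ≤ L * |x - y|)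
    (hC : ∀ x, |k x| ≤ C) (hR : (0:ℝ) < R) :
    ∃ (σ p : ℝ → ℝ → ℝ → ℝ) (K : ℝ), 0 ≤ K ∧ (∀ b ρ r, HasDerivAt (σ b ρ) (p b ρ r) r) ∧
      (∀ b ρ, σ b ρ 0 = b) ∧
      (∀ b ρ, ∀ r ∈ Ioc (0:ℝ) R, r ^ 2 * p b ρ r =
        ∫ l in (0:ℝ)..r, l ^ 2 * (if ρ < l then k (σ b ρ l) else 0)) ∧
      (∀ b b' ρ ρ', |σ b ρ R - σ b' ρ' R| ≤ K * (|b - b'| + |ρ - ρ'|)) ∧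
      (∀ b b' ρ ρ', |p b ρ R - p b' ρ' R| ≤ K * (|b - b'| + |ρ - ρ'|)) := by
  have hC0 : 0 ≤ C := (abs_nonneg _).trans (hC 0)
  have hkc : Continuous k := by
    have : LipschitzWith (Real.toNNReal L) k := LipschitzWith.of_dist_le_mul (fun x y => by
      rw [Real.dist_eq, Real.dist_eq, Real.coe_toNNReal _ hL]; exact hkL x y)
    exact this.continuous
  set lam : ℝ := 2 * L + 1 with hlam
  have hlam1 : 1 ≤ lam := by linarith
  have hlam0 : 0 < lam := by linarith
  let Q : ℝ → C(Icc (0:ℝ) R, ℝ) → ℝ → ℝ := fun ρ z => Qf k lam hR.le ρ z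
  have hQ : ∀ ρ z, Bdd (Q ρ z) C := fun ρ z => Qf_bdd hkc hC lam hR.le ρ z
  have hP : ∀ ρ z, Continuous (Pq (Q ρ z)) := fun ρ z => Pq_cont (hQ ρ z)
  let A : ℝ → ℝ → C(Icc (0:ℝ) R, ℝ) → C(Icc (0:ℝ) R, ℝ) := fun b ρ => Amap (Q ρ) (hP ρ) lam b
  have hQz : ∀ ρ z z' l, |Q ρ z l - Q ρ z' l| ≤ L * dist z z' * Real.exp (lam * l) := by
    intro ρ z z' l
    simp only [Q, Qf]
    split_ifs
    · refine (hkL _ _).trans ?_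
      rw [sz, sz, ← mul_sub, abs_mul, abs_of_pos (Real.exp_pos _)]
      have : |z (projIcc 0 R hR.le l) - z' (projIcc 0 R hR.le l)| ≤ dist z z' := by
        rw [← Real.dist_eq]; exact ContinuousMap.dist_apply_le_dist _
      calc _ ≤ L * (Real.exp (lam * l) * dist z z') := by gcongr
        _ = _ := by ring
    · simp only [sub_self, abs_zero]; positivity
  have hQzi : ∀ ρ z z' s, 0 ≤ s → ∫ l in (0:ℝ)..s, |Q ρ z l - Q ρ z' l| ≤
      L * dist z z' * (Real.exp (lam * s) / lam) := by
    intro ρ z z' s hs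
    calc _ ≤ ∫ l in (0:ℝ)..s, L * dist z z' * Real.exp (lam * l) := by
          apply intervalIntegral.integral_mono_on hs
          · exact (((hQ ρ z).integ 0 s).sub ((hQ ρ z').integ 0 s)).abs
          · apply Continuous.intervalIntegrable; fun_prop
          · intro l _; exact hQz ρ z z' l
      _ = L * dist z z' * ∫ l in (0:ℝ)..s, Real.exp (lam * l) := by
          rw [intervalIntegral.integral_const_mul]
      _ ≤ _ := by
          apply mul_le_mul_of_nonneg_left (exp_int hlam0 s); positivity
  have hQρ : ∀ ρ ρ' z s, 0 ≤ s → ∫ l in (0:ℝ)..s, |Q ρ z l - Q ρ' z l| ≤ C * |ρ - ρ'| := by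
    intro ρ ρ' z s hs
    have hi : ∀ ρ ρ', IntervalIntegrable (fun l => |Q ρ z l - Q ρ' z l|) volume 0 s := fun ρ ρ' =>
      (((hQ ρ z).integ 0 s).sub ((hQ ρ' z).integ 0 s)).abs
    rcases le_total ρ ρ' with e | e
    · rw [abs_sub_comm ρ, abs_of_nonneg (sub_nonneg.2 e)]
      exact ind_int (k := fun l => k (sz lam hR.le z l)) hC0 (fun x => hC _) hs e (hi ρ ρ')
    · rw [abs_of_nonneg (sub_nonneg.2 e)]
      have := ind_int (k := fun l => k (sz lam hR.le z l)) hC0 (fun x => hC _) hs e (hi ρ' ρ)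
      refine le_trans (le_of_eq ?_) this
      congr 1
      ext l
      rw [abs_sub_comm]
      rfl
  have hcon : ∀ b ρ, ContractingWith (1/2 : NNReal) (A b ρ) := by
    intro b ρ
    refine ⟨by rw [← NNReal.coe_lt_coe]; norm_num, LipschitzWith.of_dist_le_mul fun z z' => ?_⟩
    rw [ContinuousMap.dist_le (by positivity)]
    intro r
    have hr := r.2
    have e1 : (A b ρ z) r - (A b ρ z') r = Real.exp (-(lam * r)) *
        ∫ s in (0:ℝ)..r, (Pq (Q ρ z) s - Pq (Q ρ z') s) := by
      rw [intervalIntegral.integral_sub ((hP ρ z).intervalIntegrable _ _) ((hP ρ z').intervalIntegrable _ _)]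
      simp only [A, Amap, ContinuousMap.coe_mk]
      ring
    have e2 : |∫ s in (0:ℝ)..r, (Pq (Q ρ z) s - Pq (Q ρ z') s)| ≤
        ∫ s in (0:ℝ)..r, L * dist z z' / lam * Real.exp (lam * s) := by
      rw [← Real.norm_eq_abs]
      apply intervalIntegral.norm_integral_le_of_norm_le hr.1
      · refine Eventually.of_forall fun s hs => ?_
        rw [Real.norm_eq_abs]
        refine (Pq_diff (hQ ρ z) (hQ ρ z') hs.1.le).trans ((hQzi ρ z z' s hs.1.le).trans (le_of_eq ?_))
        ring
      · apply Continuous.intervalIntegrable; fun_prop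
    have e3 : ∫ s in (0:ℝ)..r, L * dist z z' / lam * Real.exp (lam * s) ≤
        L * dist z z' / lam * (Real.exp (lam * r) / lam) := by
      rw [intervalIntegral.integral_const_mul]
      apply mul_le_mul_of_nonneg_left (exp_int hlam0 _); positivity
    rw [Real.dist_eq, e1, abs_mul, abs_of_pos (Real.exp_pos _)]
    calc _ ≤ Real.exp (-(lam * r)) * (L * dist z z' / lam * (Real.exp (lam * r) / lam)) := by
          gcongr; exact e2.trans e3
      _ = (L / lam ^ 2) * dist z z' := by
          rw [Real.exp_neg]
          have := Real.exp_pos (lam * r)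
          field_simp
      _ ≤ _ := by
          apply mul_le_mul_of_nonneg_right _ dist_nonneg
          rw [div_le_iff₀ (by positivity)]
          push_cast
          nlinarith
  let Z : ℝ → ℝ → C(Icc (0:ℝ) R, ℝ) := fun b ρ => ContractingWith.fixedPoint (A b ρ) (hcon b ρ)
  have hZ : ∀ b ρ, A b ρ (Z b ρ) = Z b ρ := fun b ρ => (hcon b ρ).fixedPoint_isFixedPt
  set K₁ := 2 * (1 + R * C) with hK1
  have hK10 : 0 ≤ K₁ := by positivity
  have hZd : ∀ b b' ρ ρ', dist (Z b ρ) (Z b' ρ') ≤ K₁ * (|b - b'| + |ρ - ρ'|) := by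
    intro b b' ρ ρ'
    have := (hcon b ρ).fixedPoint_lipschitz_in_map (hcon b' ρ') (C := |b - b'| + R * (C * |ρ - ρ'|)) (by
      intro z
      rw [ContinuousMap.dist_le (by positivity)]
      intro r
      have hr := r.2
      have e1 : (A b ρ z) r - (A b' ρ' z) r = Real.exp (-(lam * r)) *
          ((b - b') + ∫ s in (0:ℝ)..r, (Pq (Q ρ z) s - Pq (Q ρ' z) s)) := by
        rw [intervalIntegral.integral_sub ((hP ρ z).intervalIntegrable _ _) ((hP ρ' z).intervalIntegrable _ _)]
        simp only [A, Amap, ContinuousMap.coe_mk]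
        ring
      have e2 : |∫ s in (0:ℝ)..r, (Pq (Q ρ z) s - Pq (Q ρ' z) s)| ≤ C * |ρ - ρ'| * |(r:ℝ) - 0| := by
        rw [← Real.norm_eq_abs]
        apply intervalIntegral.norm_integral_le_of_norm_le_const
        intro s hs
        rw [uIoc_of_le hr.1] at hs
        exact (Pq_diff (hQ ρ z) (hQ ρ' z) hs.1.le).trans (hQρ ρ ρ' z s hs.1.le)
      rw [Real.dist_eq, e1, abs_mul, abs_of_pos (Real.exp_pos _)]
      have e3 : Real.exp (-(lam * r)) ≤ 1 := by
        rw [Real.exp_le_one_iff]; have := mul_nonneg hlam0.le hr.1; linarith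
      calc _ ≤ 1 * |(b - b') + ∫ s in (0:ℝ)..r, (Pq (Q ρ z) s - Pq (Q ρ' z) s)| := by gcongr
        _ ≤ |b - b'| + C * |ρ - ρ'| * |(r:ℝ) - 0| := by
            rw [one_mul]; exact (abs_add_le _ _).trans (by gcongr)
        _ ≤ |b - b'| + C * |ρ - ρ'| * R := by
            rw [sub_zero, abs_of_nonneg hr.1]; gcongr; exact hr.2
        _ = _ := by ring)
    refine this.trans ?_
    have h1 := abs_nonneg (b - b')
    have h2 := abs_nonneg (ρ - ρ')
    have h3 : 0 ≤ R * C := by positivity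
    have : (1 - ((1/2 : NNReal) : ℝ)) = 1/2 := by push_cast; norm_num
    rw [this, hK1]
    nlinarith [mul_nonneg h3 h1]
  let σ : ℝ → ℝ → ℝ → ℝ := fun b ρ r => b + ∫ s in (0:ℝ)..r, Pq (Q ρ (Z b ρ)) s
  let p : ℝ → ℝ → ℝ → ℝ := fun b ρ r => Pq (Q ρ (Z b ρ)) r
  have hσz : ∀ b ρ, ∀ l ∈ Icc (0:ℝ) R, sz lam hR.le (Z b ρ) l = σ b ρ l := by
    intro b ρ l hl
    rw [sz, projIcc_of_mem hR.le hl, ← hZ b ρ]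
    simp only [A, Amap, ContinuousMap.coe_mk, σ]
    rw [← mul_assoc, ← Real.exp_add]
    simp
  have hRm : R ∈ Icc 0 R := ⟨hR.le, le_rfl⟩
  set E := Real.exp (lam * R) with hE
  have hE0 : 0 < E := Real.exp_pos _
  refine ⟨σ, p, E * K₁ + (L * K₁ * (E / lam) + C), by positivity, ?_, ?_, ?_, ?_, ?_⟩
  · intro b ρ r
    exact ((hP ρ (Z b ρ)).integral_hasStrictDerivAt 0 r).hasDerivAt.const_add b
  · intro b ρ; simp [σ]
  · intro b ρ r hr
    have hr0 := hr.1
    simp only [p, Pq]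
    rw [mul_div_cancel₀ _ (by positivity)]
    apply intervalIntegral.integral_congr
    intro l hl
    rw [uIcc_of_le hr.1.le] at hl
    simp only [Q, Qf]
    rw [hσz b ρ l ⟨hl.1, hl.2.trans hr.2⟩]
  · intro b b' ρ ρ'
    rw [← hσz b ρ R hRm, ← hσz b' ρ' R hRm, sz, sz, ← mul_sub, abs_mul, abs_of_pos (Real.exp_pos _)]
    have h1 : |(Z b ρ) (projIcc 0 R hR.le R) - (Z b' ρ') (projIcc 0 R hR.le R)| ≤ dist (Z b ρ) (Z b' ρ') := by
      rw [← Real.dist_eq]; exact ContinuousMap.dist_apply_le_dist _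
    have h2 : 0 ≤ (L * K₁ * (E / lam) + C) * (|b - b'| + |ρ - ρ'|) := by positivity
    have h3 := mul_le_mul_of_nonneg_left (h1.trans (hZd b b' ρ ρ')) hE0.le
    linarith
  · intro b b' ρ ρ'
    have h1 := Pq_diff (hQ ρ (Z b ρ)) (hQ ρ (Z b' ρ')) hR.le
    have h2 := Pq_diff (hQ ρ (Z b' ρ')) (hQ ρ' (Z b' ρ')) hR.le
    have h3 := hQzi ρ (Z b ρ) (Z b' ρ') R hR.le
    have h4 := hQρ ρ ρ' (Z b' ρ') R hR.le
    have h5 := hZd b b' ρ ρ'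
    have h6 : |p b ρ R - p b' ρ' R| ≤ |Pq (Q ρ (Z b ρ)) R - Pq (Q ρ (Z b' ρ')) R| +
      |Pq (Q ρ (Z b' ρ')) R - Pq (Q ρ' (Z b' ρ')) R| := abs_sub_le _ _ _
    have h7 : L * dist (Z b ρ) (Z b' ρ') * (E / lam) ≤ L * (K₁ * (|b - b'| + |ρ - ρ'|)) * (E / lam) := by
      gcongr
    have h8 : 0 ≤ C * |b - b'| := by positivity
    have h9 : 0 ≤ E * K₁ * (|b - b'| + |ρ - ρ'|) := by positivity
    nlinarith

end Volterra

/-- Existence for the stationary problem above the threshold. -/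
theorem stat_exists {f : ℝ → ℝ} {β σD s R : ℝ} (hf : C1StrictInc f) (hf0 : f 0 = 0)
    (hβ : 0 < β) (hσD : 0 < σD) (hR : 0 < R) :
    ∃ σ p, SS (fun x => f x * Hside (x - σD)) β s R σ p := by
  by_cases hs : s ≤ σD
  · refine ⟨fun _ => s, fun _ => 0, continuousOn_const, fun r _ => hasDerivWithinAt_const _ _ _, ?_, by simp⟩
    intro r _
    have : Hside (s - σD) = 0 := by simp [Hside, hs]
    simp [this]
  push Not at hs
  have hs0 : 0 < s := hσD.trans hs
  -- truncated nonlinearity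
  set cl : ℝ → ℝ := fun x => max 0 (min x s) with hcl
  have hclm : ∀ x, cl x ∈ Icc 0 s := fun x => ⟨le_max_left _ _, max_le hs0.le (min_le_right _ _)⟩
  have hcleq : ∀ x ∈ Icc 0 s, cl x = x := fun x hx => by
    simp only [hcl]; rw [min_eq_left hx.2, max_eq_right hx.1]
  have hclmono : Monotone cl := fun x y hxy => max_le_max le_rfl (min_le_min hxy le_rfl)
  obtain ⟨L, hL⟩ : ∃ L : NNReal, LipschitzOnWith L f (Icc 0 s) :=
    (hf.1.mono Icc_subset_Ici_self).exists_lipschitzOnWith (by norm_num) (convex_Icc 0 s) isCompact_Icc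
  set k : ℝ → ℝ := fun x => f (cl x) with hk
  have hclL : ∀ x y, |cl x - cl y| ≤ |x - y| := by
    intro x y
    simp only [hcl]
    refine (abs_max_sub_max_le_max _ _ _ _).trans ?_
    refine max_le (by simp) ((abs_min_sub_min_le_max _ _ _ _).trans (by simp))
  have hkL : ∀ x y, |k x - k y| ≤ L * |x - y| := by
    intro x y
    have := hL.dist_le_mul (cl x) (hclm x) (cl y) (hclm y)
    rw [Real.dist_eq, Real.dist_eq] at this
    exact this.trans (mul_le_mul_of_nonneg_left (hclL x y) L.2)
  have hfm : MonotoneOn f (Ici 0) := hf.2.monotoneOn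
  have hkm : Monotone k := fun x y hxy => hfm (hclm x).1 (hclm y).1 (hclmono hxy)
  have hk0 : ∀ x, 0 ≤ k x := fun x => by
    rw [← hf0]; exact hfm (mem_Ici.2 le_rfl) (hclm x).1 (hclm x).1
  have hkC : ∀ x, |k x| ≤ f s := fun x => by
    rw [abs_of_nonneg (hk0 x)]; exact hfm (hclm x).1 hs0.le (hclm x).2
  have hkD : 0 < k σD := by
    simp only [hk]
    rw [hcleq σD ⟨hσD.le, hs.le⟩, ← hf0]
    exact hf.2 (mem_Ici.2 le_rfl) hσD.le hσD
  obtain ⟨σ, p, K, hK, hder, hσ0, hode, hσK, hpK⟩ := ivp (R := R) k L (f s) L.2 hkL hkC hR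
  have hcont : ∀ b ρ, Continuous (σ b ρ) := fun b ρ =>
    continuous_iff_continuousAt.2 (fun r => (hder b ρ r).continuousAt)
  -- shooting path
  set bb : ℝ → ℝ := fun x => σD + max x 0 with hbb
  set rr : ℝ → ℝ := fun x => max (-x) 0 with hrr
  set Φ : ℝ → ℝ := fun x => p (bb x) (rr x) R + β * σ (bb x) (rr x) R with hΦ
  have hΦc : Continuous Φ := by
    have : LipschitzWith (Real.toNNReal ((1 + β) * K * 2)) Φ := LipschitzWith.of_dist_le_mul (fun x y => by
      rw [Real.dist_eq, Real.dist_eq, Real.coe_toNNReal _ (by positivity)]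
      have h1 := hσK (bb x) (bb y) (rr x) (rr y)
      have h2 := hpK (bb x) (bb y) (rr x) (rr y)
      have h3 : |bb x - bb y| ≤ |x - y| := by
        simp only [hbb]
        rw [add_sub_add_left_eq_sub]
        exact (abs_max_sub_max_le_max _ _ _ _).trans (by simp)
      have h4 : |rr x - rr y| ≤ |x - y| := by
        simp only [hrr]
        refine (abs_max_sub_max_le_max _ _ _ _).trans (max_le (le_of_eq ?_) (by simp))
        rw [abs_sub_comm]; congr 1; ring
      have h5 : K * (|bb x - bb y| + |rr x - rr y|) ≤ K * (2 * |x - y|) := by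
        apply mul_le_mul_of_nonneg_left _ hK; linarith
      have e : Φ x - Φ y = (p (bb x) (rr x) R - p (bb y) (rr y) R) +
        β * (σ (bb x) (rr x) R - σ (bb y) (rr y) R) := by simp only [hΦ]; ring
      rw [e]
      calc _ ≤ _ := abs_add_le _ _
        _ ≤ K * (2 * |x - y|) + β * (K * (2 * |x - y|)) := by
          rw [abs_mul, abs_of_pos hβ]
          exact add_le_add (h2.trans h5) (mul_le_mul_of_nonneg_left (h1.trans h5) hβ.le)
        _ = _ := by ring)
    exact this.continuous
  -- basic properties of shots
  have hp0 : ∀ b ρ, ∀ r ∈ Ioc (0:ℝ) R, 0 ≤ p b ρ r := by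
    intro b ρ r hr
    have h2 : 0 ≤ r ^ 2 * p b ρ r := by
      rw [hode b ρ r hr]
      apply intervalIntegral.integral_nonneg hr.1.le
      intro l _
      split_ifs
      · exact mul_nonneg (sq_nonneg l) (hk0 _)
      · simp
    exact nonneg_of_mul_nonneg_right h2 (by have := hr.1; positivity)
  have hmono : ∀ b ρ, MonotoneOn (σ b ρ) (Icc 0 R) := by
    intro b ρ
    apply monotoneOn_of_deriv_nonneg (convex_Icc 0 R) (hcont b ρ).continuousOn
    · intro r _
      exact (hder b ρ r).differentiableAt.differentiableWithinAt
    · intro r hr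
      rw [interior_Icc] at hr
      rw [(hder b ρ r).deriv]
      exact hp0 b ρ r ⟨hr.1, hr.2.le⟩
  have hge : ∀ b ρ, ∀ r ∈ Icc (0:ℝ) R, b ≤ σ b ρ r := by
    intro b ρ r hr
    have := hmono b ρ ⟨le_rfl, hR.le⟩ hr hr.1
    rwa [hσ0] at this
  have hflat : ∀ b ρ, ∀ r ∈ Ioc (0:ℝ) R, r ≤ ρ → p b ρ r = 0 := by
    intro b ρ r hr hrρ
    have h1 := hode b ρ r hr
    have h2 : ∫ l in (0:ℝ)..r, l ^ 2 * (if ρ < l then k (σ b ρ l) else 0) = ∫ l in (0:ℝ)..r, 0 := by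
      apply intervalIntegral.integral_congr
      intro l hl
      rw [uIcc_of_le hr.1.le] at hl
      simp [not_lt.2 (hl.2.trans hrρ)]
    rw [h2, intervalIntegral.integral_zero] at h1
    have h3 : r ^ 2 ≠ 0 := by have := hr.1; positivity
    exact (mul_eq_zero.1 h1).resolve_left h3
  have hflat2 : ∀ b ρ, ∀ r ∈ Icc (0:ℝ) R, r ≤ ρ → σ b ρ r = b := by
    intro b ρ r hr hrρ
    rcases eq_or_lt_of_le hr.1 with e | e
    · rw [← e, hσ0]
    obtain ⟨c, hc, hce⟩ := exists_hasDerivAt_eq_slope (σ b ρ) (p b ρ) e (hcont b ρ).continuousOn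
      (fun x _ => hder b ρ x)
    rw [hflat b ρ c ⟨hc.1, hc.2.le.trans hr.2⟩ (hc.2.le.trans hrρ), hσ0] at hce
    have : σ b ρ r - b = 0 := by
      have h := hce.symm
      rw [div_eq_zero_iff] at h
      rcases h with h | h
      · exact h
      · linarith
    linarith
  have ha : Φ (-R) ≤ β * s := by
    simp only [hΦ, hbb, hrr]
    have e1 : max (-R) 0 = 0 := max_eq_right (by linarith)
    have e2 : max (-(-R)) 0 = R := by rw [neg_neg]; exact max_eq_left hR.le
    rw [e1, e2, hflat _ R R ⟨hR, le_rfl⟩ le_rfl, hflat2 _ R R ⟨hR.le, le_rfl⟩ le_rfl]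
    have := mul_le_mul_of_nonneg_left hs.le hβ.le
    linarith
  have hb : β * s ≤ Φ (s - σD) := by
    simp only [hΦ]
    have h1 := hp0 (bb (s - σD)) (rr (s - σD)) R ⟨hR, le_rfl⟩
    have h2 := hge (bb (s - σD)) (rr (s - σD)) R ⟨hR.le, le_rfl⟩
    have h3 : bb (s - σD) = s := by
      simp only [hbb]; rw [max_eq_left (by linarith)]; ring
    rw [h3] at h1 h2 ⊢
    have := mul_le_mul_of_nonneg_left h2 hβ.le
    linarith
  obtain ⟨x, hx, hxe⟩ := intermediate_value_Icc (by linarith : -R ≤ s - σD) hΦc.continuousOn ⟨ha, hb⟩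
  set b := bb x with hbx
  set ρ := rr x with hρx
  have hb1 : σD ≤ b := by simp only [hbx, hbb]; have := le_max_right x 0; linarith
  have hρ0 : 0 ≤ ρ := le_max_right _ _
  have hbρ : σD < b → ρ = 0 := by
    intro h
    simp only [hbx, hbb] at h
    have : 0 < max x 0 := by linarith
    have : 0 < x := by
      rcases lt_max_iff.1 this with h | h
      · exact h
      · exact absurd h (lt_irrefl _)
    simp only [hρx, hrr]
    exact max_eq_right (by linarith)
  have hrob : p b ρ R + β * (σ b ρ R - s) = 0 := by
    have : p b ρ R + β * σ b ρ R = β * s := hxe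
    linarith
  have hle : ∀ r ∈ Icc 0 R, σ b ρ r ≤ s := by
    intro r hr
    have h1 := hmono b ρ hr ⟨hR.le, le_rfl⟩ hr.2
    have h2 := hp0 b ρ R ⟨hR, le_rfl⟩
    have h3 : 0 ≤ β * (s - σ b ρ R) := by linarith
    have := nonneg_of_mul_nonneg_right h3 hβ
    linarith
  have hgt : ∀ r ∈ Icc 0 R, ρ < r → σD < σ b ρ r := by
    intro r hr hρr
    have hr0 : 0 < r := hρ0.trans_lt hρr
    obtain ⟨c, hc, hce⟩ := exists_hasDerivAt_eq_slope (σ b ρ) (p b ρ) hρr (hcont b ρ).continuousOn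
      (fun x _ => hder b ρ x)
    have hc0 : 0 < c := hρ0.trans_lt hc.1
    have hcR : c ≤ R := hc.2.le.trans hr.2
    have hpc : 0 < p b ρ c := by
      have h1 : 0 < c ^ 2 * p b ρ c := by
        rw [hode b ρ c ⟨hc0, hcR⟩]
        have hmeas : ∀ u v, IntervalIntegrable (fun l => l ^ 2 * (if ρ < l then k (σ b ρ l) else 0)) volume u v := by
          intro u v
          have hkc : Continuous k := by
            have : LipschitzWith L k := LipschitzWith.of_dist_le_mul (fun x y => by
              rw [Real.dist_eq, Real.dist_eq]; exact hkL x y)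
            exact this.continuous
          have hB : Bdd (fun l => if ρ < l then k (σ b ρ l) else 0) (f s) :=
            ⟨Measurable.ite measurableSet_Ioi (hkc.comp (hcont b ρ)).measurable measurable_const, fun y => by
              split_ifs
              · exact hkC _
              · simpa using (abs_nonneg _).trans (hkC 0)⟩
          exact hB.integ2 u v
        rw [← intervalIntegral.integral_add_adjacent_intervals (hmeas 0 ρ) (hmeas ρ c)]
        have i1 : 0 ≤ ∫ l in (0:ℝ)..ρ, l ^ 2 * (if ρ < l then k (σ b ρ l) else 0) := by
          apply intervalIntegral.integral_nonneg hρ0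
          intro l _
          split_ifs
          · exact mul_nonneg (sq_nonneg l) (hk0 _)
          · simp
        have i2 : 0 < ∫ l in ρ..c, l ^ 2 * (if ρ < l then k (σ b ρ l) else 0) := by
          apply intervalIntegral.intervalIntegral_pos_of_pos_on (hmeas ρ c) _ hc.1
          intro l hl
          have hl0 : 0 < l := hρ0.trans_lt hl.1
          simp only [hl.1, if_true]
          have : k σD ≤ k (σ b ρ l) := hkm (hb1.trans (hge b ρ l ⟨hl0.le, hl.2.le.trans hcR⟩))
          have : 0 < k (σ b ρ l) := hkD.trans_le this
          positivity
        linarith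
      exact pos_of_mul_pos_right h1 (sq_nonneg c)
    rw [hce] at hpc
    have h1 : 0 < σ b ρ r - σ b ρ ρ := by
      have := mul_pos hpc (sub_pos.2 hρr)
      rwa [div_mul_cancel₀ _ (sub_pos.2 hρr).ne'] at this
    have := hge b ρ ρ ⟨hρ0, hρr.le.trans hr.2⟩
    linarith
  refine ⟨σ b ρ, p b ρ, (hcont b ρ).continuousOn, fun r _ => (hder b ρ r).hasDerivWithinAt, ?_, hrob⟩
  intro r hr
  rw [hode b ρ r hr]
  apply intervalIntegral.integral_congr
  intro l hl
  rw [uIcc_of_le hr.1.le] at hl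
  have hlR : l ∈ Icc 0 R := ⟨hl.1, hl.2.trans hr.2⟩
  simp only
  by_cases hρl : ρ < l
  · have h1 := hgt l hlR hρl
    have h2 : Hside (σ b ρ l - σD) = 1 := by simp [Hside, h1]
    have h3 : k (σ b ρ l) = f (σ b ρ l) := by
      simp only [hk]; rw [hcleq _ ⟨hσD.le.trans h1.le, hle l hlR⟩]
    simp [hρl, h2, h3]
  · have hlρ := not_lt.1 hρl
    rcases eq_or_lt_of_le hb1 with e | e
    · have h1 := hflat2 b ρ l hlR hlρ
      have h2 : Hside (σ b ρ l - σD) = 0 := by simp [Hside, h1, e]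
      simp [hρl, h2]
    · have h1 := hbρ e
      have : l = 0 := le_antisymm (by linarith) hl.1
      simp [this]

end Aux

lemma ode_uniq {x y a b : ℝ → ℝ} {L Tm : ℝ} (hL : 0 ≤ L)
    (hx : ContinuousOn x (Icc 0 Tm)) (hy : ContinuousOn y (Icc 0 Tm))
    (dx : ∀ t ∈ Ioo 0 Tm, HasDerivAt x (a t) t) (dy : ∀ t ∈ Ioo 0 Tm, HasDerivAt y (b t) t)
    (hab : ∀ t ∈ Ioo 0 Tm, |a t - b t| ≤ L * |x t - y t|) (h0 : x 0 = y 0) :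
    ∀ t ∈ Icc 0 Tm, x t = y t := by
  have hd : ∀ t ∈ Ioo 0 Tm, HasDerivAt (fun t => Real.exp (-(2 * L) * t) * (x t - y t) ^ 2)
      (Real.exp (-(2 * L) * t) * (-(2 * L)) * (x t - y t) ^ 2 +
        Real.exp (-(2 * L) * t) * (2 * (x t - y t) * (a t - b t))) t := by
    intro t ht
    have h1 : HasDerivAt (fun t : ℝ => -(2 * L) * t) (-(2 * L)) t := by
      simpa using (hasDerivAt_id t).const_mul (-(2 * L))
    have h2 := h1.exp.mul (((dx t ht).sub (dy t ht)).pow 2)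
    refine h2.congr_deriv ?_
    simp
  have hanti : AntitoneOn (fun t => Real.exp (-(2 * L) * t) * (x t - y t) ^ 2) (Icc 0 Tm) := by
    apply antitoneOn_of_deriv_nonpos (convex_Icc _ _)
    · exact ContinuousOn.mul (by fun_prop) ((hx.sub hy).pow 2)
    · rw [interior_Icc]
      exact fun t ht => (hd t ht).differentiableAt.differentiableWithinAt
    · rw [interior_Icc]
      intro t ht
      rw [(hd t ht).deriv]
      have h1 : (x t - y t) * (a t - b t) ≤ L * (x t - y t) ^ 2 := by
        calc (x t - y t) * (a t - b t) ≤ |x t - y t| * |a t - b t| := by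
              rw [← abs_mul]; exact le_abs_self _
          _ ≤ |x t - y t| * (L * |x t - y t|) :=
              mul_le_mul_of_nonneg_left (hab t ht) (abs_nonneg _)
          _ = L * (x t - y t) ^ 2 := by rw [← sq_abs (x t - y t)]; ring
      have h2 := mul_nonneg (Real.exp_pos (-(2 * L) * t)).le (sub_nonneg.2 h1)
      nlinarith [h2]
  intro t ht
  have h1 := hanti (left_mem_Icc.2 (ht.1.trans ht.2)) ht ht.1
  simp only [h0, sub_self] at h1
  have h2 : (x t - y t) ^ 2 ≤ 0 := by
    have := Real.exp_pos (-(2 * L) * t)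
    by_contra hc
    push Not at hc
    have := mul_pos this hc
    rw [zero_pow two_ne_zero, mul_zero] at h1
    linarith
  have h3 : x t - y t = 0 := by
    have := le_antisymm h2 (sq_nonneg _)
    exact pow_eq_zero_iff (two_ne_zero) |>.1 this
  linarith

theorem glob_ode (N : ℝ → ℝ → ℝ) (x0 : ℝ) (hcont : ∀ x, Continuous (fun t => N t x))
    (hbd : ∀ Tm : ℝ, ∃ D ≥ 0, ∀ t ∈ Icc 0 Tm, ∀ x, |N t x| ≤ D)
    (hlip : ∀ Tm B : ℝ, ∃ K ≥ 0, ∀ t ∈ Icc 0 Tm, ∀ x ≤ B, ∀ y ≤ B, |N t x - N t y| ≤ K * |x - y|) :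
    ∃ x : ℝ → ℝ, x 0 = x0 ∧ ∀ t ≥ 0, HasDerivWithinAt x (N t (x t)) (Ici 0) t := by
  have loc : ∀ n : ℕ, ∃ x : ℝ → ℝ, x 0 = x0 ∧
      ∀ t ∈ Icc (0:ℝ) n, HasDerivWithinAt x (N t (x t)) (Icc (0:ℝ) n) t := by
    intro n
    obtain ⟨D, hD, hDb⟩ := hbd n
    obtain ⟨K, hK, hKb⟩ := hlip n (x0 + D * n)
    have hn : (0:ℝ) ≤ n := Nat.cast_nonneg n
    have hmem : (0:ℝ) ∈ Icc (0:ℝ) n := ⟨le_rfl, hn⟩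
    have hP : IsPicardLindelof N (tmin := 0) (tmax := n) ⟨0, hmem⟩ x0 (NNReal.mk (D * n) (by positivity)) 0
        (NNReal.mk D hD) (NNReal.mk K hK) := by
      constructor
      · intro t ht
        apply LipschitzOnWith.of_dist_le_mul
        intro x hx y hy
        rw [Real.dist_eq, Real.dist_eq]
        rw [Metric.mem_closedBall, Real.dist_eq] at hx hy
        have hx' := (abs_le.1 hx).2
        have hy' := (abs_le.1 hy).2
        simp only [NNReal.coe_mk] at hx' hy' ⊢
        exact hKb t ht x (by linarith) y (by linarith)
      · intro x _
        exact (hcont x).continuousOn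
      · intro t ht x _
        exact hDb t ht x
      · simp [hn]
    obtain ⟨x, h1, h2⟩ := hP.exists_eq_forall_mem_Icc_hasDerivWithinAt₀
    exact ⟨x, h1, h2⟩
  choose X hX0 hX using loc
  have agree : ∀ m n : ℕ, m ≤ n → ∀ t ∈ Icc (0:ℝ) m, X m t = X n t := by
    intro m n hmn
    have hmn' : (m:ℝ) ≤ n := by exact_mod_cast hmn
    have hsub : Icc (0:ℝ) m ⊆ Icc (0:ℝ) n := Icc_subset_Icc_right hmn'
    have c1 : ContinuousOn (X m) (Icc (0:ℝ) m) := fun t ht => (hX m t ht).continuousWithinAt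
    have c2 : ContinuousOn (X n) (Icc (0:ℝ) m) := fun t ht =>
      ((hX n t (hsub ht)).continuousWithinAt).mono hsub
    obtain ⟨B1, hB1⟩ := isCompact_Icc.bddAbove_image c1
    obtain ⟨B2, hB2⟩ := isCompact_Icc.bddAbove_image c2
    obtain ⟨K, hK, hKb⟩ := hlip m (max B1 B2)
    refine ode_uniq hK c1 c2 (a := fun t => N t (X m t)) (b := fun t => N t (X n t)) ?_ ?_ ?_
      ((hX0 m).trans (hX0 n).symm)
    · intro t ht
      exact (hX m t (Ioo_subset_Icc_self ht)).hasDerivAt (Icc_mem_nhds ht.1 ht.2)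
    · intro t ht
      exact (hX n t (hsub (Ioo_subset_Icc_self ht))).hasDerivAt
        (Icc_mem_nhds ht.1 (ht.2.trans_le hmn'))
    · intro t ht
      have ht' := Ioo_subset_Icc_self ht
      exact hKb t ht' _ (le_max_of_le_left (hB1 (mem_image_of_mem _ ht'))) _
        (le_max_of_le_right (hB2 (mem_image_of_mem _ ht')))
  have key : ∀ n : ℕ, ∀ t ∈ Icc (0:ℝ) n, X ⌈t⌉₊ t = X n t := by
    intro n t ht
    exact agree _ n (Nat.ceil_le.2 ht.2) t ⟨ht.1, Nat.le_ceil t⟩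
  refine ⟨fun t => X ⌈t⌉₊ t, hX0 _, fun t ht => ?_⟩
  set n := ⌈t⌉₊ + 1 with hn
  have htn : t < n := by
    have := Nat.le_ceil t
    rw [hn]; push_cast; linarith
  have h1 := hX n t ⟨ht, htn.le⟩
  have h2 : HasDerivWithinAt (fun t => X ⌈t⌉₊ t) (N t (X n t)) (Icc (0:ℝ) n) t :=
    h1.congr (fun s hs => key n s hs) (key n t ⟨ht, htn.le⟩)
  have h3 : Icc (0:ℝ) n ∈ 𝓝[Ici 0] t := by
    rw [← Ici_inter_Iic]
    exact Filter.inter_mem self_mem_nhdsWithin (mem_nhdsWithin_of_mem_nhds (Iic_mem_nhds htn))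
  have h4 := h2.mono_of_mem_nhdsWithin h3
  show HasDerivWithinAt _ (N t (X ⌈t⌉₊ t)) _ _
  rw [key n t ⟨ht, htn.le⟩]
  exact h4

lemma F_nonneg {f : ℝ → ℝ} {σD : ℝ} (hσD : 0 < σD) (hf : C1StrictInc f) (hf0 : f 0 = 0) (x : ℝ) :
    0 ≤ f x * Hside (x - σD) := by
  unfold Hside
  split_ifs with h
  · have : f 0 ≤ f x := hf.2.monotoneOn (mem_Ici.2 le_rfl) (mem_Ici.2 (by linarith)) (by linarith)
    linarith
  · simp

lemma F_mono {f : ℝ → ℝ} {σD : ℝ} (hσD : 0 < σD) (hf : C1StrictInc f) (hf0 : f 0 = 0) :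
    Monotone (fun x => f x * Hside (x - σD)) := by
  intro x y hxy
  by_cases h : 0 < x - σD
  · have h' : 0 < y - σD := by linarith
    simp only [Hside, if_pos h, if_pos h', mul_one]
    exact hf.2.monotoneOn (mem_Ici.2 (by linarith)) (mem_Ici.2 (by linarith)) hxy
  · have : f x * Hside (x - σD) = 0 := by simp [Hside, h]
    simp only [this]
    exact F_nonneg hσD hf hf0 y

lemma T_mono {g : ℝ → ℝ} {σD ν : ℝ} (hσD : 0 < σD) (hg : C1StrictInc g) (hgν : 0 ≤ g σD + ν) :
    Monotone (Sfun g σD ν) := by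
  intro x y hxy
  unfold Sfun
  split_ifs with h1 h2 h2
  · exact hg.2.monotoneOn (mem_Ici.2 (by linarith)) (mem_Ici.2 (by linarith)) hxy
  · linarith
  · have := hg.2.monotoneOn (a := σD) (b := y) (mem_Ici.2 (by linarith)) (mem_Ici.2 (by linarith))
      h2.le
    linarith
  · exact le_rfl

lemma T_ge {g : ℝ → ℝ} {σD ν : ℝ} (hσD : 0 < σD) (hg : C1StrictInc g) (hgν : 0 ≤ g σD + ν)
    (x : ℝ) : -ν ≤ Sfun g σD ν x := by
  unfold Sfun
  split_ifs with h1
  · have := hg.2.monotoneOn (a := σD) (b := x) (mem_Ici.2 (by linarith)) (mem_Ici.2 (by linarith))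
      h1.le
    linarith
  · exact le_rfl

lemma T_facts {f g : ℝ → ℝ} {σD ν : ℝ} (hσD : 0 < σD) (hf : C1StrictInc f) (hf0 : f 0 = 0)
    (hg : C1StrictInc g) (hgν : 0 ≤ g σD + ν) (hν : 0 < ν) (M : ℝ) :
    ∃ κ Lg D : ℝ, 0 ≤ κ ∧ 0 ≤ Lg ∧ 0 ≤ D ∧
      (∀ x y, x ≤ y → y ≤ M → Sfun g σD ν y - Sfun g σD ν x ≤
        κ * (f y * Hside (y - σD) - f x * Hside (x - σD)) + Lg * (y - x)) ∧
      (∀ x ≤ M, |Sfun g σD ν x| ≤ D) := by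
  have hfD : 0 < f σD := by
    rw [← hf0]; exact hf.2 (mem_Ici.2 le_rfl) (mem_Ici.2 hσD.le) hσD
  obtain ⟨K, hK⟩ := (hg.1.mono (Icc_subset_Ici_self : Icc 0 M ⊆ Ici 0)).exists_lipschitzOnWith
    (by norm_num) (convex_Icc 0 _) isCompact_Icc
  refine ⟨(g σD + ν) / f σD, K, ν + |Sfun g σD ν M|, by positivity, K.2, by positivity, ?_, ?_⟩
  · intro x y hxy hyM
    have lipg : ∀ a b, 0 ≤ a → a ≤ b → b ≤ M → g b - g a ≤ K * (b - a) := by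
      intro a b ha hab hb
      have := hK.dist_le_mul b ⟨ha.trans hab, hb⟩ a ⟨ha, hab.trans hb⟩
      rw [Real.dist_eq, Real.dist_eq, abs_of_nonneg (sub_nonneg.2 hab)] at this
      exact (le_abs_self _).trans this
    have hmon := F_mono hσD hf hf0 hxy
    simp only at hmon
    have hκ : 0 ≤ (g σD + ν) / f σD := by positivity
    by_cases hx : σD < x
    · have hy : σD < y := by linarith
      have h1 := lipg x y (by linarith) hxy hyM
      have h2 := mul_nonneg hκ (sub_nonneg.2 hmon)
      simp only [Sfun, if_pos hx, if_pos hy]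
      linarith
    · by_cases hy : σD < y
      · have h1 := lipg σD y hσD.le hy.le hyM
        have e1 : f x * Hside (x - σD) = 0 := by
          rw [Hside, if_neg (by linarith), mul_zero]
        have e2 : f y * Hside (y - σD) = f y := by
          rw [Hside, if_pos (by linarith), mul_one]
        rw [e1, e2, sub_zero]
        simp only [Sfun, if_neg hx, if_pos hy]
        have h2 : f σD ≤ f y := hf.2.monotoneOn (mem_Ici.2 hσD.le) (mem_Ici.2 (by linarith)) hy.le
        have h3 : g σD + ν ≤ (g σD + ν) / f σD * f y := by
          rw [div_mul_eq_mul_div, le_div_iff₀ hfD]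
          exact mul_le_mul_of_nonneg_left h2 hgν
        have h4 : (K:ℝ) * (y - σD) ≤ K * (y - x) :=
          mul_le_mul_of_nonneg_left (by linarith) K.2
        linarith
      · have h2 := mul_nonneg hκ (sub_nonneg.2 hmon)
        have h4 : 0 ≤ (K:ℝ) * (y - x) := mul_nonneg K.2 (by linarith)
        simp only [Sfun, if_neg hx, if_neg hy]
        linarith
  · intro x hx
    have h1 := T_ge hσD hg hgν x
    have h2 := T_mono hσD hg hgν hx
    have h3 := le_abs_self (Sfun g σD ν M)
    have h4 := abs_nonneg (Sfun g σD ν M)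
    rw [abs_le]
    constructor <;> linarith

lemma IsStationarySol.toSS {f : ℝ → ℝ} {β σD s R : ℝ} {σ p : ℝ → ℝ}
    (h : IsStationarySol f β σD s R σ p) : SS (fun x => f x * Hside (x - σD)) β s R σ p where
  cont := h.cont
  deriv := h.deriv
  ode := by
    intro r hr
    rw [h.ode r hr]
    simp only [mul_assoc]
  robin := h.robin

lemma SS.toStat {f : ℝ → ℝ} {β σD s R : ℝ} {σ p : ℝ → ℝ}
    (h : SS (fun x => f x * Hside (x - σD)) β s R σ p) : IsStationarySol f β σD s R σ p where
  cont := h.cont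
  deriv := h.deriv
  ode := by
    intro r hr
    rw [h.ode r hr]
    simp only [mul_assoc]
  robin := h.robin

theorem stmt_4 (β σD ν ω : ℝ) (hβ : 0 < β) (hσD : 0 < σD) (hν : 0 < ν) (hω : 0 < ω)
    (f g : ℝ → ℝ) (hf : C1StrictInc f) (hf0 : f 0 = 0)
    (hg : C1StrictInc g) (hgz : ∃ σt > σD, g σt = 0) (hgν : 0 ≤ g σD + ν)
    (φ : ℝ → ℝ) (hφc : Continuous φ) (hφpos : ∀ t, 0 < φ t)
    (hφper : Function.Periodic φ ω) :
    ∀ R₀ > (0:ℝ), ∃ (σ : ℝ → ℝ → ℝ) (R R' : ℝ → ℝ),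
      IsEvolutionSol f g β σD ν φ σ R R' ∧ R 0 = R₀ ∧
      (∀ t ≥ (0:ℝ), R₀ * Real.exp (-ν * t / 3) ≤ R t) ∧
      (∀ (τ : ℝ → ℝ → ℝ) (Q Q' : ℝ → ℝ), IsEvolutionSol f g β σD ν φ τ Q Q' →
        Q 0 = R₀ → ∀ t ≥ (0:ℝ), Q t = R t) := by
  intro R₀ hR₀
  have hF0 : ∀ x, 0 ≤ (fun x => f x * Hside (x - σD)) x := F_nonneg hσD hf hf0
  have hF := F_mono hσD hf hf0
  have hT := T_mono hσD hg hgν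
  have hex : ∀ R s : ℝ, ∃ σ p : ℝ → ℝ, 0 < R → SS (fun x => f x * Hside (x - σD)) β s R σ p := by
    intro R s
    by_cases h : 0 < R
    · obtain ⟨σ, p, hh⟩ := stat_exists (s := s) hf hf0 hβ hσD h
      exact ⟨σ, p, fun _ => hh⟩
    · exact ⟨0, 0, fun h' => absurd h' h⟩
  choose σs ps hs using hex
  -- bound of φ
  have hφM : ∀ Tm : ℝ, ∃ M, ∀ t ∈ Icc 0 Tm, φ t ≤ M := by
    intro Tm
    obtain ⟨M, hM⟩ := isCompact_Icc.bddAbove_image (hφc.continuousOn (s := Icc 0 Tm))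
    exact ⟨M, fun t ht => hM (mem_image_of_mem _ ht)⟩
  -- stationary Lipschitz comparison
  have hgr : ∀ Tm B : ℝ, ∃ K ≥ 0, ∀ t ∈ Icc 0 Tm, ∀ R R' : ℝ, 0 < R → 0 < R' → R ≤ B → R' ≤ B →
      ∀ σ p σ' p', SS (fun x => f x * Hside (x - σD)) β (φ t) R σ p →
        SS (fun x => f x * Hside (x - σD)) β (φ t) R' σ' p' →
      |(∫ r in (0:ℝ)..R', r ^ 2 * Sfun g σD ν (σ' r)) / R' ^ 3 -
        (∫ r in (0:ℝ)..R, r ^ 2 * Sfun g σD ν (σ r)) / R ^ 3| ≤ K * |Real.log R' - Real.log R| := by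
    intro Tm B
    obtain ⟨M, hM⟩ := hφM Tm
    obtain ⟨κ, Lg, D, hκ, hLg, hD0, hTF, hD⟩ := T_facts hσD hf hf0 hg hgν hν M
    refine ⟨_, le_max_right (((κ * β + Lg * B) * (B * (f M * Hside (M - σD)) +
      2 * (f M * Hside (M - σD)) / β) + 4 * D)) 0, ?_⟩
    intro t ht R R' hR hR' hB hB' σ p σ' p' h h'
    have := h.growth h' hF0 hF hβ hT hκ hLg hTF hD (hM t ht) hR hR' hB hB'
    exact this.trans (mul_le_mul_of_nonneg_right (le_max_left _ _) (abs_nonneg _))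
  set N : ℝ → ℝ → ℝ := fun t x => (∫ r in (0:ℝ)..Real.exp x, r ^ 2 *
    Sfun g σD ν (σs (Real.exp x) (φ t) r)) / (Real.exp x) ^ 3 with hN
  have hNlow : ∀ t x, -ν / 3 ≤ N t x := by
    intro t x
    have hp := Real.exp_pos x
    simp only [hN]
    rw [le_div_iff₀ (by positivity)]
    have hint := (hs (Real.exp x) (φ t) hp).integ hF0 hT (left_mem_Icc.2 hp.le)
      (right_mem_Icc.2 hp.le)
    have h2 := intervalIntegral.integral_mono_on (f := fun r : ℝ => r ^ 2 * (-ν)) hp.le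
      (Continuous.intervalIntegrable (by fun_prop) _ _) hint
      (fun r _ => mul_le_mul_of_nonneg_left (T_ge hσD hg hgν _) (sq_nonneg r))
    rw [intervalIntegral.integral_mul_const, integral_pow] at h2
    norm_num at h2 ⊢
    linarith
  obtain ⟨x, hx0, hx⟩ := glob_ode N (Real.log R₀) (by
    intro x
    have hp := Real.exp_pos x
    rw [continuous_iff_continuousAt]
    intro t
    obtain ⟨κ, Lg, D, hκ, hLg, hD0, hTF, hD⟩ := T_facts hσD hf hf0 hg hgν hν (φ t + 1)
    have ev : ∀ᶠ u in 𝓝 t, φ u ≤ φ t + 1 :=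
      (hφc.tendsto t).eventually (Iic_mem_nhds (by linarith))
    rw [ContinuousAt, tendsto_iff_dist_tendsto_zero]
    have hz : Tendsto (fun u => Real.exp x ^ 2 * (κ * β + Lg * Real.exp x) * |φ u - φ t| /
        Real.exp x ^ 3) (𝓝 t) (𝓝 0) := by
      have : Continuous (fun u => Real.exp x ^ 2 * (κ * β + Lg * Real.exp x) * |φ u - φ t| /
        Real.exp x ^ 3) := by fun_prop
      have h2 := this.tendsto t
      simpa using h2
    refine tendsto_of_tendsto_of_tendsto_of_le_of_le' tendsto_const_nhds hz
      (Eventually.of_forall fun _ => dist_nonneg) ?_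
    filter_upwards [ev] with u hu
    have h1 := hs (Real.exp x) (φ u) hp
    have h2 := hs (Real.exp x) (φ t) hp
    rw [Real.dist_eq]
    simp only [hN]
    rw [← sub_div, abs_div, abs_of_pos (show 0 < Real.exp x ^ 3 by positivity)]
    refine div_le_div_of_nonneg_right ?_ (by positivity)
    exact h1.lip h2 hF0 hF hp hβ hT hκ hLg hTF
      (fun r hr => (h1.le_s hF0 hβ hp hr).trans hu)
      (fun r hr => (h2.le_s hF0 hβ hp hr).trans (by linarith))) (by
    intro Tm
    obtain ⟨M, hM⟩ := hφM Tm
    obtain ⟨κ, Lg, D, hκ, hLg, hD0, hTF, hD⟩ := T_facts hσD hf hf0 hg hgν hν M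
    refine ⟨D, hD0, fun t ht x => ?_⟩
    have hp := Real.exp_pos x
    have h1 := hs (Real.exp x) (φ t) hp
    have := h1.int_bd (fun r hr => (h1.le_s hF0 hβ hp hr).trans (hM t ht)) hD le_rfl hp.le le_rfl
    simp only [hN]
    rw [abs_div, abs_of_pos (show 0 < Real.exp x ^ 3 by positivity), div_le_iff₀ (by positivity)]
    calc _ ≤ _ := this
      _ = _ := by ring) (by
    intro Tm B
    obtain ⟨K, hK, hKb⟩ := hgr Tm (Real.exp B)
    refine ⟨K, hK, fun t ht x hx y hy => ?_⟩
    have := hKb t ht _ _ (Real.exp_pos y) (Real.exp_pos x) (Real.exp_le_exp.2 hy)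
      (Real.exp_le_exp.2 hx) _ _ _ _ (hs _ _ (Real.exp_pos y)) (hs _ _ (Real.exp_pos x))
    simpa only [Real.log_exp] using this)
  have hxc : ContinuousOn x (Ici 0) := fun t ht => (hx t ht).continuousWithinAt
  refine ⟨fun r t => σs (Real.exp (x t)) (φ t) r, fun t => Real.exp (x t),
    fun t => Real.exp (x t) * N t (x t), ?_, ?_, ?_, ?_⟩
  · constructor
    · exact fun t _ => Real.exp_pos _
    · exact fun t _ => ⟨_, (hs _ _ (Real.exp_pos _)).toStat⟩
    · exact fun t ht => (hx t ht).exp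
    · intro t ht
      simp only [hN]
      have : Real.exp (x t) ≠ 0 := (Real.exp_pos _).ne'
      simp only [mul_comm (Sfun _ _ _ _)]
      field_simp
  · simp only [hx0, Real.exp_log hR₀]
  · intro t ht
    have hmono : MonotoneOn (fun t => x t + ν / 3 * t) (Ici 0) := by
      have hdd : ∀ s ∈ Ioi (0:ℝ), HasDerivAt (fun t => x t + ν / 3 * t) (N s (x s) + ν / 3) s := by
        intro s hs'
        have h1 := (hx s (le_of_lt hs')).hasDerivAt (Ici_mem_nhds hs')
        have h2 := (hasDerivAt_id s).const_mul (ν / 3)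
        exact (h1.add h2).congr_deriv (by simp)
      apply monotoneOn_of_deriv_nonneg (convex_Ici _)
      · exact hxc.add (by fun_prop)
      · rw [interior_Ici]
        exact fun s hs' => (hdd s hs').differentiableAt.differentiableWithinAt
      · rw [interior_Ici]
        intro s hs'
        rw [(hdd s hs').deriv]
        have := hNlow s (x s)
        linarith
    have h1 := hmono (mem_Ici.2 le_rfl) (mem_Ici.2 ht) ht
    simp only [hx0] at h1
    calc R₀ * Real.exp (-ν * t / 3) = Real.exp (Real.log R₀ + -ν * t / 3) := by
          rw [Real.exp_add, Real.exp_log hR₀]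
      _ ≤ Real.exp (x t) := Real.exp_le_exp.2 (by linarith)
  · intro τ Q Q' hQ hQ0 t ht
    have hQc : ContinuousOn Q (Ici 0) := fun s hs' => (hQ.deriv s hs').continuousWithinAt
    obtain ⟨B1, hB1⟩ := isCompact_Icc.bddAbove_image (hQc.mono (Icc_subset_Ici_self : Icc 0 t ⊆ _))
    obtain ⟨B2, hB2⟩ := isCompact_Icc.bddAbove_image
      ((hxc.mono (Icc_subset_Ici_self : Icc 0 t ⊆ _)).rexp)
    obtain ⟨K, hK, hKb⟩ := hgr t (max B1 B2)
    have := ode_uniq (x := fun s => Real.log (Q s)) (y := x) (a := fun s => Q' s / Q s)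
      (b := fun s => N s (x s)) (Tm := t) hK
      (ContinuousOn.log (hQc.mono Icc_subset_Ici_self) (fun s hs' => (hQ.pos s hs'.1).ne'))
      (hxc.mono Icc_subset_Ici_self)
      (fun s hs' => ((hQ.deriv s hs'.1.le).hasDerivAt (Ici_mem_nhds hs'.1)).log
        (hQ.pos s hs'.1.le).ne')
      (fun s hs' => (hx s hs'.1.le).hasDerivAt (Ici_mem_nhds hs'.1))
      (by
        intro s hs'
        have hs'' := Ioo_subset_Icc_self hs'
        obtain ⟨p, hp⟩ := hQ.stat s hs'.1.le
        have hQp := hQ.pos s hs'.1.le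
        have h1 := hKb s hs'' _ _ (Real.exp_pos (x s)) hQp
          (le_max_of_le_right (hB2 (mem_image_of_mem _ hs'')))
          (le_max_of_le_left (hB1 (mem_image_of_mem _ hs''))) _ _ _ _
          (hs _ _ (Real.exp_pos (x s))) hp.toSS
        rw [Real.log_exp] at h1
        have h2 := hQ.ode s hs'.1
        simp only [mul_comm (Sfun _ _ _ _)] at h2
        rw [← h2] at h1
        have h3 : Q s ^ 2 * Q' s / Q s ^ 3 = Q' s / Q s := by
          have := hQp.ne'
          field_simp
        rw [h3] at h1
        exact h1)
      (by simp only [hQ0, hx0]) t ⟨ht, le_rfl⟩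
    show Q t = Real.exp (x t)
    rw [← this, Real.exp_log (hQ.pos t ht)]
end

section
/- Assume (A1). Then for every σ̄ > 0 and every R > 0, the stationary radial nutrient problem with parameters σ̄ and R admits exactly one solution σ : [0,R] → ℝ. -/
open MeasureTheory Set Filter Topology

noncomputable def Qop (h : ℝ → ℝ) (s : ℝ) : ℝ := (s^2)⁻¹ * ∫ l in (0:ℝ)..s, l^2 * h l

lemma bdd_ii {h : ℝ → ℝ} {M : ℝ} (hm : Measurable h) (hb : ∀ x, |h x| ≤ M) (a b : ℝ) :
    IntervalIntegrable h volume a b := by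
  refine (intervalIntegrable_const (c := M)).mono_fun hm.aestronglyMeasurable ?_
  filter_upwards with x
  have := hb x
  simp only [Real.norm_eq_abs]
  exact this.trans (le_abs_self M)

lemma sq_ii {h : ℝ → ℝ} {M : ℝ} (hm : Measurable h) (hb : ∀ x, |h x| ≤ M) (a b : ℝ) :
    IntervalIntegrable (fun l => l^2 * h l) volume a b :=
  (bdd_ii hm hb a b).continuousOn_mul (by fun_prop)

lemma Qop_bound {h : ℝ → ℝ} {M : ℝ} (hm : Measurable h) (hb : ∀ x, |h x| ≤ M) (s : ℝ)
    (hs : 0 ≤ s) : |Qop h s| ≤ ∫ l in (0:ℝ)..s, |h l| := by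
  have h1 : |∫ l in (0:ℝ)..s, l^2 * h l| ≤ ∫ l in (0:ℝ)..s, s^2 * |h l| := by
    refine (intervalIntegral.abs_integral_le_integral_abs hs).trans ?_
    refine intervalIntegral.integral_mono_on hs (sq_ii hm hb _ _).abs
      ((bdd_ii hm hb _ _).abs.const_mul _) ?_
    intro x hx
    rw [abs_mul, abs_of_nonneg (sq_nonneg x)]
    have := pow_le_pow_left₀ hx.1 hx.2 2
    gcongr
  rw [intervalIntegral.integral_const_mul] at h1
  unfold Qop
  rw [abs_mul, abs_of_nonneg (by positivity : 0 ≤ (s^2)⁻¹)]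
  rcases hs.eq_or_lt with h0 | h0
  · subst h0; simp
  · rw [inv_mul_le_iff₀ (by positivity)]; exact h1

lemma Qop_abs {h : ℝ → ℝ} {M : ℝ} (hb : ∀ x, |h x| ≤ M) (s : ℝ) :
    |Qop h s| ≤ M * |s| := by
  have h1 : ‖∫ l in (0:ℝ)..s, l^2 * h l‖ ≤ (s^2 * M) * |s - 0| := by
    apply intervalIntegral.norm_integral_le_of_norm_le_const
    intro x hx
    rw [norm_mul, Real.norm_eq_abs, Real.norm_eq_abs, abs_of_nonneg (sq_nonneg x)]
    have : x^2 ≤ s^2 := by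
      rw [sq_le_sq]
      rcases le_total 0 s with h | h
      · rw [uIoc_of_le h] at hx
        rw [abs_of_pos hx.1, abs_of_nonneg h]; exact hx.2
      · rw [uIoc_of_ge h] at hx
        rw [abs_of_nonpos hx.2, abs_of_nonpos h]; linarith [hx.1]
    have := hb x
    have := abs_nonneg (h x)
    gcongr
  rw [Real.norm_eq_abs, sub_zero, mul_assoc] at h1
  unfold Qop
  rw [abs_mul, abs_of_nonneg (by positivity : 0 ≤ (s^2)⁻¹)]
  by_cases h0 : s = 0
  · subst h0; simp
  · rw [inv_mul_le_iff₀ (by positivity)]; exact h1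

lemma Qop_cont {h : ℝ → ℝ} {M : ℝ} (hm : Measurable h) (hb : ∀ x, |h x| ≤ M) :
    Continuous (Qop h) := by
  rw [continuous_iff_continuousAt]
  intro s
  by_cases h0 : s = 0
  · subst h0
    have : Qop h 0 = 0 := by simp [Qop]
    rw [ContinuousAt, this]
    apply squeeze_zero_norm (a := fun s => M * |s|) (Qop_abs hb)
    have : Continuous (fun s : ℝ => M * |s|) := by fun_prop
    simpa using this.tendsto 0
  · unfold Qop
    apply ContinuousAt.mul
    · exact ContinuousAt.inv₀ (by fun_prop) (by positivity)
    · exact (intervalIntegral.continuous_primitive (fun a b => sq_ii hm hb a b) 0).continuousAt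

lemma Qop_sub {h k : ℝ → ℝ} {M : ℝ} (hm : Measurable h) (hb : ∀ x, |h x| ≤ M)
    (km : Measurable k) (kb : ∀ x, |k x| ≤ M) (s : ℝ) :
    Qop h s - Qop k s = Qop (fun l => h l - k l) s := by
  unfold Qop
  rw [← mul_sub, ← intervalIntegral.integral_sub (sq_ii hm hb _ _) (sq_ii km kb _ _)]
  simp only [mul_sub]

lemma Qop_sub_bound {h k : ℝ → ℝ} {M : ℝ} (hm : Measurable h) (hb : ∀ x, |h x| ≤ M)
    (km : Measurable k) (kb : ∀ x, |k x| ≤ M) (s : ℝ) (hs : 0 ≤ s) :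
    |Qop h s - Qop k s| ≤ ∫ l in (0:ℝ)..s, |h l - k l| := by
  rw [Qop_sub hm hb km kb]
  refine Qop_bound (M := M + M) (hm.sub km) (fun x => ?_) s hs
  exact (abs_sub _ _).trans (add_le_add (hb x) (kb x))

noncomputable def cut (b : ℝ) (G : ℝ → ℝ) (l : ℝ) : ℝ := if b < l then G l else 0

lemma cut_meas {G : ℝ → ℝ} (b : ℝ) (hG : Measurable G) : Measurable (cut b G) :=
  Measurable.ite measurableSet_Ioi hG measurable_const

lemma cut_bd {G : ℝ → ℝ} {M : ℝ} (b : ℝ) (hG : ∀ x, |G x| ≤ M) (x : ℝ) : |cut b G x| ≤ M := by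
  unfold cut
  split_ifs
  · exact hG x
  · simpa using (abs_nonneg _).trans (hG x)

lemma int_cut {G K E : ℝ → ℝ} {M : ℝ} (b b' : ℝ) (hG : Measurable G) (hGb : ∀ x, |G x| ≤ M)
    (hK : Measurable K) (hKb : ∀ x, |K x| ≤ M) (s : ℝ) (hs : 0 ≤ s) (hE : Continuous E)
    (hd : ∀ l ∈ Icc 0 s, |G l - K l| ≤ E l) :
    ∫ l in (0:ℝ)..s, |cut b G l - cut b' K l| ≤ (∫ l in (0:ℝ)..s, E l) + M * |b - b'| := by
  have hM : 0 ≤ M := (abs_nonneg _).trans (hGb 0)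
  have hI : Integrable ((uIoc b b').indicator (fun _ => M)) := by
    rw [integrable_indicator_iff measurableSet_uIoc]
    exact integrableOn_const (hs := by rw [uIoc]; simp) (hC := by simp)
  have h1 : ∫ l in (0:ℝ)..s, |cut b G l - cut b' K l| ≤
      ∫ l in (0:ℝ)..s, (E l + (uIoc b b').indicator (fun _ => M) l) := by
    refine intervalIntegral.integral_mono_on hs ?_ ?_ ?_
    · exact (bdd_ii (M := M + M) ((cut_meas b hG).sub (cut_meas b' hK)) (fun x =>
        (abs_sub _ _).trans (add_le_add (cut_bd b hGb x) (cut_bd b' hKb x))) _ _).abs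
    · exact (hE.intervalIntegrable _ _).add hI.intervalIntegrable
    · intro l hl
      have h2 := hd l hl
      have h3 := abs_nonneg (G l - K l)
      have h4 := hGb l
      have h5 := hKb l
      unfold cut indicator
      simp only [mem_uIoc]
      split_ifs with ha hb hc hc hb hc hc
      all_goals first | linarith | (simp only [sub_zero, zero_sub, abs_neg, abs_zero]; linarith) | (exfalso; grind)
  refine h1.trans ?_
  rw [intervalIntegral.integral_add (hE.intervalIntegrable _ _) hI.intervalIntegrable]
  gcongr
  rw [intervalIntegral.integral_of_le hs]
  refine (setIntegral_le_integral hI ?_).trans ?_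
  · filter_upwards with x
    exact indicator_nonneg (fun _ _ => hM) x
  · rw [integral_indicator measurableSet_uIoc, setIntegral_const, uIoc]
    simp only [Measure.real, Real.volume_Ioc, smul_eq_mul]
    rw [max_sub_min_eq_abs', ENNReal.toReal_ofReal (abs_nonneg _)]
    linarith

lemma int_exp_le (lam s : ℝ) (hl : 0 < lam) :
    ∫ l in (0:ℝ)..s, Real.exp (lam * l) ≤ Real.exp (lam * s) / lam := by
  have : ∫ l in (0:ℝ)..s, Real.exp (lam * l) = Real.exp (lam * s) / lam - Real.exp (lam*0) / lam := by
    apply intervalIntegral.integral_eq_sub_of_hasDerivAt (f := fun l => Real.exp (lam*l) / lam)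
    · intro x _
      have := (((hasDerivAt_id x).const_mul lam).exp).div_const lam
      simpa [hl.ne'] using this
    · exact (by fun_prop : Continuous _).intervalIntegrable _ _
  rw [this]
  have : 0 < Real.exp (lam*0) / lam := by positivity
  linarith

noncomputable def Wf (R : ℝ) (hR : 0 ≤ R) (lam c : ℝ) (v : C(Icc (0:ℝ) R, ℝ)) (l : ℝ) : ℝ :=
  c + Real.exp (lam * l) * IccExtend hR v l

lemma Wf_cont (R : ℝ) (hR : 0 ≤ R) (lam c : ℝ) (v : C(Icc (0:ℝ) R, ℝ)) :
    Continuous (Wf R hR lam c v) := by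
  have : Continuous (IccExtend hR v) := v.continuous.Icc_extend'
  unfold Wf
  fun_prop

lemma Qint_cont {h : ℝ → ℝ} {M : ℝ} (hm : Measurable h) (hb : ∀ x, |h x| ≤ M) :
    Continuous (fun r => ∫ s in (0:ℝ)..r, Qop h s) :=
  intervalIntegral.continuous_primitive (fun a b => (Qop_cont hm hb).intervalIntegrable a b) 0

lemma core_est {F : ℝ → ℝ} {L M : ℝ} (R : ℝ) (hR : 0 ≤ R) (lam : ℝ) (hlam : 0 < lam) (hL : 0 ≤ L)
    (hFc : Continuous F)
    (hF : ∀ x y, |F x - F y| ≤ L * |x - y|) (hFb : ∀ x, |F x| ≤ M) (c b c' b' : ℝ)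
    (v v' : C(Icc (0:ℝ) R, ℝ)) (r : ℝ) (hr : r ∈ Icc 0 R) :
    |(∫ s in (0:ℝ)..r, Qop (cut b (fun l => F (Wf R hR lam c v l))) s) -
      ∫ s in (0:ℝ)..r, Qop (cut b' (fun l => F (Wf R hR lam c' v' l))) s| ≤
      R * (R * L * |c - c'| + M * |b - b'|) + L / lam ^ 2 * dist v v' * Real.exp (lam * r) := by
  have hM : 0 ≤ M := (abs_nonneg _).trans (hFb 0)
  have m1 : Measurable (fun l => F (Wf R hR lam c v l)) :=
    (hFc.comp (Wf_cont R hR lam c v)).measurable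
  have m2 : Measurable (fun l => F (Wf R hR lam c' v' l)) :=
    (hFc.comp (Wf_cont R hR lam c' v')).measurable
  have q1 := Qop_cont (cut_meas b m1) (cut_bd b (fun x => hFb _))
  have q2 := Qop_cont (cut_meas b' m2) (cut_bd b' (fun x => hFb _))
  have hpt : ∀ l, |F (Wf R hR lam c v l) - F (Wf R hR lam c' v' l)| ≤
      L * |c - c'| + L * dist v v' * Real.exp (lam * l) := by
    intro l
    refine (hF _ _).trans ?_
    rw [mul_assoc, ← mul_add]
    gcongr
    have e : Wf R hR lam c v l - Wf R hR lam c' v' l =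
      (c - c') + Real.exp (lam * l) * (IccExtend hR v l - IccExtend hR v' l) := by
      unfold Wf; ring
    rw [e]
    refine (abs_add_le _ _).trans ?_
    rw [abs_mul, abs_of_pos (Real.exp_pos _), mul_comm (dist v v')]
    gcongr
    exact ContinuousMap.dist_apply_le_dist (f := v) (g := v') _
  have hq : ∀ s ∈ Icc 0 r, |Qop (cut b (fun l => F (Wf R hR lam c v l))) s -
      Qop (cut b' (fun l => F (Wf R hR lam c' v' l))) s| ≤
      (R * L * |c - c'| + M * |b - b'|) + L / lam * dist v v' * Real.exp (lam * s) := by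
    intro s hs
    refine (Qop_sub_bound (cut_meas b m1) (cut_bd b (fun x => hFb _))
      (cut_meas b' m2) (cut_bd b' (fun x => hFb _)) s hs.1).trans ?_
    refine (int_cut b b' m1 (fun x => hFb _) m2 (fun x => hFb _) s hs.1
      (E := fun l => L * |c - c'| + L * dist v v' * Real.exp (lam * l)) (by fun_prop)
      (fun l _ => hpt l)).trans ?_
    rw [intervalIntegral.integral_add (by simp)
      ((by fun_prop : Continuous _).intervalIntegrable _ _),
      intervalIntegral.integral_const_mul (L * dist v v'), intervalIntegral.integral_const]
    have h1 := int_exp_le lam s hlam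
    have h2 : L * dist v v' * (∫ l in (0:ℝ)..s, Real.exp (lam * l)) ≤
      L * dist v v' * (Real.exp (lam * s) / lam) := by gcongr
    have h3 : (s - 0) • (L * |c - c'|) ≤ R * (L * |c - c'|) := by
      rw [smul_eq_mul]; gcongr; linarith [hs.2, hr.2]
    have h4 : L * dist v v' * (Real.exp (lam * s) / lam) =
       L / lam * dist v v' * Real.exp (lam * s) := by ring
    linarith
  rw [← intervalIntegral.integral_sub (q1.intervalIntegrable _ _) (q2.intervalIntegrable _ _)]
  refine (intervalIntegral.abs_integral_le_integral_abs hr.1).trans ?_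
  refine (intervalIntegral.integral_mono_on hr.1
    ((by fun_prop : Continuous _).intervalIntegrable _ _)
    ((by fun_prop : Continuous _).intervalIntegrable _ _) hq).trans ?_
  rw [intervalIntegral.integral_add (by simp)
      ((by fun_prop : Continuous _).intervalIntegrable _ _),
      intervalIntegral.integral_const_mul, intervalIntegral.integral_const]
  have h1 := int_exp_le lam r hlam
  have h2 : L / lam * dist v v' * (∫ l in (0:ℝ)..r, Real.exp (lam * l)) ≤
      L / lam * dist v v' * (Real.exp (lam * r) / lam) := by gcongr
  have h3 : (r - 0) • (R * L * |c - c'| + M * |b - b'|) ≤ R * (R * L * |c - c'| + M * |b - b'|) := by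
    rw [smul_eq_mul]; gcongr; linarith [hr.2]
  have h4 : L / lam * dist v v' * (Real.exp (lam * r) / lam) =
      L / lam ^ 2 * dist v v' * Real.exp (lam * r) := by field_simp
  linarith

lemma fam {F : ℝ → ℝ} {L M : ℝ} (R : ℝ) (hR : 0 ≤ R) (hL : 0 ≤ L) (hFc : Continuous F)
    (hF : ∀ x y, |F x - F y| ≤ L * |x - y|) (hFb : ∀ x, |F x| ≤ M) :
    ∃ u : ℝ → ℝ → ℝ → ℝ, (∀ c b, Continuous (u c b)) ∧
      (∀ c b, ∀ r ∈ Icc 0 R, u c b r = c + ∫ s in (0:ℝ)..r, Qop (cut b (fun l => F (u c b l))) s) ∧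
      ∃ C, 0 ≤ C ∧ ∀ c b c' b', ∀ r ∈ Icc 0 R,
        |u c b r - u c' b' r| ≤ C * (|c - c'| + |b - b'|) := by
  have hM : 0 ≤ M := (abs_nonneg _).trans (hFb 0)
  obtain ⟨lam, hlam⟩ : ∃ lam, lam = L + 1 := ⟨_, rfl⟩
  have hl0 : 0 < lam := by linarith
  have hK : L / lam ^ 2 ≤ 1 / 2 := by
    rw [div_le_iff₀ (by positivity), hlam]; nlinarith
  have m1 : ∀ c v, Measurable (fun l => F (Wf R hR lam c v l)) := fun c v =>
    (hFc.comp (Wf_cont R hR lam c v)).measurable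
  let T : ℝ → ℝ → C(Icc (0:ℝ) R, ℝ) → C(Icc (0:ℝ) R, ℝ) := fun c b v =>
    ⟨fun r => Real.exp (-(lam * r)) *
      ∫ s in (0:ℝ)..r, Qop (cut b (fun l => F (Wf R hR lam c v l))) s, by
        have := Qint_cont (cut_meas b (m1 c v)) (cut_bd b (fun x => hFb _))
        have h2 : Continuous (fun r => Real.exp (-(lam * r)) *
          ∫ s in (0:ℝ)..r, Qop (cut b (fun l => F (Wf R hR lam c v l))) s) := by fun_prop
        exact h2.comp continuous_subtype_val⟩
  have hT : ∀ c b c' b' v v', dist (T c b v) (T c' b' v') ≤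
      R * (R * L * |c - c'| + M * |b - b'|) + 1 / 2 * dist v v' := by
    intro c b c' b' v v'
    rw [ContinuousMap.dist_le (by positivity)]
    intro r
    have h := core_est R hR lam hl0 hL hFc hF hFb c b c' b' v v' r r.2
    simp only [T, ContinuousMap.coe_mk, Real.dist_eq]
    rw [← mul_sub, abs_mul, abs_of_pos (Real.exp_pos _)]
    have he : Real.exp (-(lam * r)) ≤ 1 := by
      rw [Real.exp_le_one_iff]; have := r.2.1; simp; positivity
    have hee : Real.exp (-(lam * r)) * Real.exp (lam * r) = 1 := by
      rw [← Real.exp_add]; simp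
    calc _ ≤ Real.exp (-(lam * r)) * (R * (R * L * |c - c'| + M * |b - b'|) + L / lam ^ 2 * dist v v' * Real.exp (lam * r)) := by gcongr
      _ = Real.exp (-(lam * r)) * (R * (R * L * |c - c'| + M * |b - b'|)) + L / lam ^ 2 * dist v v' * (Real.exp (-(lam * r)) * Real.exp (lam * r)) := by ring
      _ ≤ 1 * (R * (R * L * |c - c'| + M * |b - b'|)) + 1 / 2 * dist v v' * 1 := by
        rw [hee]; gcongr
      _ = _ := by ring
  have hcon : ∀ c b, ContractingWith (1/2) (T c b) := by
    intro c b
    refine ⟨by norm_num, LipschitzWith.of_dist_le_mul fun v v' => ?_⟩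
    have := hT c b c b v v'
    simpa using this
  let v : ℝ → ℝ → C(Icc (0:ℝ) R, ℝ) := fun c b => ContractingWith.fixedPoint (T c b) (hcon c b)
  have hv : ∀ c b, T c b (v c b) = v c b := fun c b => (hcon c b).fixedPoint_isFixedPt
  have hd : ∀ c b c' b', dist (v c b) (v c' b') ≤ 2 * (R * (R * L * |c - c'| + M * |b - b'|)) := by
    intro c b c' b'
    have := hT c b c' b' (v c b) (v c' b')
    rw [hv, hv] at this
    linarith
  refine ⟨fun c b => Wf R hR lam c (v c b), fun c b => Wf_cont _ _ _ _ _, ?_, ?_⟩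
  · intro c b r hr
    have h := congrArg (fun g : C(Icc (0:ℝ) R, ℝ) => g ⟨r, hr⟩) (hv c b)
    simp only [T, ContinuousMap.coe_mk] at h
    have hee : Real.exp (lam * r) * Real.exp (-(lam * r)) = 1 := by
      rw [← Real.exp_add]; simp
    have e : Wf R hR lam c (v c b) r = c + Real.exp (lam * r) * v c b ⟨r, hr⟩ := by
      unfold Wf; rw [IccExtend_of_mem hR _ hr]
    show Wf R hR lam c (v c b) r = _
    rw [e, ← h, ← mul_assoc, hee, one_mul]
  · refine ⟨1 + Real.exp (lam * R) * (2 * (R * (R * L + M))), by positivity, ?_⟩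
    intro c b c' b' r hr
    have e : Wf R hR lam c (v c b) r - Wf R hR lam c' (v c' b') r =
      (c - c') + Real.exp (lam * r) * (IccExtend hR (v c b) r - IccExtend hR (v c' b') r) := by
      unfold Wf; ring
    show |Wf R hR lam c (v c b) r - Wf R hR lam c' (v c' b') r| ≤ _
    rw [e]
    refine (abs_add_le _ _).trans ?_
    rw [abs_mul, abs_of_pos (Real.exp_pos _)]
    have h1 : |IccExtend hR (v c b) r - IccExtend hR (v c' b') r| ≤
        2 * (R * (R * L * |c - c'| + M * |b - b'|)) :=
      (ContinuousMap.dist_apply_le_dist (f := v c b) (g := v c' b') _).trans (hd c b c' b')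
    have h0 := abs_nonneg (c - c')
    have h0' := abs_nonneg (b - b')
    have h2 : 2 * (R * (R * L * |c - c'| + M * |b - b'|)) ≤
        2 * (R * (R * L + M)) * (|c - c'| + |b - b'|) := by
      have : R * L * |c - c'| + M * |b - b'| ≤ (R * L + M) * (|c - c'| + |b - b'|) := by
        have : 0 ≤ R * L * |b - b'| := by positivity
        have : 0 ≤ M * |c - c'| := by positivity
        linarith
      calc _ ≤ 2 * (R * ((R * L + M) * (|c - c'| + |b - b'|))) := by gcongr
        _ = _ := by ring
    calc _ ≤ (|c - c'| + |b - b'|) + Real.exp (lam * R) * (2 * (R * (R * L + M)) * (|c - c'| + |b - b'|)) := by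
            gcongr
            · linarith
            · exact hr.2
            · exact h1.trans h2
      _ = _ := by ring

lemma trunc_lip {f : ℝ → ℝ} (hf : C1StrictInc f) (K : ℝ) (hK : 0 < K) :
    ∃ L, 0 ≤ L ∧ ∀ x y, |f (max 0 (min x K)) - f (max 0 (min y K))| ≤ L * |x - y| := by
  have hc : ContinuousOn (derivWithin f (Ici 0)) (Icc 0 K) :=
    (hf.1.continuousOn_derivWithin (uniqueDiffOn_Ici 0) le_rfl).mono Icc_subset_Ici_self
  obtain ⟨C, hC⟩ := isCompact_Icc.exists_bound_of_continuousOn hc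
  have hC0 : 0 ≤ C := (norm_nonneg _).trans (hC 0 ⟨le_rfl, hK.le⟩)
  refine ⟨C, hC0, fun x y => ?_⟩
  have hmem : ∀ x, max 0 (min x K) ∈ Icc 0 K := fun x =>
    ⟨le_max_left _ _, max_le hK.le (min_le_right _ _)⟩
  have h := (convex_Icc 0 K).norm_image_sub_le_of_norm_hasDerivWithin_le (f := f)
    (f' := derivWithin f (Ici 0)) (C := C)
    (fun z hz => ((hf.1.differentiableOn one_ne_zero z hz.1).hasDerivWithinAt).mono Icc_subset_Ici_self)
    hC (hmem y) (hmem x)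
  rw [Real.norm_eq_abs, Real.norm_eq_abs] at h
  refine h.trans (mul_le_mul_of_nonneg_left ?_ hC0)
  have h1 := abs_max_sub_max_le_abs (min x K) (min y K) 0
  have h2 := abs_min_sub_min_le_max x K y K
  rw [max_comm 0, max_comm 0]
  refine h1.trans (h2.trans ?_)
  simp

lemma Qop_nonneg {h : ℝ → ℝ} (hh : ∀ x, 0 ≤ h x) (s : ℝ) (hs : 0 ≤ s) : 0 ≤ Qop h s := by
  unfold Qop
  have := intervalIntegral.integral_nonneg (μ := volume) hs
    (fun x _ => mul_nonneg (sq_nonneg x) (hh x))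
  positivity

lemma exist_main (β σD : ℝ) (hβ : 0 < β) (hσD : 0 < σD)
    (f : ℝ → ℝ) (hf : C1StrictInc f) (hf0 : f 0 = 0) (σbar : ℝ) (hσ : σD < σbar) (R : ℝ)
    (hR : 0 < R) : ∃ (σ σ' : ℝ → ℝ), IsStationarySol f β σD σbar R σ σ' := by
  have hsb : 0 < σbar := hσD.trans hσ
  obtain ⟨L, hL, hlip⟩ := trunc_lip hf σbar hsb
  obtain ⟨F, hFdef⟩ : ∃ F : ℝ → ℝ, ∀ x, F x = f (max 0 (min x σbar)) := ⟨_, fun _ => rfl⟩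
  have hF : ∀ x y, |F x - F y| ≤ L * |x - y| := by
    intro x y; rw [hFdef, hFdef]; exact hlip x y
  have hfm := hf.2.monotoneOn
  have hFmono : Monotone F := by
    intro x y hxy
    rw [hFdef, hFdef]
    exact hfm (mem_Ici.2 (le_max_left _ _)) (mem_Ici.2 (le_max_left _ _))
      (max_le_max le_rfl (min_le_min hxy le_rfl))
  have hF0 : ∀ x, 0 ≤ F x := by
    intro x; rw [hFdef]
    refine hf0.symm.le.trans ?_
    exact hfm (mem_Ici.2 le_rfl) (mem_Ici.2 (le_max_left _ _)) (le_max_left _ _)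
  have hFb : ∀ x, |F x| ≤ f σbar := by
    intro x; rw [abs_of_nonneg (hF0 x), hFdef]
    exact hfm (mem_Ici.2 (le_max_left _ _)) (mem_Ici.2 hsb.le) (max_le hsb.le (min_le_right _ _))
  have hFe : ∀ x, 0 ≤ x → x ≤ σbar → F x = f x := by
    intro x h1 h2; rw [hFdef, min_eq_left h2, max_eq_right h1]
  have hFD : 0 < F σD := by
    rw [hFe _ hσD.le hσ.le, ← hf0]
    exact hf.2 (mem_Ici.2 le_rfl) (mem_Ici.2 hσD.le) hσD
  have hFc : Continuous F := (LipschitzWith.of_dist_le' (K := L) hF).continuous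
  obtain ⟨u, huc, hue, C, hC0, hC⟩ := fam R hR.le hL hFc hF hFb
  have um : ∀ c b, Measurable (fun l => F (u c b l)) := fun c b =>
    (hFc.comp (huc c b)).measurable
  have qc : ∀ c b, Continuous (Qop (cut b (fun l => F (u c b l)))) := fun c b =>
    Qop_cont (cut_meas b (um c b)) (cut_bd b (fun x => hFb _))
  have cutnn : ∀ c b x, 0 ≤ cut b (fun l => F (u c b l)) x := by
    intro c b x; unfold cut; split_ifs
    · exact hF0 _
    · exact le_rfl
  have qn : ∀ c b s, 0 ≤ s → 0 ≤ Qop (cut b (fun l => F (u c b l))) s := fun c b s hs =>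
    Qop_nonneg (cutnn c b) s hs
  have uge : ∀ c b, ∀ r ∈ Icc 0 R, c ≤ u c b r := by
    intro c b r hr
    rw [hue c b r hr]
    have := intervalIntegral.integral_nonneg (μ := volume) hr.1 (fun x hx => qn c b x hx.1)
    linarith
  let cc : ℝ → ℝ := fun t => σD + max t 0
  let bb : ℝ → ℝ := fun t => max (-t) 0
  have hcc : ∀ t t', |cc t - cc t'| ≤ |t - t'| := by
    intro t t'
    have := abs_max_sub_max_le_abs t t' 0
    simpa [cc] using this
  have hbb : ∀ t t', |bb t - bb t'| ≤ |t - t'| := by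
    intro t t'
    have := abs_max_sub_max_le_abs (-t) (-t') 0
    have e : |-t - -t'| = |t - t'| := by rw [← abs_neg]; congr 1; ring
    rw [e] at this
    exact this
  let φ : ℝ → ℝ := fun t => Qop (cut (bb t) (fun l => F (u (cc t) (bb t) l))) R +
    β * (u (cc t) (bb t) R - σbar)
  have hM : 0 ≤ f σbar := (abs_nonneg _).trans (hFb 0)
  have hud : ∀ t t', ∀ r ∈ Icc 0 R, |u (cc t) (bb t) r - u (cc t') (bb t') r| ≤
      2 * C * |t - t'| := by
    intro t t' r hr
    refine (hC _ _ _ _ r hr).trans ?_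
    have := hcc t t'
    have := hbb t t'
    calc _ ≤ C * (|t - t'| + |t - t'|) := by gcongr
      _ = _ := by ring
  have hφ : ∀ t t', dist (φ t) (φ t') ≤ (R * (L * (2 * C)) + f σbar + β * (2 * C)) * dist t t' := by
    intro t t'
    rw [Real.dist_eq, Real.dist_eq]
    have h1 := Qop_sub_bound (cut_meas (bb t) (um (cc t) (bb t))) (cut_bd (bb t) (fun x => hFb _))
      (cut_meas (bb t') (um (cc t') (bb t'))) (cut_bd (bb t') (fun x => hFb _)) R hR.le
    have h2 := int_cut (bb t) (bb t') (um (cc t) (bb t)) (fun x => hFb _) (um (cc t') (bb t'))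
      (fun x => hFb _) R hR.le (E := fun _ => L * (2 * C * |t - t'|)) continuous_const
      (fun l hl => (hF _ _).trans (mul_le_mul_of_nonneg_left (hud t t' l hl) hL))
    rw [intervalIntegral.integral_const, smul_eq_mul, sub_zero] at h2
    have h3 := mul_le_mul_of_nonneg_left (hbb t t') hM
    have h4 := mul_le_mul_of_nonneg_left (hud t t' R ⟨hR.le, le_rfl⟩) hβ.le
    have e : φ t - φ t' = (Qop (cut (bb t) (fun l => F (u (cc t) (bb t) l))) R -
      Qop (cut (bb t') (fun l => F (u (cc t') (bb t') l))) R) +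
      β * (u (cc t) (bb t) R - u (cc t') (bb t') R) := by simp only [φ]; ring
    rw [e]
    refine (abs_add_le _ _).trans ?_
    rw [abs_mul, abs_of_pos hβ]
    linarith
  have hφc : Continuous φ := (LipschitzWith.of_dist_le' hφ).continuous
  -- vanishing before b
  have qz : ∀ c b, ∀ s, 0 ≤ s → s ≤ b → Qop (cut b (fun l => F (u c b l))) s = 0 := by
    intro c b s hs hsb
    unfold Qop
    have : ∫ l in (0:ℝ)..s, l ^ 2 * cut b (fun l => F (u c b l)) l = ∫ l in (0:ℝ)..s, (0:ℝ) := by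
      apply intervalIntegral.integral_congr
      intro l hl
      rw [uIcc_of_le hs] at hl
      have : ¬ b < l := by linarith [hl.2]
      simp [cut, this]
    rw [this]; simp
  have uz : ∀ c b, ∀ r ∈ Icc 0 R, r ≤ b → u c b r = c := by
    intro c b r hr hrb
    rw [hue c b r hr]
    have : ∫ s in (0:ℝ)..r, Qop (cut b (fun l => F (u c b l))) s = ∫ l in (0:ℝ)..r, (0:ℝ) := by
      apply intervalIntegral.integral_congr
      intro l hl
      rw [uIcc_of_le hr.1] at hl
      exact qz c b l hl.1 (hl.2.trans hrb)
    rw [this]; simp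
  have hRR : R ∈ Icc 0 R := ⟨hR.le, le_rfl⟩
  have hneg : φ (-R) ≤ 0 := by
    have e1 : cc (-R) = σD := by simp [cc, hR.le]
    have e2 : bb (-R) = R := by simp [bb, hR.le]
    simp only [φ, e1, e2]
    rw [qz _ _ _ hR.le le_rfl, uz _ _ _ hRR le_rfl]
    nlinarith
  have hpos : 0 ≤ φ (σbar - σD) := by
    have e1 : cc (σbar - σD) = σbar := by simp [cc, hσ.le]
    simp only [φ]
    have h1 := qn (cc (σbar - σD)) (bb (σbar - σD)) R hR.le
    have h2 := uge (cc (σbar - σD)) (bb (σbar - σD)) R hRR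
    nth_rewrite 1 [e1] at h2
    have := mul_nonneg hβ.le (sub_nonneg.2 h2)
    linarith
  obtain ⟨t, -, ht⟩ := intermediate_value_Icc (by linarith : -R ≤ σbar - σD) hφc.continuousOn
    ⟨hneg, hpos⟩
  have hcD : σD ≤ cc t := by simp [cc]
  have hb0 : 0 ≤ bb t := by simp [bb]
  have hcb : cc t = σD ∨ bb t = 0 := by
    rcases le_total t 0 with h | h
    · left; simp [cc, h]
    · right; simp [bb, h]
  simp only [φ] at ht
  generalize cc t = c at *
  generalize bb t = b at *
  have hle : u c b R ≤ σbar := by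
    have := qn c b R hR.le
    by_contra hcon
    push Not at hcon
    have := mul_pos hβ (sub_pos.2 hcon)
    linarith
  have uii : ∀ x y, IntervalIntegrable (Qop (cut b (fun l => F (u c b l)))) volume x y :=
    fun x y => (qc c b).intervalIntegrable x y
  have ule : ∀ r ∈ Icc 0 R, u c b r ≤ σbar := by
    intro r hr
    refine le_trans ?_ hle
    rw [hue c b r hr, hue c b R hRR, ← intervalIntegral.integral_add_adjacent_intervals (uii 0 r) (uii r R)]
    have := intervalIntegral.integral_nonneg (μ := volume) hr.2 (fun x hx => qn c b x (hr.1.trans hx.1))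
    linarith
  have qpos : ∀ s, b < s → s ≤ R → 0 < Qop (cut b (fun l => F (u c b l))) s := by
    intro s hs hsR
    unfold Qop
    have i2 := sq_ii (cut_meas b (um c b)) (cut_bd b (fun x => hFb _))
    have : 0 < ∫ l in (0:ℝ)..s, l ^ 2 * cut b (fun l => F (u c b l)) l := by
      rw [← intervalIntegral.integral_add_adjacent_intervals (i2 0 b) (i2 b s)]
      have h1 := intervalIntegral.integral_nonneg (μ := volume) hb0
        (fun x _ => mul_nonneg (sq_nonneg x) (cutnn c b x))
      have h2 := intervalIntegral.intervalIntegral_pos_of_pos_on (i2 b s) (fun x hx => by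
        have hx0 : 0 < x := hb0.trans_lt hx.1
        have : 0 < F (u c b x) := hFD.trans_le (hFmono (hcD.trans (uge c b x
          ⟨hx0.le, hx.2.le.trans hsR⟩)))
        simp only [cut, hx.1, if_true]
        positivity) hs
      linarith
    have : 0 < s := hb0.trans_lt hs
    positivity
  have ugt : ∀ r, b < r → r ≤ R → c < u c b r := by
    intro r hr hrR
    have hr0 : 0 ≤ r := hb0.trans hr.le
    rw [hue c b r ⟨hr0, hrR⟩, ← intervalIntegral.integral_add_adjacent_intervals (uii 0 b) (uii b r)]
    have h1 := intervalIntegral.integral_nonneg (μ := volume) hb0 (fun x hx => qn c b x hx.1)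
    have h2 := intervalIntegral.intervalIntegral_pos_of_pos_on (uii b r) (fun x hx =>
      qpos x hx.1 (hx.2.le.trans hrR)) hr
    linarith
  refine ⟨u c b, Qop (cut b (fun l => F (u c b l))), (huc c b).continuousOn, ?_, ?_, ht⟩
  · intro r hr
    have h1 : HasDerivAt (fun r => c + ∫ s in (0:ℝ)..r, Qop (cut b (fun l => F (u c b l))) s)
        (Qop (cut b (fun l => F (u c b l))) r) r :=
      (intervalIntegral.integral_hasDerivAt_right (uii 0 r)
        (qc c b).stronglyMeasurable.stronglyMeasurableAtFilter (qc c b).continuousAt).const_add c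
    exact h1.hasDerivWithinAt.congr (fun x hx => hue c b x hx) (hue c b r ⟨hr.1.le, hr.2⟩)
  · intro r hr
    have : r ^ 2 * Qop (cut b (fun l => F (u c b l))) r =
        ∫ l in (0:ℝ)..r, l ^ 2 * cut b (fun l => F (u c b l)) l := by
      unfold Qop
      rw [← mul_assoc, mul_inv_cancel₀ (by have := hr.1; positivity), one_mul]
    rw [this]
    apply intervalIntegral.integral_congr
    intro l hl
    rw [uIcc_of_le hr.1.le] at hl
    have hlR : l ≤ R := hl.2.trans hr.2
    by_cases hbl : b < l
    · have h1 := ugt l hbl hlR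
      have h2 : 0 < u c b l - σD := by linarith
      simp only [cut, hbl, if_true, Hside, h2, mul_one]
      rw [hFe _ (by linarith) (ule l ⟨hl.1, hlR⟩)]
    · push Not at hbl
      rcases hcb with h | h
      · have := uz c b l ⟨hl.1, hlR⟩ hbl
        have h9 : ¬ (0 < u c b l - σD) := by rw [this, h]; simp
        simp only [cut, hbl.not_gt, Hside, h9, if_false, mul_zero]
      · have : l = 0 := by linarith [hl.1]
        simp [this]

lemma g_mono {f : ℝ → ℝ} {σD : ℝ} (hσD : 0 < σD) (hf : C1StrictInc f) (hf0 : f 0 = 0) :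
    Monotone (fun s => f s * Hside (s - σD)) := by
  have hfm := hf.2.monotoneOn
  intro x y hxy
  simp only [Hside]
  split_ifs with h1 h2 h2
  · simpa using hfm (mem_Ici.2 (by linarith)) (mem_Ici.2 (by linarith)) hxy
  · exfalso; linarith
  · have := hfm (mem_Ici.2 le_rfl) (mem_Ici.2 (by linarith : 0 ≤ y)) (by linarith : 0 ≤ y)
    simp; linarith
  · simp

lemma g_int {f : ℝ → ℝ} {σD R : ℝ} (hσD : 0 < σD) (hf : C1StrictInc f) (hf0 : f 0 = 0)
    (hR : 0 < R) {σ : ℝ → ℝ} (hσ : ContinuousOn σ (Icc 0 R)) (a b : ℝ) (ha : a ∈ Icc 0 R)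
    (hb : b ∈ Icc 0 R) :
    IntervalIntegrable (fun l => l ^ 2 * f (σ l) * Hside (σ l - σD)) volume a b := by
  have hg := g_mono hσD hf hf0
  have hc : Continuous (IccExtend hR.le (domRestrict (Icc 0 R) σ)) := hσ.domRestrict.Icc_extend'
  obtain ⟨C, hC⟩ := isCompact_Icc.exists_bound_of_continuousOn hσ
  have hm : Measurable (fun l => (fun s => f s * Hside (s - σD))
    (IccExtend hR.le (domRestrict (Icc 0 R) σ) l)) := hg.measurable.comp hc.measurable
  have hbd : ∀ l, |(fun s => f s * Hside (s - σD))
    (IccExtend hR.le (domRestrict (Icc 0 R) σ) l)| ≤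
      max |(fun s => f s * Hside (s - σD)) (-C)| |(fun s => f s * Hside (s - σD)) C| := by
    intro l
    have := hC _ (projIcc 0 R hR.le l).2
    rw [Real.norm_eq_abs, abs_le] at this
    exact abs_le_max_abs_abs (hg this.1) (hg this.2)
  refine (sq_ii hm hbd a b).congr ?_
  intro l hl
  have : l ∈ Icc 0 R := by
    have := uIoc_subset_uIcc hl
    exact (uIcc_subset_Icc ha hb) this
  simp only [IccExtend_of_mem hR.le _ this, domRestrict_apply]
  rw [mul_assoc]

lemma compare (β σD : ℝ) (hβ : 0 < β) (hσD : 0 < σD)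
    (f : ℝ → ℝ) (hf : C1StrictInc f) (hf0 : f 0 = 0) (σbar R : ℝ) (hR : 0 < R)
    (σ σ' τ τ' : ℝ → ℝ) (h1 : IsStationarySol f β σD σbar R σ σ')
    (h2 : IsStationarySol f β σD σbar R τ τ') : ∀ r ∈ Icc 0 R, τ r ≤ σ r := by
  have hg := g_mono hσD hf hf0
  have i1 := g_int hσD hf hf0 hR h1.cont
  have i2 := g_int hσD hf hf0 hR h2.cont
  by_contra! hcon
  obtain ⟨ρ, hρ, hρ'⟩ := hcon
  have hwc : ContinuousOn (fun r => τ r - σ r) (Icc 0 R) := h2.cont.sub h1.cont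
  obtain ⟨r0, hr0, hmax⟩ := isCompact_Icc.exists_isMaxOn ⟨ρ, hρ⟩ hwc
  have hm : 0 < τ r0 - σ r0 := by
    have : τ ρ - σ ρ ≤ τ r0 - σ r0 := hmax hρ
    linarith
  have hwd : ∀ r ∈ Ioc 0 R, HasDerivWithinAt (fun r => τ r - σ r) (τ' r - σ' r) (Icc 0 R) r :=
    fun r hr => (h2.deriv r hr).sub (h1.deriv r hr)
  let k : ℝ → ℝ := fun l => l ^ 2 * f (τ l) * Hside (τ l - σD) - l ^ 2 * f (σ l) * Hside (σ l - σD)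
  have h0R : (0:ℝ) ∈ Icc 0 R := ⟨le_rfl, hR.le⟩
  have hki : ∀ a ∈ Icc 0 R, ∀ b ∈ Icc 0 R, IntervalIntegrable k volume a b :=
    fun a ha b hb => (i2 a b ha hb).sub (i1 a b ha hb)
  have hD : ∀ r ∈ Ioc 0 R, r ^ 2 * (τ' r - σ' r) = ∫ l in (0:ℝ)..r, k l := by
    intro r hr
    have hr' : r ∈ Icc 0 R := ⟨hr.1.le, hr.2⟩
    rw [mul_sub, h2.ode r hr, h1.ode r hr,
      intervalIntegral.integral_sub (i2 0 r h0R hr') (i1 0 r h0R hr')]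
  have hD0 : 0 ≤ ∫ l in (0:ℝ)..r0, k l := by
    rcases hr0.1.eq_or_lt with h | h
    · rw [← h]; simp
    · have hr0' : r0 ∈ Ioc 0 R := ⟨h, hr0.2⟩
      rw [← hD r0 hr0']
      have hloc : IsLocalMaxOn (fun r => τ r - σ r) (Icc 0 R) r0 := hmax.localize
      have := hloc.hasFDerivWithinAt_nonpos (hwd r0 hr0').hasFDerivWithinAt
        (y := -r0) (mem_posTangentConeAt_of_segment_subset (by
          rw [add_neg_cancel]
          exact (convex_Icc 0 R).segment_subset hr0 h0R))
      have h3 : -(r0 * (τ' r0 - σ' r0)) ≤ 0 := by simpa using this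
      have : 0 ≤ τ' r0 - σ' r0 := by
        by_contra hc
        push Not at hc
        nlinarith
      positivity
  have hDr : ∀ r ∈ Icc r0 R, (∀ l ∈ Ico r0 r, 0 < τ l - σ l) → 0 ≤ ∫ l in (0:ℝ)..r, k l := by
    intro r hr hl
    have hr' : r ∈ Icc 0 R := ⟨hr0.1.trans hr.1, hr.2⟩
    rw [← intervalIntegral.integral_add_adjacent_intervals (hki 0 h0R r0 hr0) (hki r0 hr0 r hr')]
    refine add_nonneg hD0 ?_
    rw [intervalIntegral.integral_of_le hr.1, integral_Ioc_eq_integral_Ioo]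
    refine setIntegral_nonneg measurableSet_Ioo (fun l hl' => ?_)
    have h3 := hl l ⟨hl'.1.le, hl'.2⟩
    have h4 := hg (by linarith : σ l ≤ τ l)
    have h5 := mul_le_mul_of_nonneg_left h4 (sq_nonneg l)
    simp only [k]
    simp only at h5
    linarith
  have hpos : ∀ r ∈ Icc r0 R, 0 < τ r - σ r := by
    by_contra! hcon
    obtain ⟨r1, hr1, hr1'⟩ := hcon
    have hsub : Icc r0 R ⊆ Icc 0 R := Icc_subset_Icc_left hr0.1
    have hcomp : IsCompact (Icc r0 R ∩ (fun r => τ r - σ r) ⁻¹' Iic 0) :=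
      isCompact_Icc.of_isClosed_subset
        ((hwc.mono hsub).preimage_isClosed_of_isClosed isClosed_Icc isClosed_Iic) inter_subset_left
    obtain ⟨b, hb, hbl⟩ := hcomp.exists_isLeast ⟨r1, hr1, hr1'⟩
    have hlt : ∀ l ∈ Ico r0 b, 0 < τ l - σ l := by
      intro l hl
      by_contra hc
      push Not at hc
      have := hbl ⟨⟨hl.1, hl.2.le.trans hb.1.2⟩, hc⟩
      linarith [hl.2]
    have hmon : MonotoneOn (fun r => τ r - σ r) (Icc r0 b) := by
      have hda : ∀ x ∈ Ioo r0 b, HasDerivAt (fun r => τ r - σ r) (τ' x - σ' x) x := by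
        intro x hx
        have hx0 : 0 < x := hr0.1.trans_lt hx.1
        have hxR : x < R := hx.2.trans_le hb.1.2
        exact (hwd x ⟨hx0, hxR.le⟩).hasDerivAt (Icc_mem_nhds hx0 hxR)
      refine monotoneOn_of_deriv_nonneg (convex_Icc _ _)
        (hwc.mono (Icc_subset_Icc hr0.1 hb.1.2)) ?_ ?_
      · rw [interior_Icc]
        exact fun x hx => (hda x hx).differentiableAt.differentiableWithinAt
      · rw [interior_Icc]
        intro x hx
        have hx0 : 0 < x := hr0.1.trans_lt hx.1
        have hxR : x < R := hx.2.trans_le hb.1.2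
        rw [(hda x hx).deriv]
        have h3 := hDr x ⟨hx.1.le, hxR.le⟩ (fun l hl => hlt l ⟨hl.1, hl.2.trans hx.2⟩)
        rw [← hD x ⟨hx0, hxR.le⟩] at h3
        exact nonneg_of_mul_nonneg_right h3 (by positivity)
    have h3 : τ r0 - σ r0 ≤ τ b - σ b := hmon ⟨le_rfl, hb.1.1⟩ ⟨hb.1.1, le_rfl⟩ hb.1.1
    have h4 : τ b - σ b ≤ 0 := hb.2
    linarith
  have h3 := hDr R ⟨hr0.2, le_rfl⟩ (fun l hl => hpos l ⟨hl.1, hl.2.le⟩)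
  rw [← hD R ⟨hR, le_rfl⟩] at h3
  have h4 : 0 ≤ τ' R - σ' R := nonneg_of_mul_nonneg_right h3 (by positivity)
  have h5 := mul_pos hβ (hpos R ⟨hr0.2, le_rfl⟩)
  have h6 := h1.robin
  have h7 := h2.robin
  linarith

/-- Under (A1), for every $σ̄ > 0$ and $R > 0$ the stationary radial nutrient
problem admits exactly one solution on $[0,R]$. -/
theorem stmt_5 (β σD : ℝ) (hβ : 0 < β) (hσD : 0 < σD)
    (f : ℝ → ℝ) (hf : C1StrictInc f) (hf0 : f 0 = 0) :
    ∀ σbar > (0:ℝ), ∀ R > (0:ℝ),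
      ∃ (σ σ' : ℝ → ℝ), IsStationarySol f β σD σbar R σ σ' ∧
        ∀ (τ τ' : ℝ → ℝ), IsStationarySol f β σD σbar R τ τ' →
          ∀ r ∈ Icc (0:ℝ) R, τ r = σ r := by
  intro σbar hsb R hR
  have hex : ∃ (σ σ' : ℝ → ℝ), IsStationarySol f β σD σbar R σ σ' := by
    rcases lt_or_ge σD σbar with h | h
    · exact exist_main β σD hβ hσD f hf hf0 σbar h R hR
    · refine ⟨fun _ => σbar, fun _ => 0, continuousOn_const, ?_, ?_, ?_⟩
      · intro r _
        exact hasDerivWithinAt_const _ _ _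
      · intro r _
        have : ¬ (0 < σbar - σD) := by linarith
        simp only [Hside, this, if_false, mul_zero, intervalIntegral.integral_zero]
      · simp
  obtain ⟨σ, σ', hs⟩ := hex
  refine ⟨σ, σ', hs, fun τ τ' ht r hr => le_antisymm ?_ ?_⟩
  · exact compare β σD hβ hσD f hf hf0 σbar R hR σ σ' τ τ' hs ht r hr
  · exact compare β σD hβ hσD f hf hf0 σbar R hR τ τ' σ σ' ht hs r hr
end

section
/- Assume (A1) and let 0 < σ̄ ≤ σ_D and R > 0. Then the constant function σ(r) ≡ σ̄ on [0,R] is a solution of the stationary radial nutrient problem with parameters σ̄ and R, and every solution of this problem is identically equal to σ̄. -/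
open MeasureTheory Set Filter Topology

/-- Under (A1), if $0 < σ̄ ≤ σ_D$ then the constant $σ̄$ is a solution of the
stationary problem, and every solution is identically $σ̄$ on $[0,R]$. -/
theorem stmt_6 (β σD : ℝ) (hβ : 0 < β) (hσD : 0 < σD)
    (f : ℝ → ℝ) (hf : C1StrictInc f) (hf0 : f 0 = 0)
    (σbar R : ℝ) (hσbar : 0 < σbar) (hσbar' : σbar ≤ σD) (hR : 0 < R) :
    IsStationarySol f β σD σbar R (fun _ => σbar) (fun _ => 0) ∧
    ∀ (σ σ' : ℝ → ℝ), IsStationarySol f β σD σbar R σ σ' →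
      ∀ r ∈ Icc (0:ℝ) R, σ r = σbar := by
  refine ⟨⟨continuousOn_const, fun r _ => hasDerivWithinAt_const _ _ _, ?_, by simp⟩, ?_⟩
  · intro r _
    have h : ¬ (0 < σbar - σD) := by linarith
    simp [Hside, h]
  · intro σ σ' h
    have hnn : ∀ r ∈ Ioc (0:ℝ) R, 0 ≤ σ' r := by
      intro r hr
      have h1 : 0 ≤ r ^ 2 * σ' r := by
        rw [h.ode r hr]
        apply intervalIntegral.integral_nonneg hr.1.le
        intro l _
        unfold Hside
        split_ifs with hl
        · have h2 : f 0 < f (σ l) :=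
            hf.2 (mem_Ici.2 le_rfl) (mem_Ici.2 (by linarith)) (by linarith)
          rw [hf0] at h2
          positivity
        · simp
      have h3 : 0 < r ^ 2 := pow_pos hr.1 2
      exact nonneg_of_mul_nonneg_right h1 h3
    have hint : ∀ r ∈ interior (Icc (0:ℝ) R),
        HasDerivWithinAt σ (σ' r) (interior (Icc (0:ℝ) R)) r := by
      intro r hr
      have hr' := hr
      rw [interior_Icc] at hr'
      exact (h.deriv r ⟨hr'.1, hr'.2.le⟩).mono interior_subset
    have hmono : MonotoneOn σ (Icc 0 R) := by
      apply monotoneOn_of_hasDerivWithinAt_nonneg (convex_Icc 0 R) h.cont hint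
      intro r hr
      rw [interior_Icc] at hr
      exact hnn r ⟨hr.1, hr.2.le⟩
    have hRm : R ∈ Icc (0:ℝ) R := ⟨hR.le, le_rfl⟩
    have hRR : σ R ≤ σbar := by
      have h1 := hnn R ⟨hR, le_rfl⟩
      have h2 := h.robin
      by_contra hc
      have h3 : 0 < β * (σ R - σbar) := mul_pos hβ (by linarith)
      linarith
    have hz : ∀ r ∈ Ioc (0:ℝ) R, σ' r = 0 := by
      intro r hr
      have h1 : r ^ 2 * σ' r = 0 := by
        rw [h.ode r hr]
        apply intervalIntegral.integral_zero_ae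
        refine Eventually.of_forall fun l hl => ?_
        rw [uIoc_of_le hr.1.le] at hl
        have h2 := hmono ⟨hl.1.le, hl.2.trans hr.2⟩ hRm (hl.2.trans hr.2)
        have h3 : ¬ (0 < σ l - σD) := by linarith
        simp [Hside, h3]
      exact (mul_eq_zero.1 h1).resolve_left (pow_pos hr.1 2).ne'
    have hanti : AntitoneOn σ (Icc 0 R) := by
      apply antitoneOn_of_hasDerivWithinAt_nonpos (convex_Icc 0 R) h.cont hint
      intro r hr
      rw [interior_Icc] at hr
      exact (hz r ⟨hr.1, hr.2.le⟩).le
    have hRe : σ R = σbar := by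
      have h2 := h.robin
      rw [hz R ⟨hR, le_rfl⟩, zero_add] at h2
      have := (mul_eq_zero.1 h2).resolve_left hβ.ne'
      linarith
    intro r hr
    rw [← hRe]
    exact le_antisymm (hmono hr hRm hr.2) (hanti hr hRm hr.2)
end

section
/- Assume (A1) and let σ̄ > 0, R > 0. Then every solution σ of the stationary radial nutrient problem with parameters σ̄ and R is nondecreasing on [0,R] (indeed σ'(r) ≥ 0 for all 0 < r ≤ R) and satisfies σ(r) ≤ σ̄ for all r ∈ [0,R]. -/
open MeasureTheory Set Filter Topology

/-- Under (A1), every solution of the stationary problem is nondecreasing on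
$[0,R]$ (with $σ'(r) ≥ 0$ on $(0,R]$) and bounded above by $σ̄$. -/
theorem stmt_7 (β σD : ℝ) (hβ : 0 < β) (hσD : 0 < σD)
    (f : ℝ → ℝ) (hf : C1StrictInc f) (hf0 : f 0 = 0)
    (σbar R : ℝ) (hσbar : 0 < σbar) (hR : 0 < R)
    (σ σ' : ℝ → ℝ) (hsol : IsStationarySol f β σD σbar R σ σ') :
    MonotoneOn σ (Icc 0 R) ∧ (∀ r ∈ Ioc (0:ℝ) R, 0 ≤ σ' r) ∧
    ∀ r ∈ Icc (0:ℝ) R, σ r ≤ σbar := by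
  have hpos : ∀ r ∈ Ioc (0:ℝ) R, 0 ≤ σ' r := by
    intro r hr
    have h1 : 0 ≤ ∫ l in (0:ℝ)..r, l ^ 2 * f (σ l) * Hside (σ l - σD) := by
      apply intervalIntegral.integral_nonneg hr.1.le
      intro l _
      unfold Hside
      split_ifs with h
      · have h0 : 0 < σ l := by linarith
        have h2 : f 0 < f (σ l) := hf.2 (mem_Ici.2 le_rfl) (mem_Ici.2 h0.le) h0
        rw [hf0] at h2
        positivity
      · simp
    rw [← hsol.ode r hr] at h1
    exact nonneg_of_mul_nonneg_right h1 (pow_pos hr.1 2)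
  have hmono : MonotoneOn σ (Icc 0 R) := by
    apply monotoneOn_of_hasDerivWithinAt_nonneg (f' := σ') (convex_Icc 0 R) hsol.cont
    · intro x hx
      rw [interior_Icc] at hx ⊢
      exact (hsol.deriv x ⟨hx.1, hx.2.le⟩).mono Ioo_subset_Icc_self
    · intro x hx
      rw [interior_Icc] at hx
      exact hpos x ⟨hx.1, hx.2.le⟩
  refine ⟨hmono, hpos, fun r hr => ?_⟩
  have h1 := hmono hr (right_mem_Icc.2 hR.le) hr.2
  have h2 := hpos R ⟨hR, le_rfl⟩
  have h3 := hsol.robin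
  by_contra! h
  have : 0 < β * (σ R - σbar) := mul_pos hβ (by linarith)
  linarith
end

section
/- Assume (A1) and let σ̄ > 0, R > 0. Then every solution σ of the stationary radial nutrient problem with parameters σ̄ and R satisfies σ̄ − f(σ̄)(R²/6 + R/(3β)) ≤ σ(r) ≤ σ̄ for all r ∈ [0,R]. In particular, solutions converge uniformly to the constant σ̄ as R → 0⁺. -/
open MeasureTheory Set Filter Topology

theorem stmt_8_aux (β σD : ℝ) (hβ : 0 < β) (hσD : 0 < σD)
    (f : ℝ → ℝ) (hf : C1StrictInc f) (hf0 : f 0 = 0)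
    (σbar : ℝ) (hσbar : 0 < σbar) (R : ℝ) (hR : 0 < R) (σ σ' : ℝ → ℝ)
    (h : IsStationarySol f β σD σbar R σ σ') (r : ℝ) (hr : r ∈ Icc (0:ℝ) R) :
    σbar - f σbar * (R ^ 2 / 6 + R / (3 * β)) ≤ σ r ∧ σ r ≤ σbar := by
  have hm := hf.2
  have hRm : R ∈ Icc (0:ℝ) R := ⟨hR.le, le_rfl⟩
  have hg : ∀ l, 0 ≤ l ^ 2 * f (σ l) * Hside (σ l - σD) := by
    intro l
    unfold Hside
    split_ifs with hl
    · have h1 : f 0 < f (σ l) := hm (by simp) (by simp; linarith) (by linarith)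
      rw [hf0] at h1
      positivity
    · simp
  have hd0 : ∀ x ∈ Ioc (0:ℝ) R, 0 ≤ σ' x := by
    intro x hx
    have h1 : 0 ≤ x ^ 2 * σ' x := by
      rw [h.ode x hx]
      exact intervalIntegral.integral_nonneg hx.1.le (fun l _ => hg l)
    have h2 : 0 < x ^ 2 := by have := hx.1; positivity
    exact nonneg_of_mul_nonneg_right h1 h2
  have hda : ∀ x ∈ Ioo (0:ℝ) R, HasDerivAt σ (σ' x) x := fun x hx =>
    (h.deriv x ⟨hx.1, hx.2.le⟩).hasDerivAt (Icc_mem_nhds hx.1 hx.2)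
  have hmono : MonotoneOn σ (Icc 0 R) := by
    apply monotoneOn_of_deriv_nonneg (convex_Icc 0 R) h.cont
    · rw [interior_Icc]
      exact fun x hx => (hda x hx).differentiableAt.differentiableWithinAt
    · rw [interior_Icc]
      intro x hx
      rw [(hda x hx).deriv]
      exact hd0 x ⟨hx.1, hx.2.le⟩
  have hσR : σ R ≤ σbar := by
    have h1 := h.robin
    have h2 := hd0 R ⟨hR, le_rfl⟩
    by_contra! hc
    have := mul_pos hβ (sub_pos.2 hc)
    linarith
  have hub : ∀ x ∈ Icc (0:ℝ) R, σ x ≤ σbar := fun x hx =>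
    (hmono hx hRm hx.2).trans hσR
  have hF : 0 < f σbar := by
    have h1 : f 0 < f σbar := hm (by simp) hσbar.le hσbar
    rwa [hf0] at h1
  have hgu : ∀ l ∈ Icc (0:ℝ) R, l ^ 2 * f (σ l) * Hside (σ l - σD) ≤ l ^ 2 * f σbar := by
    intro l hlm
    unfold Hside
    split_ifs with hl
    · have h1 : f (σ l) ≤ f σbar :=
        hm.monotoneOn (by simp; linarith) hσbar.le (hub l hlm)
      rw [mul_one]
      gcongr
    · rw [mul_zero]
      positivity
  have hd1 : ∀ x ∈ Ioc (0:ℝ) R, σ' x ≤ f σbar * x / 3 := by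
    intro x hx
    have hx0 := hx.1
    have h1 : x ^ 2 * σ' x ≤ x ^ 3 / 3 * f σbar := by
      rw [h.ode x hx]
      have h2 : ‖∫ l in (0:ℝ)..x, l ^ 2 * f (σ l) * Hside (σ l - σD)‖
          ≤ ∫ l in (0:ℝ)..x, l ^ 2 * f σbar := by
        apply intervalIntegral.norm_integral_le_of_norm_le hx0.le
        · refine Filter.Eventually.of_forall fun l hl => ?_
          rw [Real.norm_of_nonneg (hg l)]
          exact hgu l ⟨hl.1.le, hl.2.trans hx.2⟩
        · exact Continuous.intervalIntegrable (by fun_prop) _ _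
      have h3 : ∫ l in (0:ℝ)..x, l ^ 2 * f σbar = x ^ 3 / 3 * f σbar := by
        rw [intervalIntegral.integral_mul_const, integral_pow]
        norm_num
      rw [h3] at h2
      exact (le_abs_self _).trans h2
    have h2 : 0 < x ^ 2 := by positivity
    refine le_of_mul_le_mul_left (h1.trans (le_of_eq ?_)) h2
    ring
  have hmono2 : MonotoneOn (fun x => f σbar * x ^ 2 / 6 - σ x) (Icc 0 R) := by
    have hda2 : ∀ x ∈ Ioo (0:ℝ) R,
        HasDerivAt (fun x => f σbar * x ^ 2 / 6 - σ x) (f σbar * x / 3 - σ' x) x := by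
      intro x hx
      have := ((((hasDerivAt_id x).pow 2).const_mul (f σbar)).div_const 6).sub (hda x hx)
      refine this.congr_deriv ?_
      simp
      ring
    apply monotoneOn_of_deriv_nonneg (convex_Icc 0 R)
    · exact ContinuousOn.sub (by fun_prop) h.cont
    · rw [interior_Icc]
      exact fun x hx => (hda2 x hx).differentiableAt.differentiableWithinAt
    · rw [interior_Icc]
      intro x hx
      rw [(hda2 x hx).deriv]
      linarith [hd1 x ⟨hx.1, hx.2.le⟩]
  refine ⟨?_, hub r hr⟩
  have h1 := hmono2 hr hRm hr.2
  simp only at h1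
  have h2 := hd1 R ⟨hR, le_rfl⟩
  have h3 : σbar - σ R ≤ f σbar * (R / (3 * β)) := by
    have h4 : β * (σbar - σ R) ≤ β * (f σbar * (R / (3 * β))) := by
      have : β * (f σbar * (R / (3 * β))) = f σbar * R / 3 := by field_simp
      rw [this]
      linarith [h.robin]
    exact le_of_mul_le_mul_left h4 hβ
  have h5 : 0 ≤ f σbar * r ^ 2 := by positivity
  linarith

/-- Under (A1), every solution of the stationary problem satisfies
$σ̄ − f(σ̄)(R²/6 + R/(3β)) ≤ σ(r) ≤ σ̄$ on $[0,R]$; in particular solutions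
converge uniformly to $σ̄$ as $R → 0^+$. -/
theorem stmt_8 (β σD : ℝ) (hβ : 0 < β) (hσD : 0 < σD)
    (f : ℝ → ℝ) (hf : C1StrictInc f) (hf0 : f 0 = 0)
    (σbar : ℝ) (hσbar : 0 < σbar) :
    (∀ R > (0:ℝ), ∀ (σ σ' : ℝ → ℝ), IsStationarySol f β σD σbar R σ σ' →
      ∀ r ∈ Icc (0:ℝ) R,
        σbar - f σbar * (R ^ 2 / 6 + R / (3 * β)) ≤ σ r ∧ σ r ≤ σbar) ∧
    (∀ ε > (0:ℝ), ∃ δ > (0:ℝ), ∀ R, 0 < R → R < δ →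
      ∀ (σ σ' : ℝ → ℝ), IsStationarySol f β σD σbar R σ σ' →
        ∀ r ∈ Icc (0:ℝ) R, |σ r - σbar| < ε) := by
  refine ⟨fun R hR σ σ' h r hr =>
    stmt_8_aux β σD hβ hσD f hf hf0 σbar hσbar R hR σ σ' h r hr, ?_⟩
  intro ε hε
  have hc : Tendsto (fun R : ℝ => f σbar * (R ^ 2 / 6 + R / (3 * β))) (𝓝 0) (𝓝 0) := by
    have : Continuous (fun R : ℝ => f σbar * (R ^ 2 / 6 + R / (3 * β))) := by fun_prop
    simpa using this.tendsto 0
  obtain ⟨δ, hδ, hδ'⟩ := Metric.eventually_nhds_iff.1 (hc.eventually (gt_mem_nhds hε))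
  refine ⟨δ, hδ, fun R hR hRδ σ σ' h r hr => ?_⟩
  have h1 := stmt_8_aux β σD hβ hσD f hf hf0 σbar hσbar R hR σ σ' h r hr
  have h2 := hδ' (y := R) (by rw [Real.dist_eq, sub_zero, abs_of_pos hR]; exact hRδ)
  rw [abs_lt]
  constructor <;> linarith [h1.1, h1.2]
end

section
/- Assume (A1) and let σ̄ > σ_D, 0 < ρ < R. Suppose (V, ρ) is a necrotic-core profile, i.e. V : [ρ,R] → ℝ is continuous, differentiable on (ρ,R], V(ρ) = σ_D, r² V'(r) = ∫_ρ^r l² f(V(l)) dl for all ρ < r ≤ R (encoding V''+ (2/r)V' = f(V) with V'(ρ) = 0), and V'(R) + β(V(R) − σ̄) = 0. Then β(σ̄ − σ_D) ≥ (1/R²)∫_ρ^R l² f(V(l)) dl ≥ f(σ_D)(R³ − ρ³)/(3R²) > 0. -/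
open MeasureTheory Set Filter Topology

/-- For a necrotic-core profile $(V, ρ)$ with $σ̄ > σ_D$ and $0 < ρ < R$:
$β(σ̄ − σ_D) ≥ (1/R²)∫_ρ^R l² f(V(l)) dl ≥ f(σ_D)(R³ − ρ³)/(3R²) > 0$. -/
theorem stmt_9 (β σD : ℝ) (hβ : 0 < β) (hσD : 0 < σD)
    (f : ℝ → ℝ) (hf : C1StrictInc f) (hf0 : f 0 = 0)
    (σbar ρ R : ℝ) (hσbar : σD < σbar) (hρ : 0 < ρ) (hρR : ρ < R)
    (V V' : ℝ → ℝ)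
    (hVc : ContinuousOn V (Icc ρ R))
    (hVd : ∀ r ∈ Ioc ρ R, HasDerivWithinAt V (V' r) (Icc ρ R) r)
    (hVode : ∀ r ∈ Ioc ρ R, r ^ 2 * V' r = ∫ l in ρ..r, l ^ 2 * f (V l))
    (hVρ : V ρ = σD)
    (hrobin : V' R + β * (V R - σbar) = 0) :
    (1 / R ^ 2) * (∫ l in ρ..R, l ^ 2 * f (V l)) ≤ β * (σbar - σD) ∧
    f σD * (R ^ 3 - ρ ^ 3) / (3 * R ^ 2) ≤
      (1 / R ^ 2) * ∫ l in ρ..R, l ^ 2 * f (V l) ∧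
    0 < f σD * (R ^ 3 - ρ ^ 3) / (3 * R ^ 2) := by
  obtain ⟨hfc, hfm⟩ := hf
  have hpos : ∀ x, 0 ≤ x → 0 ≤ f x := fun x hx => by
    rw [← hf0]; exact hfm.monotoneOn (by simp) hx hx
  have key : ∀ t ∈ Icc ρ R, (∀ r ∈ Ico ρ t, 0 < V r) → MonotoneOn V (Icc ρ t) := by
    intro t ht hV
    have hd : ∀ r ∈ Ioo ρ t, HasDerivAt V (V' r) r := fun r hr =>
      (hVd r ⟨hr.1, hr.2.le.trans ht.2⟩).hasDerivAt
        (Icc_mem_nhds hr.1 (hr.2.trans_le ht.2))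
    apply monotoneOn_of_deriv_nonneg (convex_Icc ρ t)
      (hVc.mono (Icc_subset_Icc_right ht.2))
    · rw [interior_Icc]
      exact fun r hr => (hd r hr).differentiableAt.differentiableWithinAt
    · rw [interior_Icc]
      intro r hr
      rw [(hd r hr).deriv]
      have h1 := hVode r ⟨hr.1, hr.2.le.trans ht.2⟩
      have h2 : 0 ≤ ∫ l in ρ..r, l ^ 2 * f (V l) := by
        apply intervalIntegral.integral_nonneg hr.1.le
        intro u hu
        exact mul_nonneg (sq_nonneg u) (hpos _ (hV u ⟨hu.1, hu.2.trans_lt hr.2⟩).le)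
      rw [← h1] at h2
      have hr0 : 0 < r := hρ.trans hr.1
      exact nonneg_of_mul_nonneg_right h2 (by positivity)
  have hVpos : ∀ r ∈ Icc ρ R, 0 < V r := by
    by_contra! hcon
    obtain ⟨r, hr, hr0⟩ := hcon
    have hcl : IsClosed (Icc ρ R ∩ V ⁻¹' Iic 0) :=
      hVc.preimage_isClosed_of_isClosed isClosed_Icc isClosed_Iic
    have hcp : IsCompact (Icc ρ R ∩ V ⁻¹' Iic 0) :=
      isCompact_Icc.of_isClosed_subset hcl inter_subset_left
    obtain ⟨t, ⟨ht, ht0⟩, htl⟩ := hcp.exists_isLeast ⟨r, hr, hr0⟩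
    have hm := key t ht (fun u hu => by
      by_contra! h
      exact absurd (htl ⟨⟨hu.1, hu.2.le.trans ht.2⟩, h⟩) (not_le.2 hu.2))
    have := hm (left_mem_Icc.2 ht.1) (right_mem_Icc.2 ht.1) ht.1
    have h0 : V t ≤ 0 := ht0
    linarith
  have hm := key R (right_mem_Icc.2 hρR.le) (fun r hr => hVpos r ⟨hr.1, hr.2.le⟩)
  have hge : ∀ r ∈ Icc ρ R, σD ≤ V r := fun r hr => by
    rw [← hVρ]; exact hm (left_mem_Icc.2 hρR.le) hr hr.1
  have hR : 0 < R := hρ.trans hρR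
  have hfD : 0 < f σD := by
    rw [← hf0]; exact hfm (by simp) hσD.le hσD
  have hcube : 0 < R ^ 3 - ρ ^ 3 := by
    have : ρ ^ 3 < R ^ 3 := by gcongr
    linarith
  refine ⟨?_, ?_, by positivity⟩
  · rw [← hVode R ⟨hρR, le_rfl⟩]
    have h1 : 1 / R ^ 2 * (R ^ 2 * V' R) = V' R := by field_simp
    rw [h1]
    have := mul_le_mul_of_nonneg_left (hge R (right_mem_Icc.2 hρR.le)) hβ.le
    linarith
  · have hcont : ContinuousOn (fun l => l ^ 2 * f (V l)) (Icc ρ R) :=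
      (continuous_pow 2).continuousOn.mul
        (hfc.continuousOn.comp hVc (fun r hr => (hVpos r hr).le))
    have hle : ∫ l in ρ..R, l ^ 2 * f σD ≤ ∫ l in ρ..R, l ^ 2 * f (V l) := by
      apply intervalIntegral.integral_mono_on hρR.le
      · exact Continuous.intervalIntegrable (by fun_prop) _ _
      · exact ContinuousOn.intervalIntegrable_of_Icc hρR.le hcont
      · intro u hu
        exact mul_le_mul_of_nonneg_left
          (hfm.monotoneOn hσD.le (hVpos u hu).le (hge u hu)) (sq_nonneg u)
    have hc : ∫ l in ρ..R, l ^ 2 * f σD = (R ^ 3 - ρ ^ 3) / 3 * f σD := by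
      rw [intervalIntegral.integral_mul_const, integral_pow]; norm_num
    rw [hc] at hle
    calc f σD * (R ^ 3 - ρ ^ 3) / (3 * R ^ 2)
        = 1 / R ^ 2 * ((R ^ 3 - ρ ^ 3) / 3 * f σD) := by field_simp
      _ ≤ _ := mul_le_mul_of_nonneg_left hle (by positivity)
end

section
/- Assume (A1)–(A3) and let σ̄ > 0, R > 0. Then every solution σ of the stationary radial nutrient problem with parameters σ̄ and R satisfies −ν/3 ≤ (1/R³)[∫_{{r ∈ [0,R] : σ(r) > σ_D}} g(σ(r)) r² dr − ν ∫_{{r ∈ [0,R] : σ(r) ≤ σ_D}} r² dr] ≤ S(σ̄)/3, where S(σ̄) = g(σ̄) if σ̄ > σ_D and S(σ̄) = −ν if σ̄ ≤ σ_D. -/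
open MeasureTheory Set Filter Topology

/-- The growth average
`G = (1/R³)[∫_{r ∈ [0,R] : σ r > σD} g(σ r) r² dr − ν ∫_{r ∈ [0,R] : σ r ≤ σD} r² dr]`
associated with a radial nutrient profile `σ` on `[0,R]`. -/
noncomputable def Gavg (g : ℝ → ℝ) (σD ν R : ℝ) (σ : ℝ → ℝ) : ℝ :=
  (1 / R ^ 3) *
    ((∫ r in {r : ℝ | r ∈ Icc (0:ℝ) R ∧ σD < σ r}, g (σ r) * r ^ 2) -
      ν * ∫ r in {r : ℝ | r ∈ Icc (0:ℝ) R ∧ σ r ≤ σD}, r ^ 2)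

/-- Under (A1)–(A3), every solution of the stationary problem satisfies
$-ν/3 ≤ G(σ̄,R) ≤ S(σ̄)/3$. -/
theorem stmt_10 (β σD ν : ℝ) (hβ : 0 < β) (hσD : 0 < σD) (hν : 0 < ν)
    (f g : ℝ → ℝ) (hf : C1StrictInc f) (hf0 : f 0 = 0)
    (hg : C1StrictInc g) (hgz : ∃ σt > σD, g σt = 0) (hgν : 0 ≤ g σD + ν)
    (σbar R : ℝ) (hσbar : 0 < σbar) (hR : 0 < R)
    (σ σ' : ℝ → ℝ) (hsol : IsStationarySol f β σD σbar R σ σ') :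
    -ν / 3 ≤ Gavg g σD ν R σ ∧ Gavg g σD ν R σ ≤ Sfun g σD ν σbar / 3 := by
  have hσ'nn : ∀ r ∈ Ioc (0:ℝ) R, 0 ≤ σ' r := by
    intro r hr
    have h1 := hsol.ode r hr
    have h2 : 0 ≤ ∫ l in (0:ℝ)..r, l ^ 2 * f (σ l) * Hside (σ l - σD) := by
      apply intervalIntegral.integral_nonneg hr.1.le
      intro l hl
      unfold Hside
      split_ifs with h
      · have h3 : f 0 < f (σ l) := hf.2 (by simp) (by simp only [mem_Ici]; linarith) (by linarith)
        rw [hf0] at h3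
        positivity
      · simp
    rw [← h1] at h2
    have : 0 < r ^ 2 := pow_pos hr.1 2
    exact nonneg_of_mul_nonneg_right h2 this
  have hmono : MonotoneOn σ (Icc 0 R) := by
    apply monotoneOn_of_hasDerivWithinAt_nonneg (f' := σ') (convex_Icc 0 R) hsol.cont
    · intro x hx
      rw [interior_Icc] at hx
      exact (hsol.deriv x ⟨hx.1, hx.2.le⟩).mono interior_subset
    · intro x hx
      rw [interior_Icc] at hx
      exact hσ'nn x ⟨hx.1, hx.2.le⟩
  have hRb : σ R ≤ σbar := by
    have h1 := hσ'nn R ⟨hR, le_rfl⟩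
    have h2 := hsol.robin
    by_contra hc
    push Not at hc
    have : 0 < β * (σ R - σbar) := mul_pos hβ (by linarith)
    linarith
  have hgD : ∀ s, σD < s → -ν ≤ g s := by
    intro s hs
    have : g σD < g s := hg.2 (by simp only [mem_Ici]; linarith) (by simp only [mem_Ici]; linarith) hs
    linarith
  have hSlow : ∀ s, -ν ≤ Sfun g σD ν s := by
    intro s
    unfold Sfun
    split_ifs with h
    · exact hgD s h
    · exact le_rfl
  have hSmono : Monotone (Sfun g σD ν) := by
    intro s t hst
    by_cases hs : σD < s
    · have ht : σD < t := lt_of_lt_of_le hs hst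
      simp only [Sfun, hs, ht, if_true]
      exact hg.2.monotoneOn (by simp only [mem_Ici]; linarith) (by simp only [mem_Ici]; linarith) hst
    · have : Sfun g σD ν s = -ν := by simp [Sfun, hs]
      rw [this]; exact hSlow t
  have hle : ∀ r ∈ Icc (0:ℝ) R, Sfun g σD ν (σ r) ≤ Sfun g σD ν σbar := fun r hr =>
    hSmono ((hmono hr ⟨hR.le, le_rfl⟩ hr.2).trans hRb)
  have hint0 : IntegrableOn (fun r => Sfun g σD ν (σ r)) (Icc 0 R) :=
    MonotoneOn.integrableOn_isCompact isCompact_Icc (fun a ha b hb hab => hSmono (hmono ha hb hab))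
  have hint : IntegrableOn (fun r => Sfun g σD ν (σ r) * r ^ 2) (Icc 0 R) :=
    hint0.mul_continuousOn (by fun_prop) isCompact_Icc
  have hBm : MeasurableSet {r : ℝ | r ∈ Icc (0:ℝ) R ∧ σ r ≤ σD} :=
    (hsol.cont.preimage_isClosed_of_isClosed isClosed_Icc (isClosed_Iic (a := σD))).measurableSet
  have hAeq : {r : ℝ | r ∈ Icc (0:ℝ) R ∧ σD < σ r} =
      Icc (0:ℝ) R \ {r : ℝ | r ∈ Icc (0:ℝ) R ∧ σ r ≤ σD} := by
    ext r
    simp only [mem_setOf_eq, mem_diff, not_and, not_le]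
    exact ⟨fun h => ⟨h.1, fun _ => h.2⟩, fun h => ⟨h.1, h.2 h.1⟩⟩
  have hAm : MeasurableSet {r : ℝ | r ∈ Icc (0:ℝ) R ∧ σD < σ r} := by
    rw [hAeq]; exact measurableSet_Icc.diff hBm
  have hG : Gavg g σD ν R σ = (1 / R ^ 3) * ∫ r in Icc (0:ℝ) R, Sfun g σD ν (σ r) * r ^ 2 := by
    unfold Gavg
    congr 1
    have e1 : ∫ r in {r : ℝ | r ∈ Icc (0:ℝ) R ∧ σD < σ r}, g (σ r) * r ^ 2 =
        ∫ r in {r : ℝ | r ∈ Icc (0:ℝ) R ∧ σD < σ r}, Sfun g σD ν (σ r) * r ^ 2 := by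
      apply setIntegral_congr_fun hAm
      intro r hr
      simp [Sfun, hr.2]
    have e2 : ∫ r in {r : ℝ | r ∈ Icc (0:ℝ) R ∧ σ r ≤ σD}, Sfun g σD ν (σ r) * r ^ 2 =
        -ν * ∫ r in {r : ℝ | r ∈ Icc (0:ℝ) R ∧ σ r ≤ σD}, r ^ 2 := by
      rw [← integral_const_mul]
      apply setIntegral_congr_fun hBm
      intro r hr
      simp [Sfun, not_lt.mpr hr.2]
    have e3 := integral_diff (μ := volume) hBm hint (fun r hr => hr.1)
    rw [← hAeq] at e3
    rw [e1, e3, e2]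
    ring
  have hc : ∀ c : ℝ, ∫ r in Icc (0:ℝ) R, c * r ^ 2 = c * (R ^ 3 / 3) := by
    intro c
    rw [integral_Icc_eq_integral_Ioc, ← intervalIntegral.integral_of_le hR.le]
    rw [intervalIntegral.integral_const_mul, integral_pow]
    norm_num
  have hci : ∀ c : ℝ, IntegrableOn (fun r : ℝ => c * r ^ 2) (Icc 0 R) := fun c =>
    ContinuousOn.integrableOn_Icc (by fun_prop)
  have hR3 : 0 < R ^ 3 := pow_pos hR 3
  have key : ∀ c : ℝ, (1 / R ^ 3) * (c * (R ^ 3 / 3)) = c / 3 := by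
    intro c; field_simp
  rw [hG]
  constructor
  · rw [← key, ← hc]
    apply mul_le_mul_of_nonneg_left _ (by positivity)
    apply setIntegral_mono_on (hci _) hint measurableSet_Icc
    intro r hr
    exact mul_le_mul_of_nonneg_right (hSlow _) (sq_nonneg r)
  · rw [← key, ← hc]
    apply mul_le_mul_of_nonneg_left _ (by positivity)
    apply setIntegral_mono_on hint (hci _) measurableSet_Icc
    intro r hr
    exact mul_le_mul_of_nonneg_right (hle r hr) (sq_nonneg r)
end

section
/- Assume (A1)–(A3). Fix R > 0 and let σ_D < σ̄₁ < σ̄₂. If σ₁ and σ₂ are the solutions of the stationary radial nutrient problem with radius R and boundary parameters σ̄₁ and σ̄₂ respectively, then (1/R³)[∫_{{σ₁ > σ_D}} g(σ₁(r)) r² dr − ν ∫_{{σ₁ ≤ σ_D}} r² dr] < (1/R³)[∫_{{σ₂ > σ_D}} g(σ₂(r)) r² dr − ν ∫_{{σ₂ ≤ σ_D}} r² dr]; that is, the growth average G(σ̄, R) is strictly increasing in σ̄ for σ̄ > σ_D. -/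
open MeasureTheory Set Filter Topology

lemma aux_mono (w w' P : ℝ → ℝ) (R : ℝ) (hc : ContinuousOn w (Icc 0 R))
    (hd : ∀ r ∈ Ioc (0:ℝ) R, HasDerivWithinAt w (w' r) (Icc 0 R) r)
    (hP : ∀ r ∈ Ioc (0:ℝ) R, r ^ 2 * w' r = P r)
    (a b : ℝ) (ha : 0 ≤ a) (hb : b ≤ R) (h : ∀ r ∈ Ioo a b, 0 ≤ P r) :
    MonotoneOn w (Icc a b) := by
  have hder : ∀ r ∈ Ioo a b, HasDerivAt w (w' r) r := fun r hr =>
    (hd r ⟨by linarith [hr.1], by linarith [hr.2]⟩).hasDerivAt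
      (Icc_mem_nhds (by linarith [hr.1]) (by linarith [hr.2]))
  apply monotoneOn_of_deriv_nonneg (convex_Icc a b)
  · exact hc.mono (Icc_subset_Icc ha hb)
  · rw [interior_Icc]
    exact fun r hr => (hder r hr).differentiableAt.differentiableWithinAt
  · rw [interior_Icc]
    intro r hr
    rw [(hder r hr).deriv]
    have h0 : 0 < r := by linarith [hr.1]
    have h1 := hP r ⟨h0, by linarith [hr.2]⟩
    have h2 := h r hr
    rw [← h1] at h2
    exact nonneg_of_mul_nonneg_right h2 (by positivity)

lemma aux_anti (w w' P : ℝ → ℝ) (R : ℝ) (hc : ContinuousOn w (Icc 0 R))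
    (hd : ∀ r ∈ Ioc (0:ℝ) R, HasDerivWithinAt w (w' r) (Icc 0 R) r)
    (hP : ∀ r ∈ Ioc (0:ℝ) R, r ^ 2 * w' r = P r)
    (a b : ℝ) (ha : 0 ≤ a) (hb : b ≤ R) (h : ∀ r ∈ Ioo a b, P r ≤ 0) :
    AntitoneOn w (Icc a b) := by
  have := aux_mono (fun r => - w r) (fun r => - w' r) (fun r => - P r) R hc.neg
    (fun r hr => (hd r hr).neg) (fun r hr => by have := hP r hr; linarith) a b ha hb
    (fun r hr => by have := h r hr; linarith)
  intro x hx y hy hxy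
  have := this hx hy hxy
  simp only at this
  linarith

lemma aux_nonneg (w w' P : ℝ → ℝ) (R : ℝ) (hR : 0 < R) (hc : ContinuousOn w (Icc 0 R))
    (hd : ∀ r ∈ Ioc (0:ℝ) R, HasDerivWithinAt w (w' r) (Icc 0 R) r)
    (hP : ∀ r ∈ Ioc (0:ℝ) R, r ^ 2 * w' r = P r) (hP0 : P 0 = 0)
    (hPm : ∀ a b, 0 ≤ a → a ≤ b → b ≤ R → (∀ r ∈ Ioo a b, w r < 0) → P b ≤ P a)
    (hend : w R < 0 → 0 < w' R) : ∀ r ∈ Icc (0:ℝ) R, 0 ≤ w r := by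
  intro c hcR
  by_contra hw
  push Not at hw
  rcases le_or_gt (P c) 0 with hPc | hPc
  · have hneg : ∀ t ∈ Icc c R, w t < 0 := by
      by_contra! hne
      have hcomp : IsCompact (Icc c R ∩ w ⁻¹' (Ici 0)) :=
        isCompact_Icc.of_isClosed_subset
          ((hc.mono (Icc_subset_Icc hcR.1 le_rfl)).preimage_isClosed_of_isClosed isClosed_Icc
            isClosed_Ici) inter_subset_left
      obtain ⟨t, ht⟩ := hne
      obtain ⟨t0, ht0, hmin⟩ := hcomp.exists_isLeast ⟨t, ht.1, ht.2⟩
      have hlt : ∀ r ∈ Ioo c t0, w r < 0 := by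
        intro r hr
        by_contra! h
        have := hmin ⟨⟨hr.1.le, hr.2.le.trans ht0.1.2⟩, h⟩
        linarith [hr.2]
      have := aux_anti w w' P R hc hd hP c t0 hcR.1 ht0.1.2 (fun r hr =>
        (hPm c r hcR.1 hr.1.le (hr.2.le.trans ht0.1.2)
          (fun s hs => hlt s ⟨hs.1, hs.2.trans hr.2⟩)).trans hPc)
        (left_mem_Icc.2 ht0.1.1) (right_mem_Icc.2 ht0.1.1) ht0.1.1
      have h2 : 0 ≤ w t0 := ht0.2
      linarith
    have h1 := hend (hneg R ⟨hcR.2, le_rfl⟩)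
    have h2 := hPm c R hcR.1 hcR.2 le_rfl (fun r hr => hneg r ⟨hr.1.le, hr.2.le⟩)
    have h3 := hP R ⟨hR, le_rfl⟩
    have : 0 < R ^ 2 * w' R := by positivity
    linarith
  · have hneg : ∀ t ∈ Icc 0 c, w t < 0 := by
      by_contra! hne
      have hcomp : IsCompact (Icc 0 c ∩ w ⁻¹' (Ici 0)) :=
        isCompact_Icc.of_isClosed_subset
          ((hc.mono (Icc_subset_Icc le_rfl hcR.2)).preimage_isClosed_of_isClosed isClosed_Icc
            isClosed_Ici) inter_subset_left
      obtain ⟨t, ht⟩ := hne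
      obtain ⟨t0, ht0, hmax⟩ := hcomp.exists_isGreatest ⟨t, ht.1, ht.2⟩
      have hlt : ∀ r ∈ Ioo t0 c, w r < 0 := by
        intro r hr
        by_contra! h
        have := hmax ⟨⟨ht0.1.1.trans hr.1.le, hr.2.le⟩, h⟩
        linarith [hr.1]
      have := aux_mono w w' P R hc hd hP t0 c ht0.1.1 hcR.2 (fun r hr =>
        hPc.le.trans (hPm r c (ht0.1.1.trans hr.1.le) hr.2.le hcR.2
          (fun s hs => hlt s ⟨hr.1.trans hs.1, hs.2⟩)))
        (left_mem_Icc.2 ht0.1.2) (right_mem_Icc.2 ht0.1.2) ht0.1.2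
      have h2 : 0 ≤ w t0 := ht0.2
      linarith
    have h2 := hPm 0 c le_rfl hcR.1 hcR.2 (fun r hr => hneg r ⟨hr.1.le, hr.2.le⟩)
    linarith

lemma aux_int (M σ : ℝ → ℝ) (R : ℝ) (hM : Monotone M) (hc : ContinuousOn σ (Icc 0 R)) :
    IntegrableOn (fun r => r ^ 2 * M (σ r)) (Icc 0 R) := by
  have hm : AEStronglyMeasurable (fun r => M (σ r)) (volume.restrict (Icc 0 R)) :=
    (hM.measurable.comp_aemeasurable (hc.aemeasurable measurableSet_Icc)).aestronglyMeasurable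
  obtain ⟨A, hA⟩ := isCompact_Icc.bddAbove_image hc
  obtain ⟨B, hB⟩ := isCompact_Icc.bddBelow_image hc
  have hi : IntegrableOn (fun r => M (σ r)) (Icc 0 R) := by
    refine IntegrableOn.of_bound (by simp) hm (|M A| + |M B|) ?_
    rw [ae_restrict_iff' measurableSet_Icc]
    refine ae_of_all _ fun r hr => ?_
    have h1 := hM (hA (mem_image_of_mem σ hr))
    have h2 := hM (hB (mem_image_of_mem σ hr))
    rw [Real.norm_eq_abs, abs_le]
    constructor
    · linarith [neg_abs_le (M B), abs_nonneg (M A)]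
    · linarith [le_abs_self (M A), abs_nonneg (M B)]
  exact hi.continuousOn_mul (by fun_prop) isCompact_Icc

lemma aux_F (f : ℝ → ℝ) (σD : ℝ) (hσD : 0 < σD) (hf : StrictMonoOn f (Ici 0)) (hf0 : f 0 = 0) :
    Monotone (fun s => f s * Hside (s - σD)) ∧ ∀ s, 0 ≤ f s * Hside (s - σD) := by
  have hpos : ∀ s, σD < s → 0 ≤ f s := fun s hs => by
    rw [← hf0]
    exact hf.monotoneOn (by simp) (by simp; linarith) (by linarith)
  have hnn : ∀ s, 0 ≤ f s * Hside (s - σD) := by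
    intro s
    unfold Hside
    split_ifs with h
    · rw [mul_one]; exact hpos s (by linarith)
    · simp
  refine ⟨?_, hnn⟩
  intro s t hst
  by_cases h : σD < s
  · have h1 : Hside (s - σD) = 1 := if_pos (by linarith)
    have h2 : Hside (t - σD) = 1 := if_pos (by linarith)
    simp only [h1, h2, mul_one]
    exact hf.monotoneOn (by simp; linarith) (by simp; linarith) hst
  · have h1 : Hside (s - σD) = 0 := if_neg (by linarith)
    simp only [h1, mul_zero]
    exact hnn t

lemma aux_S (g : ℝ → ℝ) (σD ν : ℝ) (hσD : 0 < σD) (hg : StrictMonoOn g (Ici 0))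
    (hgν : 0 ≤ g σD + ν) : Monotone (Sfun g σD ν) := by
  intro s t hst
  unfold Sfun
  split_ifs with h1 h2 h2
  · exact hg.monotoneOn (by simp; linarith) (by simp; linarith) hst
  · linarith
  · have := hg.monotoneOn (a := σD) (b := t) (by simp; linarith) (by simp; linarith) h2.le
    linarith
  · rfl

lemma aux_G (g σ : ℝ → ℝ) (σD ν R : ℝ) (hS : Monotone (Sfun g σD ν))
    (hc : ContinuousOn σ (Icc 0 R)) :
    Gavg g σD ν R σ = (1 / R ^ 3) * ∫ r in Icc 0 R, r ^ 2 * Sfun g σD ν (σ r) := by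
  have hi := aux_int _ σ R hS hc
  have hcl : IsClosed {r : ℝ | r ∈ Icc (0:ℝ) R ∧ σ r ≤ σD} :=
    hc.preimage_isClosed_of_isClosed isClosed_Icc isClosed_Iic
  have hm2 := hcl.measurableSet
  have heq : {r : ℝ | r ∈ Icc (0:ℝ) R ∧ σD < σ r} =
      Icc 0 R \ {r : ℝ | r ∈ Icc (0:ℝ) R ∧ σ r ≤ σD} := by
    ext r; simp only [mem_setOf_eq, mem_diff]; constructor
    · rintro ⟨h1, h2⟩; exact ⟨h1, fun h => by linarith [h.2]⟩
    · rintro ⟨h1, h2⟩; exact ⟨h1, by by_contra! h; exact h2 ⟨h1, h⟩⟩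
  have hm1 : MeasurableSet {r : ℝ | r ∈ Icc (0:ℝ) R ∧ σD < σ r} := by
    rw [heq]; exact measurableSet_Icc.diff hm2
  have hun : Icc 0 R = {r : ℝ | r ∈ Icc (0:ℝ) R ∧ σD < σ r} ∪
      {r : ℝ | r ∈ Icc (0:ℝ) R ∧ σ r ≤ σD} := by
    rw [heq, diff_union_of_subset]; exact fun r hr => hr.1
  have hdis : Disjoint {r : ℝ | r ∈ Icc (0:ℝ) R ∧ σD < σ r}
      {r : ℝ | r ∈ Icc (0:ℝ) R ∧ σ r ≤ σD} := by
    rw [heq]; exact disjoint_sdiff_left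
  unfold Gavg
  congr 1
  conv_rhs => rw [hun]
  rw [setIntegral_union hdis hm2 (hi.mono_set fun r hr => hr.1) (hi.mono_set fun r hr => hr.1),
    sub_eq_add_neg]
  congr 1
  · refine setIntegral_congr_fun hm1 fun r hr => ?_
    simp only [Sfun, if_pos hr.2]; ring
  · rw [← neg_mul, ← integral_const_mul]
    refine setIntegral_congr_fun hm2 fun r hr => ?_
    simp only [Sfun, if_neg (not_lt.2 hr.2)]; ring

/-- Under (A1)–(A3), for fixed $R > 0$ the growth average $G(σ̄,R)$ is strictly
increasing in $σ̄$ for $σ̄ > σ_D$. -/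
theorem stmt_11 (β σD ν : ℝ) (hβ : 0 < β) (hσD : 0 < σD) (hν : 0 < ν)
    (f g : ℝ → ℝ) (hf : C1StrictInc f) (hf0 : f 0 = 0)
    (hg : C1StrictInc g) (hgz : ∃ σt > σD, g σt = 0) (hgν : 0 ≤ g σD + ν)
    (R : ℝ) (hR : 0 < R) (σbar₁ σbar₂ : ℝ) (h₁ : σD < σbar₁) (h₁₂ : σbar₁ < σbar₂)
    (σ₁ σ₁' σ₂ σ₂' : ℝ → ℝ)
    (hsol₁ : IsStationarySol f β σD σbar₁ R σ₁ σ₁')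
    (hsol₂ : IsStationarySol f β σD σbar₂ R σ₂ σ₂') :
    Gavg g σD ν R σ₁ < Gavg g σD ν R σ₂ := by
  obtain ⟨hFm, hFn⟩ := aux_F f σD hσD hf.2 hf0
  have hSm := aux_S g σD ν hσD hg.2 hgν
  set F : ℝ → ℝ := fun s => f s * Hside (s - σD) with hF
  have hode : ∀ σ σ' σbar, IsStationarySol f β σD σbar R σ σ' → ∀ r ∈ Ioc (0:ℝ) R,
      r ^ 2 * σ' r = ∫ l in (0:ℝ)..r, l ^ 2 * F (σ l) := by
    intro σ σ' σbar h r hr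
    rw [h.ode r hr]
    simp only [hF, mul_assoc]
  have hII : ∀ σ, ContinuousOn σ (Icc 0 R) → ∀ a b, 0 ≤ a → a ≤ b → b ≤ R →
      IntervalIntegrable (fun l => l ^ 2 * F (σ l)) volume a b := by
    intro σ hc a b ha hab hb
    rw [intervalIntegrable_iff_integrableOn_Icc_of_le hab]
    exact (aux_int F σ R hFm hc).mono_set (Icc_subset_Icc ha hb)
  have hc1 := hsol₁.cont
  have hc2 := hsol₂.cont
  have hD1 := hode _ _ _ hsol₁
  have hD2 := hode _ _ _ hsol₂
  have hrob1 := hsol₁.robin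
  have hrob2 := hsol₂.robin
  have hRR : R ∈ Icc (0:ℝ) R := ⟨hR.le, le_rfl⟩
  -- comparison
  have hw : ∀ r ∈ Icc (0:ℝ) R, 0 ≤ σ₂ r - σ₁ r := by
    refine aux_nonneg (fun r => σ₂ r - σ₁ r) (fun r => σ₂' r - σ₁' r)
      (fun r => (∫ l in (0:ℝ)..r, l ^ 2 * F (σ₂ l)) - ∫ l in (0:ℝ)..r, l ^ 2 * F (σ₁ l)) R hR
      (hc2.sub hc1) (fun r hr => (hsol₂.deriv r hr).sub (hsol₁.deriv r hr)) ?_ (by simp) ?_ ?_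
    · intro r hr
      simp only [← hD1 r hr, ← hD2 r hr]; ring
    · intro a b ha hab hb hneg
      have e1 := intervalIntegral.integral_add_adjacent_intervals
        (hII σ₁ hc1 0 a le_rfl ha (hab.trans hb)) (hII σ₁ hc1 a b ha hab hb)
      have e2 := intervalIntegral.integral_add_adjacent_intervals
        (hII σ₂ hc2 0 a le_rfl ha (hab.trans hb)) (hII σ₂ hc2 a b ha hab hb)
      have := intervalIntegral.integral_mono_on_of_le_Ioo hab (hII σ₂ hc2 a b ha hab hb)
        (hII σ₁ hc1 a b ha hab hb) (fun r hr =>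
          mul_le_mul_of_nonneg_left (hFm (by linarith [hneg r hr])) (sq_nonneg r))
      linarith
    · intro h
      nlinarith
  -- strictness at R
  have hwR : 0 < σ₂ R - σ₁ R := by
    rcases (hw R hRR).lt_or_eq with h | h
    · exact h
    exfalso
    have hd : HasDerivWithinAt (fun r => σ₂ r - σ₁ r) (σ₂' R - σ₁' R) (Icc 0 R) R :=
      (hsol₂.deriv R ⟨hR, le_rfl⟩).sub (hsol₁.deriv R ⟨hR, le_rfl⟩)
    have hpos : 0 < σ₂' R - σ₁' R := by nlinarith
    have hI : Tendsto (slope (fun r => σ₂ r - σ₁ r) R) (𝓝[Ioo 0 R] R)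
        (𝓝 (σ₂' R - σ₁' R)) := by
      rw [hasDerivWithinAt_iff_tendsto_slope] at hd
      exact hd.mono_left (nhdsWithin_mono _ fun r hr => ⟨⟨hr.1.le, hr.2.le⟩, hr.2.ne⟩)
    haveI : (𝓝[Ioo 0 R] R).NeBot := right_nhdsWithin_Ioo_neBot hR
    obtain ⟨r, hr1, hr2⟩ := ((hI.eventually (lt_mem_nhds hpos)).and self_mem_nhdsWithin).exists
    rw [slope_def_field, ← h] at hr1
    have h3 := hw r ⟨hr2.1.le, hr2.2.le⟩
    have : (σ₂ r - σ₁ r - 0) / (r - R) ≤ 0 :=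
      div_nonpos_of_nonneg_of_nonpos (by linarith) (by linarith [hr2.2])
    linarith
  have hσ1R : σD < σ₁ R := by
    by_contra! hle
    have hmono := aux_mono σ₁ σ₁' _ R hc1 hsol₁.deriv hD1 0 R le_rfl le_rfl (fun r hr =>
      intervalIntegral.integral_nonneg hr.1.le (fun l _ => mul_nonneg (sq_nonneg l) (hFn _)))
    have hz : ∫ l in (0:ℝ)..R, l ^ 2 * F (σ₁ l) = 0 := by
      rw [intervalIntegral.integral_congr (g := fun _ => (0:ℝ))]
      · simp
      · intro l hl
        rw [uIcc_of_le hR.le] at hl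
        have h1 := hmono hl hRR hl.2
        have h2 : Hside (σ₁ l - σD) = 0 := if_neg (by linarith)
        simp [hF, h2]
    have h0 := hD1 R ⟨hR, le_rfl⟩
    rw [hz] at h0
    have h1 : σ₁' R = 0 := by
      rcases mul_eq_zero.1 h0 with h | h
      · exact absurd h (by positivity)
      · exact h
    rw [h1] at hrob1
    nlinarith
  -- strict integral comparison
  rw [aux_G g σ₁ σD ν R hSm hc1, aux_G g σ₂ σD ν R hSm hc2]
  have hi1 := aux_int _ σ₁ R hSm hc1
  have hi2 := aux_int _ σ₂ R hSm hc2
  refine mul_lt_mul_of_pos_left ?_ (by positivity)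
  rw [← sub_pos, ← integral_sub hi2 hi1]
  have hnn : ∀ r ∈ Icc (0:ℝ) R,
      0 ≤ r ^ 2 * Sfun g σD ν (σ₂ r) - r ^ 2 * Sfun g σD ν (σ₁ r) := fun r hr => by
    have := mul_le_mul_of_nonneg_left (hSm (show σ₁ r ≤ σ₂ r by linarith [hw r hr])) (sq_nonneg r)
    linarith
  rw [setIntegral_pos_iff_support_of_nonneg_ae
    ((ae_restrict_iff' measurableSet_Icc).2 (ae_of_all _ hnn)) (hi2.sub hi1)]
  have hev : ∀ᶠ r in 𝓝[Icc 0 R] R, σD < σ₁ r ∧ 0 < σ₂ r - σ₁ r :=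
    ((hc1 R hRR).eventually (lt_mem_nhds hσ1R)).and
      (((hc2 R hRR).sub (hc1 R hRR)).eventually (lt_mem_nhds hwR))
  have hev2 : ∀ᶠ r in 𝓝[≤] R, σD < σ₁ r ∧ 0 < σ₂ r - σ₁ r := by
    rwa [nhdsWithin_Icc_eq_nhdsLE hR] at hev
  obtain ⟨a, ha, hsub⟩ := (mem_nhdsLE_iff_exists_Ioc_subset' hR).1 hev2
  have hlt : max a 0 < R := max_lt ha hR
  refine lt_of_lt_of_le (b := volume (Ioo (max a 0) R)) (by simp [ha.out, hR]) (measure_mono ?_)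
  intro r hr
  have hra : a < r := (le_max_left _ _).trans_lt hr.1
  have hr0 : 0 < r := (le_max_right _ _).trans_lt hr.1
  obtain ⟨h3, h4⟩ := hsub ⟨hra, hr.2.le⟩
  refine ⟨?_, hr0.le, hr.2.le⟩
  rw [Function.mem_support]
  have hs1 : Sfun g σD ν (σ₁ r) = g (σ₁ r) := if_pos h3
  have hs2 : Sfun g σD ν (σ₂ r) = g (σ₂ r) := if_pos (by linarith)
  have hgl : g (σ₁ r) < g (σ₂ r) :=
    hg.2 (by simp; linarith) (by simp; linarith) (by linarith)
  rw [hs1, hs2, ← mul_sub]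
  have : 0 < r ^ 2 * (g (σ₂ r) - g (σ₁ r)) := mul_pos (by positivity) (by linarith)
  exact this.ne'
end
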